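/- Under the assumptions of Theorem 1.1 (positive cylindrical weak solution (u,v) of −Δ_ℍu = f(v), −Δ_ℍv = g(u) with f,g continuous, nondecreasing on (0,∞), and f(t)/t^{(Q+2)/(Q−2)}, g(t)/t^{(Q+2)/(Q−2)} nonincreasing on (0,∞)), define λ₁ := inf{λ > 0 : U_μ(ξ) ≤ 0 and V_μ(ξ) ≤ 0 for all ξ ∈ Σ_μ∖{0_μ} and all μ ≥ λ}. If λ₁ > 0, then U_{λ₁} ≡ 0 and V_{λ₁} ≡ 0 on Σ_{λ₁}∖{0_{λ₁}}. -/

import Mathlib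

open MeasureTheory Real Filter Set Topology

noncomputable section

namespace Heisenberg

/-- The underlying space of the Heisenberg group `ℍⁿ`, identified with `ℝⁿ × ℝⁿ × ℝ`
(equipped with Lebesgue measure, which is the Haar measure of `ℍⁿ`). -/
abbrev H (n : ℕ) : Type := (Fin n → ℝ) × (Fin n → ℝ) × ℝ

variable {n : ℕ}

/-- `|x|² + |y|²` for `ξ = (x, y, t)`. -/
def rsq (ξ : H n) : ℝ := ∑ i, (ξ.1 i) ^ 2 + ∑ i, (ξ.2.1 i) ^ 2

/-- The Kaplan gauge `|ξ|_ℍ = ((|x|²+|y|²)² + t²)^{1/4}`. -/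
def gaugeH (ξ : H n) : ℝ := ((rsq ξ) ^ 2 + (ξ.2.2) ^ 2) ^ ((4 : ℝ)⁻¹)

/-- The left-invariant vector field `Xᵢ = ∂_{xᵢ} + 2yᵢ∂_t` applied to `φ`. -/
def Xd (i : Fin n) (φ : H n → ℝ) (ξ : H n) : ℝ :=
  fderiv ℝ φ ξ (Pi.single i 1, 0, 2 * ξ.2.1 i)

/-- The left-invariant vector field `Yᵢ = ∂_{yᵢ} − 2xᵢ∂_t` applied to `φ`. -/
def Yd (i : Fin n) (φ : H n → ℝ) (ξ : H n) : ℝ :=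
  fderiv ℝ φ ξ (0, Pi.single i 1, -(2 * ξ.1 i))

/-- The horizontal gradient `∇_ℍ φ = (X₁φ,…,Xₙφ,Y₁φ,…,Yₙφ)` of a differentiable function. -/
def hGrad (φ : H n → ℝ) (ξ : H n) : (Fin n → ℝ) × (Fin n → ℝ) :=
  (fun i => Xd i φ ξ, fun i => Yd i φ ξ)

/-- Euclidean pairing of two horizontal vectors. -/
def hdot (a b : (Fin n → ℝ) × (Fin n → ℝ)) : ℝ :=
  ∑ i, a.1 i * b.1 i + ∑ i, a.2 i * b.2 i

/-- The (pointwise, classical) sub-Laplacian `Δ_ℍ = ∑ᵢ (Xᵢ² + Yᵢ²)`. -/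
def subLap (u : H n → ℝ) (ξ : H n) : ℝ :=
  ∑ i, Xd i (Xd i u) ξ + ∑ i, Yd i (Yd i u) ξ

/-- `φ ∈ C¹_c(Ω)`. -/
structure IsTest (Ω : Set (H n)) (φ : H n → ℝ) : Prop where
  contDiff : ContDiff ℝ 1 φ
  compactSupport : HasCompactSupport φ
  supportSubset : tsupport φ ⊆ Ω

/-- `G` is a weak horizontal gradient of `u` on `Ω`, with `u` locally integrable on `Ω`
and `G` locally square-integrable on `Ω` (i.e. `u ∈ H¹_loc(Ω)` with horizontal gradient `G`). -/
structure IsWeakHGrad (Ω : Set (H n)) (u : H n → ℝ)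
    (G : H n → (Fin n → ℝ) × (Fin n → ℝ)) : Prop where
  locInt : LocallyIntegrableOn u Ω
  locSq : ∀ K : Set (H n), K ⊆ Ω → IsCompact K → IntegrableOn (fun ξ => ‖G ξ‖ ^ 2) K
  ibpX : ∀ i : Fin n, ∀ φ : H n → ℝ, IsTest Ω φ →
    ∫ ξ, u ξ * Xd i φ ξ = -∫ ξ, (G ξ).1 i * φ ξ
  ibpY : ∀ i : Fin n, ∀ φ : H n → ℝ, IsTest Ω φ →
    ∫ ξ, u ξ * Yd i φ ξ = -∫ ξ, (G ξ).2 i * φ ξ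

/-- `u ∈ H¹_loc(Ω)` is a weak solution of `−Δ_ℍ u = F` on `Ω`:
`∫ ∇_ℍu · ∇_ℍφ = ∫ F φ` for all `φ ∈ C¹_c(Ω)`. -/
def IsWeakSol (Ω : Set (H n)) (u F : H n → ℝ) : Prop :=
  ∃ G : H n → (Fin n → ℝ) × (Fin n → ℝ), IsWeakHGrad Ω u G ∧
    ∀ φ : H n → ℝ, IsTest Ω φ → ∫ ξ, hdot (G ξ) (hGrad φ ξ) = ∫ ξ, F ξ * φ ξ

/-- A function on `ℍⁿ` is cylindrical if it depends only on `r = √(|x|²+|y|²)` and `t`. -/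
def IsCylindrical (u : H n → ℝ) : Prop :=
  ∀ ξ ξ' : H n, rsq ξ = rsq ξ' → ξ.2.2 = ξ'.2.2 → u ξ = u ξ'

/-- The CR-inverted point `ξ̃`. -/
def tilde (ξ : H n) : H n :=
  (fun i => (ξ.1 i * ξ.2.2 + ξ.2.1 i * rsq ξ) / gaugeH ξ ^ 4,
   fun i => (ξ.2.1 i * ξ.2.2 - ξ.1 i * rsq ξ) / gaugeH ξ ^ 4,
   -ξ.2.2 / gaugeH ξ ^ 4)

/-- The CR inversion `ū(ξ) = |ξ|_ℍ^{−(Q−2)} u(ξ̃)`, where `Q − 2 = 2n`. -/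
def crInv (u : H n → ℝ) (ξ : H n) : ℝ := u (tilde ξ) / gaugeH ξ ^ (2 * n)

/-- The critical exponent `τ = (Q+2)/(Q−2)` with `Q = 2n+2`. -/
def tau (n : ℕ) : ℝ := (2 * (n : ℝ) + 4) / (2 * (n : ℝ))

/-- The half space `Σ_λ = {ξ = (x,y,t) : t > λ}`. -/
def Sig (l : ℝ) : Set (H n) := {ξ | l < ξ.2.2}

/-- The H-reflection `ξ_λ = (y, x, 2λ − t)` with respect to the plane `T_λ = {t = λ}`. -/
def hRefl (l : ℝ) (ξ : H n) : H n := (ξ.2.1, ξ.1, 2 * l - ξ.2.2)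

/-- The point `0_λ = (0, 0, 2λ)`. -/
def zl (l : ℝ) : H n := (0, 0, 2 * l)

/-- `U_λ = ū − ū_λ`, where `ū` is the CR inversion of `u` and `ū_λ(ξ) = ū(ξ_λ)`. -/
def Ulam (u : H n → ℝ) (l : ℝ) (ξ : H n) : ℝ := crInv u ξ - crInv u (hRefl l ξ)

/-- `w ∈ L^{τ+1}(Σ_λ) ∩ L^∞(Σ_λ)`. -/
def MemLtau1Linf (l : ℝ) (w : H n → ℝ) : Prop :=
  IntegrableOn (fun ξ => |w ξ| ^ (tau n + 1)) (Sig l) ∧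
    ∃ M : ℝ, ∀ ξ ∈ Sig (n := n) l, |w ξ| ≤ M

/-- `w ∈ H¹(Ω)`: square integrable on `Ω`, with a weak horizontal gradient which is
square integrable on `Ω`. -/
def MemH1 (Ω : Set (H n)) (w : H n → ℝ) : Prop :=
  IntegrableOn (fun ξ => (w ξ) ^ 2) Ω ∧
  ∃ G : H n → (Fin n → ℝ) × (Fin n → ℝ),
    IntegrableOn (fun ξ => ‖G ξ‖ ^ 2) Ω ∧
    (∀ i : Fin n, ∀ φ : H n → ℝ, IsTest Ω φ →
      ∫ ξ, w ξ * Xd i φ ξ = -∫ ξ, (G ξ).1 i * φ ξ) ∧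
    (∀ i : Fin n, ∀ φ : H n → ℝ, IsTest Ω φ →
      ∫ ξ, w ξ * Yd i φ ξ = -∫ ξ, (G ξ).2 i * φ ξ)

end Heisenberg

namespace Heisenberg


section

variable {n : ℕ}

/-! ### Radial test functions -/

/-- Radial profile data: `χ` of class `C²` with derivatives `χ1`, `χ2`, vanishing beyond `1 + η`. -/
structure IsRad (η : ℝ) (χ χ1 χ2 : ℝ → ℝ) : Prop where
  d1 : ∀ c, HasDerivAt χ (χ1 c) c
  d2 : ∀ c, HasDerivAt χ1 (χ2 c) c
  cont : Continuous χ2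
  z0 : ∀ c, 1 + η ≤ c → χ c = 0
  z1 : ∀ c, 1 + η ≤ c → χ1 c = 0
  z2 : ∀ c, 1 + η ≤ c → χ2 c = 0

lemma hasDerivAt_max_sq (y : ℝ) :
    HasDerivAt (fun y : ℝ => (max 0 y) ^ 2) (2 * max 0 y) y := by
  rcases lt_trichotomy y 0 with h | h | h
  · have : (fun y : ℝ => (max 0 y) ^ 2) =ᶠ[𝓝 y] fun _ => 0 := by
      filter_upwards [gt_mem_nhds h] with z hz
      simp [max_eq_left hz.le]
    rw [max_eq_left h.le, mul_zero]
    exact (hasDerivAt_const y (0 : ℝ)).congr_of_eventuallyEq this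
  · subst h
    rw [hasDerivAt_iff_isLittleO]
    simp only [max_self, mul_zero, sub_zero, smul_eq_mul]
    have h1 : (fun x : ℝ => (max 0 x) ^ 2 - 0 ^ 2) =O[𝓝 0] fun x => x ^ 2 := by
      apply Asymptotics.IsBigO.of_bound 1
      filter_upwards with x
      rw [one_mul, zero_pow two_ne_zero, sub_zero, Real.norm_of_nonneg (by positivity), Real.norm_of_nonneg (by positivity)]
      rcases le_total 0 x with hx | hx
      · simp [max_eq_right hx]
      · rw [max_eq_left hx]; nlinarith
    have h2 : (fun x : ℝ => x ^ 2) =o[𝓝 0] fun x => x := by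
      simpa using Asymptotics.isLittleO_pow_id (𝕜 := ℝ) (one_lt_two)
    exact h1.trans_isLittleO h2
  · have : (fun y : ℝ => (max 0 y) ^ 2) =ᶠ[𝓝 y] fun z => z ^ 2 := by
      filter_upwards [lt_mem_nhds h] with z hz
      simp [max_eq_right hz.le]
    rw [max_eq_right h.le]
    simpa using (hasDerivAt_pow 2 y).congr_of_eventuallyEq this

/-- The flux profile. -/
def Jf (η ε c : ℝ) : ℝ :=
  smoothTransition ((c - 1) / ε - 1) * (max 0 (1 - √((c - 1) / η))) ^ 2

/-- Its derivative. -/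
def Jd (η ε c : ℝ) : ℝ :=
  deriv smoothTransition ((c - 1) / ε - 1) / ε * (max 0 (1 - √((c - 1) / η))) ^ 2
    - smoothTransition ((c - 1) / ε - 1) * (max 0 (1 - √((c - 1) / η)) / (η * √((c - 1) / η)))

lemma deriv_st_neg {y : ℝ} (hy : y < 0) : deriv smoothTransition y = 0 := by
  have : smoothTransition =ᶠ[𝓝 y] fun _ => 0 := by
    filter_upwards [gt_mem_nhds hy] with z hz
    exact smoothTransition.zero_of_nonpos hz.le
  rw [this.deriv_eq]; simp

lemma st_arg_neg {ε c : ℝ} (hε : 0 < ε) (hc : c < 1 + ε) : (c - 1) / ε - 1 < 0 := by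
  rw [sub_neg, div_lt_one hε]; linarith

lemma Jf_zero {η ε c : ℝ} (hε : 0 < ε) (hc : c < 1 + ε) : Jf η ε c = 0 := by
  rw [Jf, smoothTransition.zero_of_nonpos (st_arg_neg hε hc).le, zero_mul]

lemma Jd_zero {η ε c : ℝ} (hε : 0 < ε) (hc : c < 1 + ε) : Jd η ε c = 0 := by
  rw [Jd, smoothTransition.zero_of_nonpos (st_arg_neg hε hc).le, deriv_st_neg (st_arg_neg hε hc)]
  simp

lemma Jf_zero' {η ε c : ℝ} (hη : 0 < η) (hc : 1 + η ≤ c) : Jf η ε c = 0 := by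
  have : 1 ≤ √((c - 1) / η) := by
    rw [Real.one_le_sqrt, one_le_div hη]; linarith
  rw [Jf, max_eq_left (by linarith)]; simp

lemma Jd_zero' {η ε c : ℝ} (hη : 0 < η) (hc : 1 + η ≤ c) : Jd η ε c = 0 := by
  have : 1 ≤ √((c - 1) / η) := by
    rw [Real.one_le_sqrt, one_le_div hη]; linarith
  rw [Jd, max_eq_left (by linarith)]; simp

lemma Jf_nonneg (η ε c : ℝ) : 0 ≤ Jf η ε c :=
  mul_nonneg (smoothTransition.nonneg _) (by positivity)

lemma st_hasDerivAt (y : ℝ) : HasDerivAt smoothTransition (deriv smoothTransition y) y :=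
  ((smoothTransition.contDiff (n := 1)).differentiable (by norm_num) y).hasDerivAt

lemma st_deriv_cont : Continuous (deriv smoothTransition) :=
  (smoothTransition.contDiff (n := 1)).continuous_deriv (by norm_num)

lemma Jf_hasDerivAt {η ε : ℝ} (hη : 0 < η) (hε : 0 < ε) (c : ℝ) :
    HasDerivAt (Jf η ε) (Jd η ε c) c := by
  rcases lt_or_ge c (1 + ε) with h | h
  · rw [Jd_zero hε h]
    refine (hasDerivAt_const c (0 : ℝ)).congr_of_eventuallyEq ?_
    filter_upwards [gt_mem_nhds h] with z hz
    exact Jf_zero hε hz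
  · have hc : 0 < (c - 1) / η := by apply div_pos <;> linarith
    have h1 : HasDerivAt (fun c : ℝ => (c - 1) / ε - 1) (1 / ε) c := by
      simpa using (((hasDerivAt_id c).sub_const 1).div_const ε).sub_const 1
    have h2 : HasDerivAt (fun c : ℝ => (c - 1) / η) (1 / η) c := by
      simpa using (((hasDerivAt_id c).sub_const 1).div_const η)
    have h3 := (h2.sqrt hc.ne').const_sub 1
    have h4 := (hasDerivAt_max_sq (1 - √((c - 1) / η))).comp c h3
    have h5 := (st_hasDerivAt ((c - 1) / ε - 1)).comp c h1
    have h6 := h5.mul h4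
    refine h6.congr_deriv ?_
    have : 0 < √((c - 1) / η) := Real.sqrt_pos.2 hc
    simp only [Jd, Function.comp]
    field_simp
    ring

lemma Jd_contAt {η ε : ℝ} (hη : 0 < η) {c : ℝ} (hc : 1 < c) :
    ContinuousAt (Jd η ε) c := by
  have hc : 0 < (c - 1) / η := by apply div_pos <;> linarith
  have : 0 < √((c - 1) / η) := Real.sqrt_pos.2 hc
  have h1 : Continuous fun c : ℝ => (c - 1) / ε - 1 := by fun_prop
  have h2 : Continuous fun c : ℝ => √((c - 1) / η) := by fun_prop
  have h3 : Continuous fun c : ℝ => max 0 (1 - √((c - 1) / η)) := by fun_prop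
  have h4 : Continuous fun c : ℝ => deriv smoothTransition ((c - 1) / ε - 1) :=
    st_deriv_cont.comp h1
  have h5 : Continuous fun c : ℝ => smoothTransition ((c - 1) / ε - 1) :=
    smoothTransition.continuous.comp h1
  unfold Jd
  refine ContinuousAt.sub (by fun_prop) (h5.continuousAt.mul (h3.continuousAt.div (by fun_prop) ?_))
  positivity

/-- `k = J / (c² - 1)`. -/
def kf (η ε c : ℝ) : ℝ := Jf η ε c / (c ^ 2 - 1)

/-- derivative of `kf`. -/
def kd (η ε c : ℝ) : ℝ := (Jd η ε c * (c ^ 2 - 1) - Jf η ε c * (2 * c)) / (c ^ 2 - 1) ^ 2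

lemma kf_hasDerivAt {η ε : ℝ} (hη : 0 < η) (hε : 0 < ε) (c : ℝ) :
    HasDerivAt (kf η ε) (kd η ε c) c := by
  rcases lt_or_ge c (1 + ε) with h | h
  · rw [kd, Jd_zero hε h, Jf_zero hε h]
    simp only [zero_mul, sub_zero, zero_div]
    refine (hasDerivAt_const c (0 : ℝ)).congr_of_eventuallyEq ?_
    filter_upwards [gt_mem_nhds h] with z hz
    rw [kf, Jf_zero hε hz, zero_div]
  · have hc : c ^ 2 - 1 ≠ 0 := by nlinarith
    have h1 : HasDerivAt (fun c : ℝ => c ^ 2 - 1) (2 * c) c := by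
      simpa using (hasDerivAt_pow 2 c).sub_const 1
    exact (Jf_hasDerivAt hη hε c).div h1 hc

lemma kf_cont {η ε : ℝ} (hη : 0 < η) (hε : 0 < ε) : Continuous (kf η ε) :=
  continuous_iff_continuousAt.2 fun c => (kf_hasDerivAt hη hε c).continuousAt

lemma kd_cont {η ε : ℝ} (hη : 0 < η) (hε : 0 < ε) : Continuous (kd η ε) := by
  refine continuous_iff_continuousAt.2 fun c => ?_
  rcases lt_or_ge c (1 + ε) with h | h
  · have : (fun _ => (0 : ℝ)) =ᶠ[𝓝 c] kd η ε := by
      filter_upwards [gt_mem_nhds h] with z hz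
      rw [kd, Jf_zero hε hz, Jd_zero hε hz]; simp
    exact continuousAt_const.congr this
  · have hc : c ^ 2 - 1 ≠ 0 := by nlinarith
    have h1 := Jd_contAt (ε := ε) hη (c := c) (by linarith)
    have h2 := (Jf_hasDerivAt hη hε c).continuousAt
    unfold kd
    refine ContinuousAt.div (by fun_prop) (by fun_prop) (by positivity)

lemma kf_nonneg {η ε : ℝ} (hε : 0 < ε) (c : ℝ) : 0 ≤ kf η ε c := by
  rcases lt_or_ge c (1 + ε) with h | h
  · rw [kf, Jf_zero hε h, zero_div]
  · exact div_nonneg (Jf_nonneg _ _ _) (by nlinarith)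

/-- The potential profile. -/
def chi (η ε c : ℝ) : ℝ := - ∫ a in (1 + η)..c, kf η ε a

lemma chi_hasDerivAt {η ε : ℝ} (hη : 0 < η) (hε : 0 < ε) (c : ℝ) :
    HasDerivAt (chi η ε) (- kf η ε c) c :=
  ((kf_cont hη hε).integral_hasStrictDerivAt _ c).hasDerivAt.neg

lemma chi_zero {η ε : ℝ} (hη : 0 < η) {c : ℝ} (hc : 1 + η ≤ c) : chi η ε c = 0 := by
  rw [chi, neg_eq_zero]
  have : ∀ a ∈ Set.uIcc (1 + η) c, kf η ε a = 0 := by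
    intro a ha
    rw [Set.uIcc_of_le hc] at ha
    rw [kf, Jf_zero' hη ha.1, zero_div]
  rw [intervalIntegral.integral_congr this]; simp

lemma chi_nonneg {η ε : ℝ} (hη : 0 < η) (hε : 0 < ε) (c : ℝ) : 0 ≤ chi η ε c := by
  rcases le_total (1 + η) c with h | h
  · rw [chi_zero hη h]
  · rw [chi, intervalIntegral.integral_symm, neg_neg]
    exact intervalIntegral.integral_nonneg h fun u _ => kf_nonneg hε u

lemma chi_le {η ε : ℝ} (hη : 0 < η) (hε : 0 < ε) {c : ℝ} (h1 : 1 < c) (h2 : c ≤ 1 + η) :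
    chi η ε c ≤ 1 / √((c - 1) / η) - 1 := by
  have key := intervalIntegral.integral_le_sub_of_hasDeriv_right_of_le (a := c) (b := 1 + η)
    (g := fun a => - (√((a - 1) / η))⁻¹)
    (g' := fun a => (1 / η) / (2 * √((a - 1) / η)) / (√((a - 1) / η)) ^ 2)
    (φ := kf η ε) h2 ?_ ?_ ?_ ?_
  · have e : √((1 + η - 1) / η) = 1 := by
      rw [add_sub_cancel_left, div_self hη.ne', Real.sqrt_one]
    rw [chi, intervalIntegral.integral_symm, neg_neg]
    simp only [e] at key
    simp only [one_div]
    linarith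
  · intro a ha
    have : 0 < √((a - 1) / η) := Real.sqrt_pos.2 (div_pos (by linarith [ha.1]) hη)
    apply ContinuousAt.continuousWithinAt
    have h2 : Continuous fun c : ℝ => √((c - 1) / η) := by fun_prop
    exact (h2.continuousAt.inv₀ this.ne').neg
  · intro a ha
    have hp : 0 < (a - 1) / η := (div_pos (by linarith [ha.1]) hη)
    have : 0 < √((a - 1) / η) := Real.sqrt_pos.2 hp
    have h2 : HasDerivAt (fun c : ℝ => (c - 1) / η) (1 / η) a := by
      simpa using (((hasDerivAt_id a).sub_const 1).div_const η)
    have h3 := ((h2.sqrt hp.ne').inv this.ne').neg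
    refine (h3.congr_deriv ?_).hasDerivWithinAt
    rw [neg_div, neg_neg]
  · exact (kf_cont hη hε).continuousOn.integrableOn_compact isCompact_Icc
  · intro a ha
    have ha1 : 1 < a := by linarith [ha.1]
    have hp : 0 < (a - 1) / η := (div_pos (by linarith [ha.1]) hη)
    have hs : 0 < √((a - 1) / η) := Real.sqrt_pos.2 hp
    have hs2 : √((a - 1) / η) ^ 2 = (a - 1) / η := Real.sq_sqrt hp.le
    have hs1 : √((a - 1) / η) ≤ 1 := by
      refine Real.sqrt_le_iff.2 ⟨zero_le_one, ?_⟩; rw [one_pow, div_le_one hη]; linarith [ha.2]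
    have hJ : Jf η ε a ≤ 1 := by
      unfold Jf
      have h0 : (max 0 (1 - √((a - 1) / η))) ≤ 1 := max_le zero_le_one (by linarith)
      have h0' : 0 ≤ (max 0 (1 - √((a - 1) / η))) := le_max_left _ _
      have := smoothTransition.le_one ((a - 1) / ε - 1)
      have := smoothTransition.nonneg ((a - 1) / ε - 1)
      have h3 : (max 0 (1 - √((a - 1) / η))) ^ 2 ≤ 1 := by nlinarith
      nlinarith [sq_nonneg (max 0 (1 - √((a - 1) / η)))]
    have e1 : kf η ε a ≤ 1 / (2 * (a - 1)) := by
      unfold kf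
      rw [div_le_div_iff₀ (by nlinarith) (by linarith)]
      nlinarith [Jf_nonneg η ε a]
    refine e1.trans ?_
    rw [hs2]
    have : 1 / η / (2 * √((a - 1) / η)) / ((a - 1) / η) = 1 / (2 * (a - 1)) / √((a - 1) / η) := by
      have : a - 1 ≠ 0 := by linarith
      field_simp
    rw [this, le_div_iff₀ hs]
    have : 0 < 1 / (2 * (a - 1)) := by apply div_pos <;> linarith
    nlinarith

lemma chi_const {η ε : ℝ} (hη : 0 < η) (hε : 0 < ε) {c : ℝ} (h : c ≤ 1 + ε) :
    chi η ε c = chi η ε (1 + ε) := by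
  have hi : ∀ a b, IntervalIntegrable (kf η ε) volume a b := fun a b =>
    (kf_cont hη hε).intervalIntegrable a b
  have h1 := intervalIntegral.integral_add_adjacent_intervals (hi (1 + η) c) (hi c (1 + ε))
  have h2 : ∫ a in c..(1 + ε), kf η ε a = 0 := by
    have : ∀ a ∈ Set.uIcc c (1 + ε), kf η ε a = 0 := by
      intro a ha
      rw [Set.uIcc_of_le h] at ha
      have hx : Jf η ε a = 0 := by
        have : (a - 1) / ε - 1 ≤ 0 := by
          rw [sub_nonpos, div_le_one hε]; linarith [ha.2]
        rw [Jf, smoothTransition.zero_of_nonpos this, zero_mul]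
      rw [kf, hx, zero_div]
    rw [intervalIntegral.integral_congr this]; simp
  unfold chi
  linarith

lemma chi_isRad {η ε : ℝ} (hη : 0 < η) (hε : 0 < ε) :
    IsRad η (chi η ε) (fun c => - kf η ε c) (fun c => - kd η ε c) where
  d1 := chi_hasDerivAt hη hε
  d2 c := (kf_hasDerivAt hη hε c).neg
  cont := (kd_cont hη hε).neg
  z0 c hc := chi_zero hη hc
  z1 c hc := by simp [kf, Jf_zero' hη hc]
  z2 c hc := by simp [kd, Jf_zero' hη hc, Jd_zero' hη hc]

lemma chi_D {η ε : ℝ} (hε : 0 < ε) (c : ℝ) :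
    (c ^ 2 - 1) * (- kd η ε c) + 2 * c * (- kf η ε c) = - Jd η ε c := by
  rcases lt_or_ge c (1 + ε) with h | h
  · simp [kd, kf, Jf_zero hε h, Jd_zero hε h]
  · have hc : c ^ 2 - 1 ≠ 0 := by nlinarith
    simp only [kd, kf]
    field_simp
    ring

lemma exists_rad {η m : ℝ} (hη : 0 < η) :
    ∃ C : ℝ, 0 < C ∧ ∀ ε, 0 < ε → 2 * ε < η → ∃ χ χ1 χ2, IsRad η χ χ1 χ2 ∧ (∀ c, 0 ≤ χ c) ∧
      (∀ c, 1 ≤ c → c ≤ 1 + 2 * ε →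
        |(c ^ 2 - 1) * χ2 c + 2 * c * χ1 c - m * χ c| ≤ C / ε) ∧
      (∀ c, 1 + 2 * ε ≤ c → c < 1 + η →
        (1 / √((c - 1) / η) - 1) * (1 / η - |m|) ≤
          (c ^ 2 - 1) * χ2 c + 2 * c * χ1 c - m * χ c) := by
  obtain ⟨A, hA⟩ := isCompact_Icc.exists_bound_of_continuousOn (s := Icc (0 : ℝ) 1)
    st_deriv_cont.continuousOn
  have hA0 : 0 ≤ A := (norm_nonneg _).trans (hA 0 ⟨le_rfl, zero_le_one⟩)
  refine ⟨A + 1 + |m| * η, by positivity, fun ε hε h2 => ⟨chi η ε, _, _, chi_isRad hη hε,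
    chi_nonneg hη hε, fun c hc1 hc2 => ?_, fun c hc1 hc2 => ?_⟩⟩
  · skip
    rw [chi_D hε]
    have hchi : chi η ε c ≤ η / ε := by
      have aux : ∀ c, 1 + ε ≤ c → c ≤ 1 + 2 * ε → chi η ε c ≤ η / ε := by
        intro c h3 h4
        refine (chi_le hη hε (by linarith) (by linarith)).trans ?_
        have hp : 0 < (c - 1) / η := (div_pos (by linarith) hη)
        have hs : 0 < √((c - 1) / η) := Real.sqrt_pos.2 hp
        have hs1 : √((c - 1) / η) ≤ 1 := by
          refine Real.sqrt_le_iff.2 ⟨zero_le_one, ?_⟩; rw [one_pow, div_le_one hη]; linarith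
        have hs2 : √((c - 1) / η) ^ 2 = (c - 1) / η := Real.sq_sqrt hp.le
        have : ε / η ≤ √((c - 1) / η) := by
          have : ε / η ≤ (c - 1) / η := by gcongr; linarith
          nlinarith
        have : 1 / √((c - 1) / η) ≤ η / ε := by
          rw [div_le_div_iff₀ hs hε]
          rw [div_le_iff₀ hη] at this; linarith
        linarith
      rcases le_total c (1 + ε) with h | h
      · rw [chi_const hη hε h]; exact aux _ le_rfl (by linarith)
      · exact aux c h hc2
    have hJd : |Jd η ε c| ≤ (A + 1) / ε := by
      rcases lt_or_ge c (1 + ε) with h | h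
      · rw [Jd_zero hε h, abs_zero]; positivity
      · unfold Jd
        have hp : 0 < (c - 1) / η := (div_pos (by linarith) hη)
        have hs : 0 < √((c - 1) / η) := Real.sqrt_pos.2 hp
        have hs1 : √((c - 1) / η) ≤ 1 := by
          refine Real.sqrt_le_iff.2 ⟨zero_le_one, ?_⟩; rw [one_pow, div_le_one hη]; linarith
        have hs2 : √((c - 1) / η) ^ 2 = (c - 1) / η := Real.sq_sqrt hp.le
        have h5 : ε ≤ η * √((c - 1) / η) := by
          have : ε / η ≤ (c - 1) / η := by gcongr; linarith
          have : ε / η ≤ √((c - 1) / η) := by nlinarith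
          rw [div_le_iff₀ hη] at this; linarith
        have hM0 : 0 ≤ (max 0 (1 - √((c - 1) / η))) := le_max_left _ _
        have hM1 : (max 0 (1 - √((c - 1) / η))) ≤ 1 := max_le zero_le_one (by linarith)
        have hy : (c - 1) / ε - 1 ∈ Icc (0 : ℝ) 1 := by
          constructor
          · rw [sub_nonneg, one_le_div hε]; linarith
          · rw [sub_le_iff_le_add, div_le_iff₀ hε]; linarith
        have hd := hA _ hy
        rw [Real.norm_eq_abs] at hd
        refine (abs_sub _ _).trans ?_
        rw [add_div]
        apply add_le_add
        · rw [abs_mul, abs_div, abs_of_pos hε, abs_of_nonneg (by positivity : 0 ≤ (max 0 (1 - √((c - 1) / η))) ^ 2)]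
          have : (max 0 (1 - √((c - 1) / η))) ^ 2 ≤ 1 := by nlinarith
          calc _ ≤ A / ε * 1 := by gcongr
            _ = _ := mul_one _
        · rw [abs_mul, abs_of_nonneg (smoothTransition.nonneg _), abs_of_nonneg (by positivity)]
          calc _ ≤ 1 * (1 / ε) := by
                gcongr
                exact smoothTransition.le_one _
            _ = _ := one_mul _
    have h6 : |m * chi η ε c| ≤ |m| * η / ε := by
      rw [abs_mul, abs_of_nonneg (chi_nonneg hη hε c), mul_div_assoc]
      gcongr
    calc _ ≤ |-Jd η ε c| + |m * chi η ε c| := abs_sub _ _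
      _ ≤ (A + 1) / ε + |m| * η / ε := by rw [abs_neg]; gcongr
      _ = _ := by ring
  · skip
    rw [chi_D hε]
    have hp : 0 < (c - 1) / η := (div_pos (by linarith) hη)
    have hs : 0 < √((c - 1) / η) := Real.sqrt_pos.2 hp
    have hs1 : √((c - 1) / η) < 1 := by
      rw [Real.sqrt_lt' one_pos, one_pow, div_lt_one hη]; linarith
    have hst : smoothTransition ((c - 1) / ε - 1) = 1 := by
      apply smoothTransition.one_of_one_le
      rw [le_sub_iff_add_le, le_div_iff₀ hε]; linarith
    have hde : deriv smoothTransition ((c - 1) / ε - 1) = 0 := by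
      have : IsLocalMax smoothTransition ((c - 1) / ε - 1) := by
        filter_upwards with z
        rw [hst]; exact smoothTransition.le_one z
      exact this.deriv_eq_zero
    have hJd : - Jd η ε c = (1 / √((c - 1) / η) - 1) * (1 / η) := by
      rw [Jd, hde, hst, max_eq_right (by linarith)]
      field_simp
      ring
    rw [hJd]
    have h1 := chi_le hη hε (c := c) (by linarith) (by linarith)
    have h2 := chi_nonneg hη hε c
    have h3 : m * chi η ε c ≤ |m| * (1 / √((c - 1) / η) - 1) :=
      (mul_le_mul_of_nonneg_right (le_abs_self m) h2).trans
        (mul_le_mul_of_nonneg_left h1 (abs_nonneg m))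
    linarith

/-! ### Two-dimensional geometry -/

/-- The open half plane. -/
def Pp : Set (ℝ × ℝ) := {p | 0 < p.1}

/-- The (cosh of the hyperbolic) distance. -/
def cc (p0 p : ℝ × ℝ) : ℝ := 1 + ((p.1 - p0.1) ^ 2 + (p.2 - p0.2) ^ 2) / (2 * p.1 * p0.1)

/-- Hyperbolic closed ball. -/
def Bc (p0 : ℝ × ℝ) (η : ℝ) : Set (ℝ × ℝ) := {p | 0 < p.1 ∧ cc p0 p ≤ 1 + η}

/-- The radial operator. -/
def Lc (m : ℝ) (χ χ1 χ2 : ℝ → ℝ) (c : ℝ) : ℝ := (c ^ 2 - 1) * χ2 c + 2 * c * χ1 c - m * χ c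

/-- Weak equation tested against radial functions. -/
def WeakRad (m : ℝ) (p0 : ℝ × ℝ) (η : ℝ) (W G : ℝ × ℝ → ℝ) : Prop :=
  ∀ χ χ1 χ2 : ℝ → ℝ, IsRad η χ χ1 χ2 →
    ∫ p in Pp, W p * Lc m χ χ1 χ2 (cc p0 p) / p.1 ^ 2 = ∫ p in Pp, G p * χ (cc p0 p) / p.1 ^ 2

lemma isOpen_Pp : IsOpen Pp := isOpen_lt continuous_const continuous_fst

lemma Pp_pos {p : ℝ × ℝ} (h : p ∈ Pp) : 0 < p.1 := h

lemma cc_le_iff {p0 p : ℝ × ℝ} (h0 : p0 ∈ Pp) (h : p ∈ Pp) (η : ℝ) :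
    cc p0 p ≤ 1 + η ↔ (p.1 - p0.1) ^ 2 + (p.2 - p0.2) ^ 2 ≤ η * (2 * p.1 * p0.1) := by
  have := Pp_pos h0
  have := Pp_pos h
  rw [cc, add_le_add_iff_left, div_le_iff₀ (by positivity)]

lemma one_le_cc {p0 p : ℝ × ℝ} (h0 : p0 ∈ Pp) (h : p ∈ Pp) : 1 ≤ cc p0 p := by
  have := Pp_pos h0
  have := Pp_pos h
  rw [cc]
  have : 0 ≤ ((p.1 - p0.1) ^ 2 + (p.2 - p0.2) ^ 2) / (2 * p.1 * p0.1) := by positivity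
  linarith

lemma cc_self (p0 : ℝ × ℝ) : cc p0 p0 = 1 := by simp [cc]

lemma one_lt_cc {p0 p : ℝ × ℝ} (h0 : p0 ∈ Pp) (h : p ∈ Pp) (hne : p ≠ p0) : 1 < cc p0 p := by
  have h1 := Pp_pos h0
  have h2 := Pp_pos h
  rw [cc]
  have h3 : 0 < (p.1 - p0.1) ^ 2 + (p.2 - p0.2) ^ 2 := by
    by_contra hc
    apply hne
    have e1 : (p.1 - p0.1) = 0 := by
      rw [← sq_eq_zero_iff]; nlinarith [sq_nonneg (p.1 - p0.1), sq_nonneg (p.2 - p0.2)]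
    have e2 : (p.2 - p0.2) = 0 := by
      rw [← sq_eq_zero_iff]; nlinarith [sq_nonneg (p.1 - p0.1), sq_nonneg (p.2 - p0.2)]
    exact Prod.ext (by linarith) (by linarith)
  have : 0 < ((p.1 - p0.1) ^ 2 + (p.2 - p0.2) ^ 2) / (2 * p.1 * p0.1) := by positivity
  linarith

lemma cc_contAt {p0 p : ℝ × ℝ} (h0 : p0 ∈ Pp) (h : p ∈ Pp) : ContinuousAt (cc p0) p := by
  have h1 := Pp_pos h0
  have h2 := Pp_pos h
  unfold cc
  exact continuousAt_const.add (ContinuousAt.div (by fun_prop) (by fun_prop) (by positivity))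

lemma cc_contOn {p0 : ℝ × ℝ} (h0 : p0 ∈ Pp) : ContinuousOn (cc p0) Pp :=
  fun _ h => (cc_contAt h0 h).continuousWithinAt

lemma Bc_low {p0 p : ℝ × ℝ} {η : ℝ} (h0 : p0 ∈ Pp) (h : p ∈ Bc p0 η) :
    p0.1 ≤ 2 * (1 + η) * p.1 := by
  have h1 := Pp_pos h0
  have h2 := Pp_pos h.1
  have h3 := (cc_le_iff h0 h.1 η).1 h.2
  have : p0.1 * p0.1 ≤ (2 * (1 + η) * p.1) * p0.1 := by
    nlinarith [sq_nonneg (p.2 - p0.2), sq_nonneg p.1]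
  exact le_of_mul_le_mul_right this h1

lemma Bc_high {p0 p : ℝ × ℝ} {η : ℝ} (h0 : p0 ∈ Pp) (h : p ∈ Bc p0 η) :
    p.1 ≤ 2 * (1 + η) * p0.1 := by
  have h1 := Pp_pos h0
  have h2 := Pp_pos h.1
  have h3 := (cc_le_iff h0 h.1 η).1 h.2
  have : p.1 * p.1 ≤ (2 * (1 + η) * p0.1) * p.1 := by
    nlinarith [sq_nonneg (p.2 - p0.2), sq_nonneg p0.1]
  exact le_of_mul_le_mul_right this h2

lemma Bc_ball {p0 p : ℝ × ℝ} {η e : ℝ} (h0 : p0 ∈ Pp) (h : p ∈ Bc p0 e) (he : e ≤ η) (he0 : 0 ≤ e) :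
    p ∈ Metric.closedBall p0 (p0.1 * √(4 * (1 + η) * e)) := by
  have h1 := Pp_pos h0
  have h2 := Pp_pos h.1
  have h3 := (cc_le_iff h0 h.1 e).1 h.2
  have h4 := Bc_high h0 h
  have hη : 0 ≤ η := he0.trans he
  have h5 : e * (2 * p.1 * p0.1) ≤ (p0.1 * √(4 * (1 + η) * e)) ^ 2 := by
    rw [mul_pow, Real.sq_sqrt (by positivity)]
    have : p.1 * (2 * p0.1 * e) ≤ (2 * (1 + η) * p0.1) * (2 * p0.1 * e) := by
      apply mul_le_mul_of_nonneg_right _ (by positivity)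
      nlinarith
    nlinarith
  rw [Metric.mem_closedBall, Prod.dist_eq, Real.dist_eq, Real.dist_eq]
  apply max_le
  · apply abs_le_of_sq_le_sq _ (by positivity)
    nlinarith [sq_nonneg (p.2 - p0.2)]
  · apply abs_le_of_sq_le_sq _ (by positivity)
    nlinarith [sq_nonneg (p.1 - p0.1)]

lemma Bc_compact {p0 : ℝ × ℝ} {η : ℝ} (h0 : p0 ∈ Pp) (hη : 0 < η) : IsCompact (Bc p0 η) := by
  have h1 := Pp_pos h0
  have e : Bc p0 η = Metric.closedBall p0 (p0.1 * √(4 * (1 + η) * η)) ∩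
      ({p | 0 ≤ p.1} ∩ {p | (p.1 - p0.1) ^ 2 + (p.2 - p0.2) ^ 2 ≤ η * (2 * p.1 * p0.1)}) := by
    ext p
    constructor
    · intro h
      exact ⟨Bc_ball h0 h le_rfl hη.le, h.1.le, (cc_le_iff h0 h.1 η).1 h.2⟩
    · rintro ⟨_, hp, hq⟩
      have hp' : 0 < p.1 := by
        rcases lt_or_eq_of_le (show 0 ≤ p.1 from hp) with h | h
        · exact h
        · exfalso
          rw [mem_ofPred_eq, ← h] at hq
          nlinarith [sq_nonneg (p.2 - p0.2)]
      exact ⟨hp', (cc_le_iff h0 hp' η).2 hq⟩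
  rw [e]
  refine (isCompact_closedBall _ _).inter_right (IsClosed.inter ?_ ?_)
  · exact isClosed_le continuous_const continuous_fst
  · exact isClosed_le (by fun_prop) (by fun_prop)

lemma Bc_sub (p0 : ℝ × ℝ) (η : ℝ) : Bc p0 η ⊆ Pp := fun _ h => h.1

lemma integrableOn_of_compact {F : ℝ × ℝ → ℝ} {K : Set (ℝ × ℝ)} (hF : ContinuousOn F Pp)
    (hK : IsCompact K) (hKP : K ⊆ Pp) (hz : ∀ p ∈ Pp, p ∉ K → F p = 0) :
    IntegrableOn F Pp := by
  have := (hF.mono hKP).integrableOn_compact (μ := volume) hK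
  exact this.of_forall_sdiff_eq_zero isOpen_Pp.measurableSet fun p hp => hz p hp.1 hp.2

lemma IsRad.c1 {η : ℝ} {χ χ1 χ2 : ℝ → ℝ} (h : IsRad η χ χ1 χ2) : Continuous χ1 :=
  continuous_iff_continuousAt.2 fun c => (h.d2 c).continuousAt

lemma IsRad.c0 {η : ℝ} {χ χ1 χ2 : ℝ → ℝ} (h : IsRad η χ χ1 χ2) : Continuous χ :=
  continuous_iff_continuousAt.2 fun c => (h.d1 c).continuousAt

lemma Lc_cont {η m : ℝ} {χ χ1 χ2 : ℝ → ℝ} (h : IsRad η χ χ1 χ2) : Continuous (Lc m χ χ1 χ2) := by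
  have := h.c0
  have := h.c1
  have := h.cont
  unfold Lc
  fun_prop

lemma Lc_zero {η m c : ℝ} {χ χ1 χ2 : ℝ → ℝ} (h : IsRad η χ χ1 χ2) (hc : 1 + η ≤ c) :
    Lc m χ χ1 χ2 c = 0 := by
  simp [Lc, h.z0 c hc, h.z1 c hc, h.z2 c hc]

lemma integrable_rad {p0 : ℝ × ℝ} {η : ℝ} (h0 : p0 ∈ Pp) (hη : 0 < η) {W : ℝ × ℝ → ℝ}
    (hW : ContinuousOn W Pp) {ψ : ℝ → ℝ} (hψ : Continuous ψ) (hz : ∀ c, 1 + η ≤ c → ψ c = 0) :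
    IntegrableOn (fun p => W p * ψ (cc p0 p) / p.1 ^ 2) Pp := by
  refine integrableOn_of_compact ?_ (Bc_compact h0 hη) (Bc_sub _ _) ?_
  · refine ContinuousOn.div (hW.mul (hψ.comp_continuousOn (cc_contOn h0))) (by fun_prop) ?_
    intro p hp
    have := Pp_pos hp
    positivity
  · intro p hp hpn
    have : 1 + η ≤ cc p0 p := by
      by_contra hc
      exact hpn ⟨hp, (not_le.1 hc).le⟩
    rw [hz _ this]; simp

/-- Strong maximum principle, local version. -/
lemma key_max {p0 : ℝ × ℝ} {η m : ℝ} {W G : ℝ × ℝ → ℝ} (h0 : p0 ∈ Pp) (hη : 0 < η)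
    (hm : |m| * η < 1) (hW : ContinuousOn W Pp) (hWn : ∀ p ∈ Bc p0 η, W p ≤ 0) (hW0 : W p0 = 0)
    (hG : ∀ p ∈ Bc p0 η, 0 ≤ G p) (hw : WeakRad m p0 η W G) :
    ∀ p ∈ Pp, cc p0 p < 1 + η → W p = 0 := by
  intro p1 hp1 hc1
  by_contra hne
  have hs0 := Pp_pos h0
  have hs1 := Pp_pos hp1
  have hlt : W p1 < 0 := lt_of_le_of_ne (hWn p1 ⟨hp1, hc1.le⟩) hne
  have hp10 : p1 ≠ p0 := by rintro rfl; exact hne hW0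
  have hc1' : 1 < cc p0 p1 := one_lt_cc h0 hp1 hp10
  have hmη : 0 < 1 / η - |m| := by
    rw [sub_pos, lt_div_iff₀ hη]; exact hm
  obtain ⟨C, hC, hrad⟩ := exists_rad (m := m) hη
  set h : ℝ × ℝ → ℝ := fun p =>
    (-W p) * ((1 / √((cc p0 p - 1) / η) - 1) * (1 / η - |m|)) / p.1 ^ 2 with hdef
  have hsq : ∀ c, 1 < c → c < 1 + η → 0 < 1 / √((c - 1) / η) - 1 := by
    intro c h1 h2
    have hp : 0 < √((c - 1) / η) := Real.sqrt_pos.2 (div_pos (by linarith) hη)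
    rw [sub_pos, lt_div_iff₀ hp, one_mul, Real.sqrt_lt' one_pos, one_pow, div_lt_one hη]
    linarith
  have hcont : ContinuousAt h p1 := by
    have e1 : ContinuousAt W p1 := hW.continuousAt (isOpen_Pp.mem_nhds hp1)
    have e2 := cc_contAt h0 hp1
    have e3 : ContinuousAt (fun p => √((cc p0 p - 1) / η)) p1 := by fun_prop
    have e4 : √((cc p0 p1 - 1) / η) ≠ 0 :=
      (Real.sqrt_pos.2 (div_pos (by linarith) hη)).ne'
    refine ContinuousAt.div (e1.neg.mul (((continuousAt_const.div e3 e4).sub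
      continuousAt_const).mul continuousAt_const)) (by fun_prop) (by positivity)
  have hpos : 0 < h p1 := by
    have := hsq _ hc1' hc1
    have : 0 < - W p1 := by linarith
    simp only [hdef]; positivity
  obtain ⟨b, hb0, hb1⟩ := exists_between hpos
  obtain ⟨δ, hδ0, hδ1⟩ : ∃ δ, 0 < δ ∧ 1 + δ < cc p0 p1 := ⟨(cc p0 p1 - 1) / 2, by linarith, by linarith⟩
  have hev : ∀ᶠ p in 𝓝 p1, b < h p ∧ 1 + δ < cc p0 p ∧ cc p0 p < 1 + η ∧ p ∈ Pp :=
    ((hcont.eventually_const_lt hb1).and (((cc_contAt h0 hp1).eventually_const_lt hδ1).and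
      (((cc_contAt h0 hp1).eventually_lt_const hc1).and (isOpen_Pp.mem_nhds hp1))))
  obtain ⟨r, hr, hV⟩ := Metric.eventually_nhds_iff_ball.1 hev
  set V := Metric.ball p1 r with hVdef
  have hVpos : 0 < volume.real V := by
    rw [Measure.real, ENNReal.toReal_pos_iff]
    exact ⟨Metric.measure_ball_pos _ _ hr, measure_ball_lt_top⟩
  set M : ℝ := (2 * (1 + η) / p0.1) ^ 2 with hM
  -- choose omega
  set T : ℝ := C * M * (32 * (1 + η) * p0.1 ^ 2) with hT
  have hTpos : 0 < T := by positivity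
  obtain ⟨ω, hω0, hω1⟩ : ∃ ω, 0 < ω ∧ ω * T < b * volume.real V := by
    refine ⟨b * volume.real V / (2 * T), by positivity, ?_⟩
    have : b * volume.real V / (2 * T) * T = b * volume.real V / 2 := by field_simp
    rw [this]; have : 0 < b * volume.real V := by positivity
    linarith
  have hWc : ContinuousAt W p0 := hW.continuousAt (isOpen_Pp.mem_nhds h0)
  obtain ⟨ρ, hρ, hWρ⟩ := Metric.continuousAt_iff.1 hWc ω hω0
  obtain ⟨ε, hε, hε1, hε2, hε3⟩ : ∃ ε, 0 < ε ∧ 2 * ε < η ∧ 2 * ε < δ ∧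
      p0.1 * √(4 * (1 + η) * (2 * ε)) < ρ := by
    have t : Tendsto (fun ε : ℝ => p0.1 * √(4 * (1 + η) * (2 * ε))) (𝓝[>] 0) (𝓝 0) := by
      have : ContinuousAt (fun ε : ℝ => p0.1 * √(4 * (1 + η) * (2 * ε))) 0 := by fun_prop
      have := this.tendsto
      simp only [mul_zero, Real.sqrt_zero] at this
      exact this.mono_left nhdsWithin_le_nhds
    have q1 : ∀ᶠ x in 𝓝[>] (0:ℝ), x ∈ Ioo 0 (η / 2) := Ioo_mem_nhdsGT (by positivity)
    have q2 : ∀ᶠ x in 𝓝[>] (0:ℝ), x ∈ Ioo 0 (δ / 2) := Ioo_mem_nhdsGT (by positivity)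
    obtain ⟨ε, h1, h2, h3⟩ := ((t.eventually_lt_const hρ).and (q1.and q2)).exists
    exact ⟨ε, h2.1, by linarith [h2.2], by linarith [h3.2], h1⟩
  obtain ⟨χ, χ1, χ2, hχ, hχ0, hχa, hχb⟩ := hrad ε hε hε1
  have hχ' := hw χ χ1 χ2 hχ
  set R := Metric.closedBall p0 (p0.1 * √(4 * (1 + η) * (2 * ε))) with hR
  set E : ℝ × ℝ → ℝ := fun p => R.indicator (fun _ => ω * (C / ε) * M) p
    - V.indicator (fun _ => b) p with hE
  have hRf : volume R ≠ ⊤ := (measure_closedBall_lt_top).ne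
  have hVf : volume V ≠ ⊤ := (measure_ball_lt_top).ne
  have hRm : MeasurableSet R := Metric.isClosed_closedBall.measurableSet
  have hVm : MeasurableSet V := Metric.isOpen_ball.measurableSet
  have hi1 : Integrable (R.indicator (fun _ => ω * (C / ε) * M)) (volume : Measure (ℝ × ℝ)) := by
    rw [integrable_indicator_iff hRm]; exact integrableOn_const hRf
  have hi2 : Integrable (V.indicator (fun _ => b)) (volume : Measure (ℝ × ℝ)) := by
    rw [integrable_indicator_iff hVm]; exact integrableOn_const hVf
  have hEi : Integrable E := hi1.sub hi2
  have hEint : ∫ p in Pp, E p ≤ ω * (C / ε) * M * volume.real R - b * volume.real V := by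
    rw [hE, integral_sub hi1.integrableOn hi2.integrableOn, setIntegral_indicator hRm,
      setIntegral_indicator hVm, setIntegral_const, setIntegral_const, smul_eq_mul, smul_eq_mul]
    have e1 : Pp ∩ V = V := inter_eq_right.2 fun p hp => (hV p hp).2.2.2
    rw [e1]
    have : volume.real (Pp ∩ R) ≤ volume.real R := measureReal_mono inter_subset_right hRf
    have h2 : 0 ≤ ω * (C / ε) * M := by positivity
    nlinarith
  have hvolR : volume.real R = 32 * (1 + η) * p0.1 ^ 2 * ε := by
    rw [hR, show p0 = (p0.1, p0.2) from rfl, ← closedBall_prod_same, Measure.volume_eq_prod,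
      measureReal_prod_prod, Real.volume_real_closedBall (by positivity),
      Real.volume_real_closedBall (by positivity)]
    have := Real.sq_sqrt (show 0 ≤ 4 * (1 + η) * (2 * ε) by positivity)
    linear_combination 4 * p0.1 ^ 2 * this
  have hpt : ∀ p ∈ Pp, W p * Lc m χ χ1 χ2 (cc p0 p) / p.1 ^ 2 ≤ E p := by
    intro p hp
    have hs := Pp_pos hp
    have hcp := one_le_cc h0 hp
    have hR0 : 0 ≤ R.indicator (fun _ => ω * (C / ε) * M) p :=
      indicator_nonneg (fun _ _ => by positivity) _
    rcases le_or_gt (1 + η) (cc p0 p) with hA | hA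
    · have : p ∉ V := fun hp => absurd (hV p hp).2.2.1 (not_lt.2 hA)
      rw [Lc_zero hχ hA, hE]
      simp only [indicator_of_notMem this]
      simpa using hR0
    · have hpB : p ∈ Bc p0 η := ⟨hp, hA.le⟩
      have hWp := hWn p hpB
      rcases le_or_gt (cc p0 p) (1 + 2 * ε) with hB | hB
      · have hpR : p ∈ R := Bc_ball h0 ⟨hp, hB⟩ hε1.le (by positivity)
        have : p ∉ V := fun hp => by linarith [(hV p hp).2.1]
        simp only [hE, indicator_of_notMem this, indicator_of_mem hpR, sub_zero]
        have a1 := hχa _ hcp hB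
        have a2 : |W p| ≤ ω := by
          have := hWρ (x := p) (lt_of_le_of_lt hpR hε3)
          rw [hW0, Real.dist_eq, sub_zero] at this
          exact this.le
        have a3 : 1 / p.1 ^ 2 ≤ M := by
          rw [hM, ← one_div_pow]
          apply pow_le_pow_left₀ (by positivity)
          rw [div_le_div_iff₀ hs hs0, one_mul]
          exact Bc_low h0 hpB
        calc W p * Lc m χ χ1 χ2 (cc p0 p) / p.1 ^ 2
            ≤ |W p * Lc m χ χ1 χ2 (cc p0 p)| * (1 / p.1 ^ 2) := by
              rw [div_eq_mul_one_div]; gcongr; exact le_abs_self _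
          _ ≤ (ω * (C / ε)) * M := by
              rw [abs_mul]; gcongr; exact a1
      · have a1 := hχb _ hB.le hA
        have a2 := hsq _ (by linarith) hA
        have a3 : 0 ≤ Lc m χ χ1 χ2 (cc p0 p) := le_trans (by positivity) a1
        by_cases hpV : p ∈ V
        · have a4 := (hV p hpV).1
          simp only [hE, indicator_of_mem hpV]
          have : W p * Lc m χ χ1 χ2 (cc p0 p) / p.1 ^ 2 ≤ - h p := by
            simp only [hdef]
            rw [← neg_div]
            gcongr
            rw [neg_mul, neg_neg]
            exact mul_le_mul_of_nonpos_left a1 hWp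
          linarith
        · simp only [hE, indicator_of_notMem hpV, sub_zero]
          refine le_trans ?_ hR0
          exact div_nonpos_of_nonpos_of_nonneg (mul_nonpos_of_nonpos_of_nonneg hWp a3) (by positivity)
  have hintg := integrable_rad (W := W) h0 hη hW (Lc_cont (m := m) hχ) (fun c hc => Lc_zero hχ hc)
  have h1 := setIntegral_mono_on hintg hEi.integrableOn isOpen_Pp.measurableSet hpt
  have h2 : 0 ≤ ∫ p in Pp, G p * χ (cc p0 p) / p.1 ^ 2 := by
    refine setIntegral_nonneg isOpen_Pp.measurableSet fun p hp => ?_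
    rcases le_or_gt (1 + η) (cc p0 p) with hA | hA
    · rw [hχ.z0 _ hA]; simp
    · have := hG p ⟨hp, hA.le⟩
      have := hχ0 (cc p0 p)
      positivity
  have h3 : ω * (C / ε) * M * volume.real R = ω * T := by
    rw [hvolR, hT]; field_simp
  linarith

/-- cubic profile -/
lemma cubic_isRad (η : ℝ) : IsRad η (fun c => (1 + η - c) * (max 0 (1 + η - c)) ^ 2)
    (fun c => -3 * (max 0 (1 + η - c)) ^ 2) (fun c => 6 * max 0 (1 + η - c)) where
  d1 c := by
    have h1 : HasDerivAt (fun c : ℝ => 1 + η - c) (-1) c := by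
      simpa using (hasDerivAt_id c).const_sub (1 + η)
    have h2 := (hasDerivAt_max_sq (1 + η - c)).comp c h1
    refine (h1.mul h2).congr_deriv ?_
    simp only [Function.comp]
    rcases le_total 0 (1 + η - c) with h | h
    · rw [max_eq_right h]; ring
    · rw [max_eq_left h]; ring
  d2 c := by
    have h1 : HasDerivAt (fun c : ℝ => 1 + η - c) (-1) c := by
      simpa using (hasDerivAt_id c).const_sub (1 + η)
    have h2 := ((hasDerivAt_max_sq (1 + η - c)).comp c h1).const_mul (-3)
    refine h2.congr_deriv ?_
    ring
  cont := by fun_prop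
  z0 c hc := by simp [max_eq_left (by linarith : 1 + η - c ≤ 0)]
  z1 c hc := by simp [max_eq_left (by linarith : 1 + η - c ≤ 0)]
  z2 c hc := by simp [max_eq_left (by linarith : 1 + η - c ≤ 0)]

lemma zero_rhs {p0 : ℝ × ℝ} {η m : ℝ} {W G : ℝ × ℝ → ℝ} (h0 : p0 ∈ Pp) (hη : 0 < η)
    (hGc : ContinuousOn G Pp) (hWz : ∀ p ∈ Pp, cc p0 p < 1 + η → W p = 0)
    (hG : ∀ p ∈ Bc p0 η, 0 ≤ G p) (hw : WeakRad m p0 η W G) : G p0 = 0 := by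
  have h1 := hw _ _ _ (cubic_isRad η)
  rw [setIntegral_eq_zero_of_forall_eq_zero] at h1
  swap
  · intro p hp
    rcases le_or_gt (1 + η) (cc p0 p) with hA | hA
    · rw [Lc_zero (cubic_isRad η) hA]; simp
    · rw [hWz p hp hA]; simp
  have hnn : ∀ p ∈ Pp, 0 ≤ G p * ((1 + η - cc p0 p) * (max 0 (1 + η - cc p0 p)) ^ 2) / p.1 ^ 2 := by
    intro p hp
    rcases le_or_gt (1 + η) (cc p0 p) with hA | hA
    · rw [max_eq_left (by linarith)]; simp
    · have := hG p ⟨hp, hA.le⟩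
      have : 0 < 1 + η - cc p0 p := by linarith
      positivity
  have hintg := integrable_rad (W := G) h0 hη hGc (cubic_isRad η).c0 (cubic_isRad η).z0
  have h2 := (setIntegral_eq_zero_iff_of_nonneg_ae
    (ae_restrict_of_forall_mem isOpen_Pp.measurableSet hnn) hintg).1 h1.symm
  have h3 := Measure.eqOn_open_of_ae_eq h2 isOpen_Pp ?_ continuousOn_const
  · have h4 := h3 h0
    have hs0 := Pp_pos h0
    simp only [cc_self, Pi.zero_apply] at h4
    rw [div_eq_zero_iff, mul_eq_zero, max_eq_right (by linarith)] at h4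
    rcases h4 with (h4 | h4) | h4
    · exact h4
    · exfalso
      have : 0 < (1 + η - 1) * (1 + η - 1) ^ 2 := by
        rw [add_sub_cancel_left]; positivity
      exact this.ne' h4
    · exfalso; exact (by positivity : p0.1 ^ 2 ≠ 0) h4
  · refine ContinuousOn.div (hGc.mul ((cubic_isRad η).c0.comp_continuousOn (cc_contOn h0))) (by fun_prop) ?_
    intro p hp
    have := Pp_pos hp
    positivity

/-! ### Second order jets on the half plane -/

/-- A function with its first and second partial derivatives. -/
structure J2 where
  v : ℝ × ℝ → ℝ
  s : ℝ × ℝ → ℝ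
  t : ℝ × ℝ → ℝ
  ss : ℝ × ℝ → ℝ
  st : ℝ × ℝ → ℝ
  tt : ℝ × ℝ → ℝ

/-- The linear form with given partials. -/
def lin (a b : ℝ) : ℝ × ℝ →L[ℝ] ℝ :=
  a • ContinuousLinearMap.fst ℝ ℝ ℝ + b • ContinuousLinearMap.snd ℝ ℝ ℝ

@[simp] lemma lin_apply (a b : ℝ) (p : ℝ × ℝ) : lin a b p = a * p.1 + b * p.2 := by
  simp [lin]

lemma lin_cont {a b : ℝ × ℝ → ℝ} {S : Set (ℝ × ℝ)} (ha : ContinuousOn a S) (hb : ContinuousOn b S) :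
    ContinuousOn (fun p => lin (a p) (b p)) S :=
  (ha.smul continuousOn_const).add (hb.smul continuousOn_const)

/-- Validity of a jet on the half plane. -/
structure J2.Valid (j : J2) : Prop where
  d : ∀ p ∈ Pp, HasFDerivAt j.v (lin (j.s p) (j.t p)) p
  ds : ∀ p ∈ Pp, HasFDerivAt j.s (lin (j.ss p) (j.st p)) p
  dt : ∀ p ∈ Pp, HasFDerivAt j.t (lin (j.st p) (j.tt p)) p
  css : ContinuousOn j.ss Pp
  cst : ContinuousOn j.st Pp
  ctt : ContinuousOn j.tt Pp

lemma J2.Valid.cv {j : J2} (h : j.Valid) : ContinuousOn j.v Pp := fun p hp =>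
  (h.d p hp).continuousAt.continuousWithinAt
lemma J2.Valid.cs {j : J2} (h : j.Valid) : ContinuousOn j.s Pp := fun p hp =>
  (h.ds p hp).continuousAt.continuousWithinAt
lemma J2.Valid.ct {j : J2} (h : j.Valid) : ContinuousOn j.t Pp := fun p hp =>
  (h.dt p hp).continuousAt.continuousWithinAt

/-- Product of jets. -/
def J2.mul (f g : J2) : J2 where
  v p := f.v p * g.v p
  s p := f.s p * g.v p + f.v p * g.s p
  t p := f.t p * g.v p + f.v p * g.t p
  ss p := f.ss p * g.v p + 2 * (f.s p * g.s p) + f.v p * g.ss p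
  st p := f.st p * g.v p + f.s p * g.t p + f.t p * g.s p + f.v p * g.st p
  tt p := f.tt p * g.v p + 2 * (f.t p * g.t p) + f.v p * g.tt p

lemma J2.Valid.mul {f g : J2} (hf : f.Valid) (hg : g.Valid) : (f.mul g).Valid where
  d p hp := by
    refine ((hf.d p hp).mul (hg.d p hp)).congr_fderiv ?_
    ext <;> simp [J2.mul] <;> ring
  ds p hp := by
    refine (((hf.ds p hp).mul (hg.d p hp)).add ((hf.d p hp).mul (hg.ds p hp))).congr_fderiv ?_
    ext <;> simp [J2.mul] <;> ring
  dt p hp := by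
    refine (((hf.dt p hp).mul (hg.d p hp)).add ((hf.d p hp).mul (hg.dt p hp))).congr_fderiv ?_
    ext <;> simp [J2.mul] <;> ring
  css := by
    have := hf.cv; have := hf.cs; have := hf.ct; have := hf.css; have := hf.cst; have := hf.ctt
    have := hg.cv; have := hg.cs; have := hg.ct; have := hg.css; have := hg.cst; have := hg.ctt
    simp only [J2.mul]; fun_prop
  cst := by
    have := hf.cv; have := hf.cs; have := hf.ct; have := hf.css; have := hf.cst; have := hf.ctt
    have := hg.cv; have := hg.cs; have := hg.ct; have := hg.css; have := hg.cst; have := hg.ctt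
    simp only [J2.mul]; fun_prop
  ctt := by
    have := hf.cv; have := hf.cs; have := hf.ct; have := hf.css; have := hf.cst; have := hf.ctt
    have := hg.cv; have := hg.cs; have := hg.ct; have := hg.css; have := hg.cst; have := hg.ctt
    simp only [J2.mul]; fun_prop

/-- Linear combination of jets. -/
def J2.comb (a b : ℝ) (f g : J2) : J2 where
  v p := a * f.v p + b * g.v p
  s p := a * f.s p + b * g.s p
  t p := a * f.t p + b * g.t p
  ss p := a * f.ss p + b * g.ss p
  st p := a * f.st p + b * g.st p
  tt p := a * f.tt p + b * g.tt p

lemma J2.Valid.comb {f g : J2} (a b : ℝ) (hf : f.Valid) (hg : g.Valid) : (J2.comb a b f g).Valid where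
  d p hp := by
    refine (((hf.d p hp).const_mul a).add ((hg.d p hp).const_mul b)).congr_fderiv ?_
    ext <;> simp [J2.comb]
  ds p hp := by
    refine (((hf.ds p hp).const_mul a).add ((hg.ds p hp).const_mul b)).congr_fderiv ?_
    ext <;> simp [J2.comb]
  dt p hp := by
    refine (((hf.dt p hp).const_mul a).add ((hg.dt p hp).const_mul b)).congr_fderiv ?_
    ext <;> simp [J2.comb]
  css := (continuousOn_const.mul hf.css).add (continuousOn_const.mul hg.css)
  cst := (continuousOn_const.mul hf.cst).add (continuousOn_const.mul hg.cst)
  ctt := (continuousOn_const.mul hf.ctt).add (continuousOn_const.mul hg.ctt)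

/-- Composition of a jet with a function of one variable. -/
def J2.comp (χ χ1 χ2 : ℝ → ℝ) (f : J2) : J2 where
  v p := χ (f.v p)
  s p := χ1 (f.v p) * f.s p
  t p := χ1 (f.v p) * f.t p
  ss p := χ2 (f.v p) * f.s p * f.s p + χ1 (f.v p) * f.ss p
  st p := χ2 (f.v p) * f.s p * f.t p + χ1 (f.v p) * f.st p
  tt p := χ2 (f.v p) * f.t p * f.t p + χ1 (f.v p) * f.tt p

lemma J2.Valid.comp {f : J2} {χ χ1 χ2 : ℝ → ℝ} (hf : f.Valid)
    (h1 : ∀ p ∈ Pp, HasDerivAt χ (χ1 (f.v p)) (f.v p))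
    (h2 : ∀ p ∈ Pp, HasDerivAt χ1 (χ2 (f.v p)) (f.v p))
    (h3 : ∀ p ∈ Pp, ContinuousAt χ2 (f.v p)) : (J2.comp χ χ1 χ2 f).Valid := by
  have c1 : ContinuousOn (fun p => χ1 (f.v p)) Pp := fun p hp =>
    ((h2 p hp).continuousAt.comp (hf.d p hp).continuousAt).continuousWithinAt
  have c2 : ContinuousOn (fun p => χ2 (f.v p)) Pp := fun p hp =>
    ((h3 p hp).comp (hf.d p hp).continuousAt).continuousWithinAt
  have := hf.cs; have := hf.ct; have := hf.css; have := hf.cst; have := hf.ctt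
  have d1 : ∀ p ∈ Pp, HasFDerivAt (fun p => χ1 (f.v p)) (χ2 (f.v p) • lin (f.s p) (f.t p)) p :=
    fun p hp => (h2 p hp).comp_hasFDerivAt p (hf.d p hp)
  refine ⟨fun p hp => ?_, fun p hp => ?_, fun p hp => ?_, ?_, ?_, ?_⟩
  · refine ((h1 p hp).comp_hasFDerivAt p (hf.d p hp)).congr_fderiv ?_
    ext <;> simp [J2.comp]
  · refine ((d1 p hp).mul (hf.ds p hp)).congr_fderiv ?_
    ext <;> simp [J2.comp] <;> ring
  · refine ((d1 p hp).mul (hf.dt p hp)).congr_fderiv ?_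
    ext <;> simp [J2.comp] <;> ring
  · exact ((c2.mul hf.cs).mul hf.cs).add (c1.mul hf.css)
  · exact ((c2.mul hf.cs).mul hf.ct).add (c1.mul hf.cst)
  · exact ((c2.mul hf.ct).mul hf.ct).add (c1.mul hf.ctt)

/-- Coordinate jet `s`. -/
def J2.S : J2 := ⟨fun p => p.1, fun _ => 1, fun _ => 0, fun _ => 0, fun _ => 0, fun _ => 0⟩

/-- Coordinate jet `t`. -/
def J2.T : J2 := ⟨fun p => p.2, fun _ => 0, fun _ => 1, fun _ => 0, fun _ => 0, fun _ => 0⟩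

lemma J2.S_valid : J2.S.Valid where
  d p _ := by
    refine (hasFDerivAt_fst (𝕜 := ℝ) (p := p)).congr_fderiv ?_
    ext <;> simp [J2.S]
  ds p _ := by
    refine (hasFDerivAt_const (1 : ℝ) p).congr_fderiv ?_
    ext <;> simp [J2.S]
  dt p _ := by
    refine (hasFDerivAt_const (0 : ℝ) p).congr_fderiv ?_
    ext <;> simp [J2.S]
  css := continuousOn_const
  cst := continuousOn_const
  ctt := continuousOn_const

lemma J2.T_valid : J2.T.Valid where
  d p _ := by
    refine (hasFDerivAt_snd (𝕜 := ℝ) (p := p)).congr_fderiv ?_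
    ext <;> simp [J2.T]
  ds p _ := by
    refine (hasFDerivAt_const (0 : ℝ) p).congr_fderiv ?_
    ext <;> simp [J2.T]
  dt p _ := by
    refine (hasFDerivAt_const (1 : ℝ) p).congr_fderiv ?_
    ext <;> simp [J2.T]
  css := continuousOn_const
  cst := continuousOn_const
  ctt := continuousOn_const

/-- The jet of `s ^ a`. -/
def J2.spow (a : ℝ) : J2 :=
  J2.comp (fun x => x ^ a) (fun x => a * x ^ (a - 1)) (fun x => a * ((a - 1) * x ^ (a - 1 - 1))) J2.S

lemma J2.spow_valid (a : ℝ) : (J2.spow a).Valid := by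
  refine J2.S_valid.comp (fun p hp => ?_) (fun p hp => ?_) (fun p hp => ?_)
  · exact Real.hasDerivAt_rpow_const (Or.inl (Pp_pos hp).ne')
  · exact (Real.hasDerivAt_rpow_const (Or.inl (Pp_pos hp).ne')).const_mul a
  · exact (((Real.hasDerivAt_rpow_const (Or.inl (Pp_pos hp).ne')).const_mul (a - 1)).const_mul a).continuousAt

lemma hasFDerivAt_quot {E : Type*} [NormedAddCommGroup E] [NormedSpace ℝ E] {f g : E → ℝ}
    {f' g' : E →L[ℝ] ℝ} {p : E} (hf : HasFDerivAt f f' p) (hg : HasFDerivAt g g' p) (h : g p ≠ 0) :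
    HasFDerivAt (fun q => f q / g q) ((g p)⁻¹ • f' - (f p / g p ^ 2) • g') p := by
  have h1 := (hasDerivAt_inv h).comp_hasFDerivAt p hg
  refine (hf.mul h1).congr_fderiv ?_
  ext v
  simp
  field_simp
  ring

/-- The jet of the distance. -/
def J2.cj (p0 : ℝ × ℝ) : J2 where
  v := cc p0
  s p := (p.1 ^ 2 - p0.1 ^ 2 - (p.2 - p0.2) ^ 2) / (2 * p.1 ^ 2 * p0.1)
  t p := (p.2 - p0.2) / (p.1 * p0.1)
  ss p := (p0.1 ^ 2 + (p.2 - p0.2) ^ 2) / (p.1 ^ 3 * p0.1)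
  st p := - (p.2 - p0.2) / (p.1 ^ 2 * p0.1)
  tt p := 1 / (p.1 * p0.1)

lemma J2.cj_valid {p0 : ℝ × ℝ} (h0 : p0 ∈ Pp) : (J2.cj p0).Valid := by
  have hs0 := (Pp_pos h0).ne'
  refine ⟨fun p hp => ?_, fun p hp => ?_, fun p hp => ?_, ?_, ?_, ?_⟩
  · have hs := (Pp_pos hp).ne'
    have f1 := hasFDerivAt_fst (𝕜 := ℝ) (p := p)
    have f2 := hasFDerivAt_snd (𝕜 := ℝ) (p := p)
    have n1 := ((f1.sub_const p0.1).pow 2).add ((f2.sub_const p0.2).pow 2)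
    have d1 := (f1.const_mul 2).mul_const p0.1
    refine ((hasFDerivAt_quot n1 d1 (by positivity)).const_add 1).congr_fderiv ?_
    ext <;> simp [J2.cj] <;> field_simp <;> ring
  · have hs := (Pp_pos hp).ne'
    have f1 := hasFDerivAt_fst (𝕜 := ℝ) (p := p)
    have f2 := hasFDerivAt_snd (𝕜 := ℝ) (p := p)
    have n1 := ((f1.pow 2).sub_const (p0.1 ^ 2)).sub ((f2.sub_const p0.2).pow 2)
    have d1 := ((f1.pow 2).const_mul 2).mul_const p0.1
    refine ((hasFDerivAt_quot n1 d1 (by positivity))).congr_fderiv ?_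
    ext <;> simp [J2.cj] <;> field_simp <;> ring
  · have hs := (Pp_pos hp).ne'
    have f1 := hasFDerivAt_fst (𝕜 := ℝ) (p := p)
    have f2 := hasFDerivAt_snd (𝕜 := ℝ) (p := p)
    have n1 := (f2.sub_const p0.2)
    have d1 := f1.mul_const p0.1
    refine ((hasFDerivAt_quot n1 d1 (by positivity))).congr_fderiv ?_
    ext <;> simp [J2.cj] <;> field_simp <;> ring
  · refine ContinuousOn.div (by fun_prop) (by fun_prop) fun p hp => ?_
    have := Pp_pos hp; positivity
  · refine ContinuousOn.div (by fun_prop) (by fun_prop) fun p hp => ?_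
    have := Pp_pos hp; positivity
  · refine ContinuousOn.div (by fun_prop) (by fun_prop) fun p hp => ?_
    have := Pp_pos hp; positivity

/-- Jet of a radial function. -/
def J2.rad (p0 : ℝ × ℝ) (χ χ1 χ2 : ℝ → ℝ) : J2 := J2.comp χ χ1 χ2 (J2.cj p0)

lemma J2.rad_valid {p0 : ℝ × ℝ} (h0 : p0 ∈ Pp) {η : ℝ} {χ χ1 χ2 : ℝ → ℝ} (h : IsRad η χ χ1 χ2) :
    (J2.rad p0 χ χ1 χ2).Valid :=
  (J2.cj_valid h0).comp (fun _ _ => h.d1 _) (fun _ _ => h.d2 _) (fun _ _ => h.cont.continuousAt)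

lemma J2.rad_lap {p0 p : ℝ × ℝ} (h0 : p0 ∈ Pp) (hp : p ∈ Pp) (χ χ1 χ2 : ℝ → ℝ) :
    p.1 ^ 2 * ((J2.rad p0 χ χ1 χ2).ss p + (J2.rad p0 χ χ1 χ2).tt p) =
      (cc p0 p ^ 2 - 1) * χ2 (cc p0 p) + 2 * cc p0 p * χ1 (cc p0 p) := by
  have hs0 := (Pp_pos h0).ne'
  have hs := (Pp_pos hp).ne'
  have e1 : p.1 ^ 2 * ((J2.cj p0).s p * (J2.cj p0).s p + (J2.cj p0).t p * (J2.cj p0).t p) =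
      cc p0 p ^ 2 - 1 := by
    simp only [J2.cj, cc]; field_simp; ring
  have e2 : p.1 ^ 2 * ((J2.cj p0).ss p + (J2.cj p0).tt p) = 2 * cc p0 p := by
    simp only [J2.cj, cc]; field_simp; ring
  rw [← e1, ← e2]
  simp only [J2.rad, J2.comp]
  have : (J2.cj p0).v p = cc p0 p := rfl
  rw [this]; ring

lemma integral_fderiv_zero (V : ℝ × ℝ → ℝ) (V' : ℝ × ℝ → ℝ × ℝ →L[ℝ] ℝ)
    (h : ∀ p, HasFDerivAt V (V' p) p) (v : ℝ × ℝ) (hi : Integrable V)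
    (hi' : Integrable fun p => V' p v) : ∫ p, V' p v = 0 := by
  have := integral_bilinear_hasLineDerivAt_right_eq_neg_left_of_integrable
    (μ := (volume : Measure (ℝ × ℝ))) (f := V) (f' := fun p => V' p v)
    (g := fun _ => (1 : ℝ)) (g' := fun _ => (0 : ℝ)) (v := v) (B := ContinuousLinearMap.mul ℝ ℝ)
    (by simpa using hi') (by simp) (by simpa using hi)
    (fun p _ => (h p).hasLineDerivAt v) (fun p _ => by
      simpa using (hasFDerivAt_const (1 : ℝ) p).hasLineDerivAt v)
  simpa using this

lemma integral_partial_zero {V : ℝ × ℝ → ℝ} {V1 V2 : ℝ × ℝ → ℝ} {K : Set (ℝ × ℝ)}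
    (hK : IsCompact K) (hKP : K ⊆ Pp) (hd : ∀ p ∈ Pp, HasFDerivAt V (lin (V1 p) (V2 p)) p)
    (hz : ∀ p ∈ Pp, p ∉ K → V p = 0)
    (h1 : ContinuousOn V1 Pp) (h2 : ContinuousOn V2 Pp) :
    ∫ p in Pp, V1 p = 0 ∧ ∫ p in Pp, V2 p = 0 := by
  classical
  have hz' : ∀ p ∈ Pp, p ∉ K → V1 p = 0 ∧ V2 p = 0 := by
    intro p hp hpK
    have : V =ᶠ[𝓝 p] fun _ => 0 := by
      filter_upwards [isOpen_Pp.mem_nhds hp, hK.isClosed.isOpen_compl.mem_nhds hpK] with q h1 h2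
      exact hz q h1 h2
    have e := ((hasFDerivAt_const (0 : ℝ) p).congr_of_eventuallyEq this).unique (hd p hp)
    have e1 := congrArg (fun L : ℝ × ℝ →L[ℝ] ℝ => L (1, 0)) e
    have e2 := congrArg (fun L : ℝ × ℝ →L[ℝ] ℝ => L (0, 1)) e
    simp at e1 e2
    exact ⟨e1.symm, e2.symm⟩
  set V' : ℝ × ℝ → ℝ := Pp.indicator V
  have hd' : ∀ p, HasFDerivAt V' (lin (Pp.indicator V1 p) (Pp.indicator V2 p)) p := by
    intro p
    by_cases hp : p ∈ Pp
    · rw [indicator_of_mem hp, indicator_of_mem hp]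
      refine (hd p hp).congr_of_eventuallyEq ?_
      filter_upwards [isOpen_Pp.mem_nhds hp] with q hq
      exact indicator_of_mem hq _
    · have hpK : p ∉ K := fun h => hp (hKP h)
      have e : V' =ᶠ[𝓝 p] fun _ => 0 := by
        filter_upwards [hK.isClosed.isOpen_compl.mem_nhds hpK] with q h2
        by_cases hq : q ∈ Pp
        · exact (indicator_of_mem hq _).trans (hz q hq h2)
        · exact indicator_of_notMem hq _
      rw [indicator_of_notMem hp, indicator_of_notMem hp]
      refine ((hasFDerivAt_const (0 : ℝ) p).congr_of_eventuallyEq e).congr_fderiv ?_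
      ext <;> simp
  have cV : ContinuousOn V Pp := fun p hp => (hd p hp).continuousAt.continuousWithinAt
  have iV : Integrable V' := (integrable_indicator_iff isOpen_Pp.measurableSet).2
    (integrableOn_of_compact cV hK hKP hz)
  have i1 : Integrable (Pp.indicator V1) := (integrable_indicator_iff isOpen_Pp.measurableSet).2
    (integrableOn_of_compact h1 hK hKP fun p hp hq => (hz' p hp hq).1)
  have i2 : Integrable (Pp.indicator V2) := (integrable_indicator_iff isOpen_Pp.measurableSet).2
    (integrableOn_of_compact h2 hK hKP fun p hp hq => (hz' p hp hq).2)
  constructor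
  · rw [← integral_indicator isOpen_Pp.measurableSet]
    simpa using integral_fderiv_zero V' _ hd' (1, 0) iV (by simpa using i1)
  · rw [← integral_indicator isOpen_Pp.measurableSet]
    simpa using integral_fderiv_zero V' _ hd' (0, 1) iV (by simpa using i2)

lemma WeakRad_of_jet {j : J2} (hj : j.Valid) {p0 : ℝ × ℝ} (h0 : p0 ∈ Pp) {η : ℝ} (hη : 0 < η) (m : ℝ) :
    WeakRad m p0 η j.v (fun p => p.1 ^ 2 * (j.ss p + j.tt p) - m * j.v p) := by
  intro χ χ1 χ2 hχ
  set X := J2.rad p0 χ χ1 χ2 with hX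
  have hXv : X.Valid := J2.rad_valid h0 hχ
  have hz : ∀ p ∈ Pp, p ∉ Bc p0 η → X.v p = 0 ∧ X.s p = 0 ∧ X.t p = 0 := by
    intro p hp hpn
    have : 1 + η ≤ cc p0 p := by
      by_contra hc
      exact hpn ⟨hp, (not_le.1 hc).le⟩
    have e : (J2.cj p0).v p = cc p0 p := rfl
    simp [hX, J2.rad, J2.comp, e, hχ.z0 _ this, hχ.z1 _ this]
  have := hj.cv; have := hj.cs; have := hj.ct; have := hj.css; have := hj.cst; have := hj.ctt
  have := hXv.cv; have := hXv.cs; have := hXv.ct; have := hXv.css; have := hXv.cst; have := hXv.ctt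
  have A := (integral_partial_zero (V := fun p => j.v p * X.s p - X.v p * j.s p)
    (V1 := fun p => j.v p * X.ss p - X.v p * j.ss p)
    (V2 := fun p => j.t p * X.s p + j.v p * X.st p - X.t p * j.s p - X.v p * j.st p)
    (Bc_compact h0 hη) (Bc_sub _ _) (fun p hp => by
      refine (((hj.d p hp).mul (hXv.ds p hp)).sub ((hXv.d p hp).mul (hj.ds p hp))).congr_fderiv ?_
      ext <;> simp <;> ring) (fun p hp hq => by simp [hz p hp hq]) (by fun_prop) (by fun_prop)).1
  have B := (integral_partial_zero (V := fun p => j.v p * X.t p - X.v p * j.t p)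
    (V1 := fun p => j.s p * X.t p + j.v p * X.st p - X.s p * j.t p - X.v p * j.st p)
    (V2 := fun p => j.v p * X.tt p - X.v p * j.tt p)
    (Bc_compact h0 hη) (Bc_sub _ _) (fun p hp => by
      refine (((hj.d p hp).mul (hXv.dt p hp)).sub ((hXv.d p hp).mul (hj.dt p hp))).congr_fderiv ?_
      ext <;> simp <;> ring) (fun p hp hq => by simp [hz p hp hq]) (by fun_prop) (by fun_prop)).2
  have zz : ∀ p ∈ Pp, p ∉ Bc p0 η → X.ss p = 0 ∧ X.tt p = 0 := by
    intro p hp hpn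
    have : 1 + η ≤ cc p0 p := by
      by_contra hc
      exact hpn ⟨hp, (not_le.1 hc).le⟩
    have e : (J2.cj p0).v p = cc p0 p := rfl
    simp [hX, J2.rad, J2.comp, e, hχ.z1 _ this, hχ.z2 _ this]
  have iA : IntegrableOn (fun p => j.v p * X.ss p - X.v p * j.ss p) Pp :=
    integrableOn_of_compact (by fun_prop) (Bc_compact h0 hη) (Bc_sub _ _)
      (fun p hp hq => by simp [hz p hp hq, zz p hp hq])
  have iB : IntegrableOn (fun p => j.v p * X.tt p - X.v p * j.tt p) Pp :=
    integrableOn_of_compact (by fun_prop) (Bc_compact h0 hη) (Bc_sub _ _)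
      (fun p hp hq => by simp [hz p hp hq, zz p hp hq])
  have hs := integral_add iA iB
  rw [A, B, add_zero] at hs
  have cG : ContinuousOn (fun p => p.1 ^ 2 * (j.ss p + j.tt p) - m * j.v p) Pp := by fun_prop
  have i1 := integrable_rad h0 hη hj.cv (Lc_cont (m := m) hχ) (fun c hc => Lc_zero hχ hc)
  have i2 := integrable_rad h0 hη cG hχ.c0 hχ.z0
  rw [← sub_eq_zero, ← integral_sub i1 i2, ← hs]
  refine setIntegral_congr_fun isOpen_Pp.measurableSet fun p hp => ?_
  have e := J2.rad_lap h0 hp χ χ1 χ2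
  have hs := (Pp_pos hp).ne'
  have e2 : (J2.rad p0 χ χ1 χ2).v p = χ (cc p0 p) := rfl
  simp only [Lc, hX, e2]
  rw [← e]
  field_simp
  ring

/-! ### Isometries -/

lemma det_lin (a b c d : ℝ) : ((lin a b).prod (lin c d)).det = a * d - b * c := by
  rw [← Matrix.det_fin_two_of, ← LinearMap.det_toLin (Module.Basis.finTwoProd ℝ),
    ← LinearMap.det_toContinuousLinearMap, Matrix.toLin_finTwoProd_toContinuousLinearMap]
  rfl

/-- Isometries of the half plane (involutive). -/
structure IsIso (T : ℝ × ℝ → ℝ × ℝ) : Prop where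
  maps : ∀ p ∈ Pp, T p ∈ Pp
  inv : ∀ p ∈ Pp, T (T p) = p
  cc_eq : ∀ p0 ∈ Pp, ∀ p ∈ Pp, cc (T p0) (T p) = cc p0 p
  cont : ContinuousOn T Pp
  meas : ∀ h : ℝ × ℝ → ℝ, ∫ p in Pp, h p / p.1 ^ 2 = ∫ p in Pp, h (T p) / p.1 ^ 2

lemma WeakRad.iso {T : ℝ × ℝ → ℝ × ℝ} (hT : IsIso T) {m η : ℝ} {p0 : ℝ × ℝ} (h0 : p0 ∈ Pp)
    {W G : ℝ × ℝ → ℝ} (h : WeakRad m (T p0) η W G) :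
    WeakRad m p0 η (fun p => W (T p)) (fun p => G (T p)) := by
  intro χ χ1 χ2 hχ
  have e := h χ χ1 χ2 hχ
  rw [hT.meas (fun p => W p * Lc m χ χ1 χ2 (cc (T p0) p)),
    hT.meas (fun p => G p * χ (cc (T p0) p))] at e
  have c : ∀ p ∈ Pp, cc (T p0) (T p) = cc p0 p := hT.cc_eq p0 h0
  refine Eq.trans (Eq.trans ?_ e) ?_
  · refine setIntegral_congr_fun isOpen_Pp.measurableSet (fun p hp => ?_)
    simp only [c p hp]
  · refine setIntegral_congr_fun isOpen_Pp.measurableSet (fun p hp => ?_)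
    simp only [c p hp]

lemma IsIso.comp {T R : ℝ × ℝ → ℝ × ℝ} (hT : IsIso T) (hR : IsIso R) :
    IsIso (fun p => T (R (T p))) where
  maps p hp := hT.maps _ (hR.maps _ (hT.maps p hp))
  inv p hp := by
    have h1 := hT.maps p hp
    have h2 := hR.maps _ h1
    rw [hT.inv _ h2, hR.inv _ h1, hT.inv _ hp]
  cc_eq p0 h0 p hp := by
    rw [hT.cc_eq _ (hR.maps _ (hT.maps p0 h0)) _ (hR.maps _ (hT.maps p hp)),
      hR.cc_eq _ (hT.maps p0 h0) _ (hT.maps p hp), hT.cc_eq p0 h0 p hp]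
  cont := (hT.cont.comp (hR.cont.comp hT.cont fun p hp => hT.maps p hp)
    fun p hp => hR.maps _ (hT.maps p hp))
  meas h := by
    rw [hT.meas h, hR.meas (fun p => h (T p)), hT.meas (fun p => h (T (R p)))]

lemma isIso_of_deriv {T : ℝ × ℝ → ℝ × ℝ} (maps : ∀ p ∈ Pp, T p ∈ Pp)
    (inv : ∀ p ∈ Pp, T (T p) = p)
    (cc_eq : ∀ p0 ∈ Pp, ∀ p ∈ Pp, cc (T p0) (T p) = cc p0 p)
    (T' : ℝ × ℝ → ℝ × ℝ →L[ℝ] ℝ × ℝ) (hd : ∀ p ∈ Pp, HasFDerivAt T (T' p) p)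
    (hdet : ∀ p ∈ Pp, |(T' p).det| = (T p).1 ^ 2 / p.1 ^ 2) : IsIso T where
  maps := maps
  inv := inv
  cc_eq := cc_eq
  cont p hp := (hd p hp).continuousAt.continuousWithinAt
  meas h := by
    have him : T '' Pp = Pp := by
      ext p
      constructor
      · rintro ⟨q, hq, rfl⟩; exact maps q hq
      · intro hp; exact ⟨T p, maps p hp, inv p hp⟩
    have hinj : InjOn T Pp := fun p hp q hq e => by rw [← inv p hp, ← inv q hq, e]
    have := integral_image_eq_integral_abs_det_fderiv_smul volume isOpen_Pp.measurableSet
      (fun p hp => (hd p hp).hasFDerivWithinAt) hinj (fun p => h p / p.1 ^ 2)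
    rw [him] at this
    rw [this]
    refine setIntegral_congr_fun isOpen_Pp.measurableSet fun p hp => ?_
    have h1 := (Pp_pos hp).ne'
    have h2 := (Pp_pos (maps p hp)).ne'
    simp only [hdet p hp, smul_eq_mul]
    field_simp

/-- inversion -/
def iv (p : ℝ × ℝ) : ℝ × ℝ := (p.1 / (p.1 ^ 2 + p.2 ^ 2), -p.2 / (p.1 ^ 2 + p.2 ^ 2))

/-- reflection -/
def rf (l : ℝ) (p : ℝ × ℝ) : ℝ × ℝ := (p.1, 2 * l - p.2)

lemma nsq_pos {p : ℝ × ℝ} (hp : p ∈ Pp) : 0 < p.1 ^ 2 + p.2 ^ 2 := by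
  have := Pp_pos hp
  positivity

lemma iv_mem {p : ℝ × ℝ} (hp : p ∈ Pp) : iv p ∈ Pp := div_pos hp (nsq_pos hp)

lemma iv_nsq {p : ℝ × ℝ} (hp : p ∈ Pp) :
    (iv p).1 ^ 2 + (iv p).2 ^ 2 = 1 / (p.1 ^ 2 + p.2 ^ 2) := by
  have := (nsq_pos hp).ne'
  simp only [iv]; field_simp

lemma iv_iv {p : ℝ × ℝ} (hp : p ∈ Pp) : iv (iv p) = p := by
  have h1 := (nsq_pos hp).ne'
  have h2 := iv_nsq hp
  rw [iv, h2]
  apply Prod.ext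
  · simp only [iv]; field_simp
  · simp only [iv]; field_simp

lemma isIso_iv : IsIso iv := by
  refine isIso_of_deriv (fun p hp => iv_mem hp) (fun p hp => iv_iv hp) ?_
    (fun p => (lin ((p.2 ^ 2 - p.1 ^ 2) / (p.1 ^ 2 + p.2 ^ 2) ^ 2) (-2 * p.1 * p.2 / (p.1 ^ 2 + p.2 ^ 2) ^ 2)).prod
      (lin (2 * p.1 * p.2 / (p.1 ^ 2 + p.2 ^ 2) ^ 2) ((p.2 ^ 2 - p.1 ^ 2) / (p.1 ^ 2 + p.2 ^ 2) ^ 2))) ?_ ?_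
  · intro p0 h0 p hp
    have h1 := (nsq_pos hp).ne'
    have h2 := (nsq_pos h0).ne'
    have h3 := (Pp_pos hp).ne'
    have h4 := (Pp_pos h0).ne'
    simp only [cc, iv]
    field_simp
    ring
  · intro p hp
    have h1 := (nsq_pos hp).ne'
    have f1 := hasFDerivAt_fst (𝕜 := ℝ) (p := p)
    have f2 := hasFDerivAt_snd (𝕜 := ℝ) (p := p)
    have d1 := (f1.pow 2).add (f2.pow 2)
    refine HasFDerivAt.prodMk ?_ ?_
    · refine (hasFDerivAt_quot f1 d1 h1).congr_fderiv ?_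
      ext <;> simp <;> field_simp <;> ring
    · refine (hasFDerivAt_quot f2.neg d1 h1).congr_fderiv ?_
      ext <;> simp <;> field_simp <;> ring
  · intro p hp
    have h1 := (nsq_pos hp)
    have h3 := (Pp_pos hp)
    rw [det_lin, abs_of_nonneg]
    · simp only [iv]; field_simp; ring
    · have : (p.2 ^ 2 - p.1 ^ 2) / (p.1 ^ 2 + p.2 ^ 2) ^ 2 * ((p.2 ^ 2 - p.1 ^ 2) / (p.1 ^ 2 + p.2 ^ 2) ^ 2) -
        -2 * p.1 * p.2 / (p.1 ^ 2 + p.2 ^ 2) ^ 2 * (2 * p.1 * p.2 / (p.1 ^ 2 + p.2 ^ 2) ^ 2) =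
        ((p.2 ^ 2 - p.1 ^ 2) / (p.1 ^ 2 + p.2 ^ 2) ^ 2) ^ 2 + (2 * p.1 * p.2 / (p.1 ^ 2 + p.2 ^ 2) ^ 2) ^ 2 := by ring
      rw [this]; positivity

lemma isIso_rf (l : ℝ) : IsIso (rf l) := by
  refine isIso_of_deriv (fun p hp => hp) (fun p hp => by simp [rf]) ?_
    (fun p => (lin 1 0).prod (lin 0 (-1))) ?_ ?_
  · intro p0 h0 p hp
    simp only [cc, rf]
    ring
  · intro p hp
    have f1 := hasFDerivAt_fst (𝕜 := ℝ) (p := p)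
    have f2 := hasFDerivAt_snd (𝕜 := ℝ) (p := p)
    refine HasFDerivAt.prodMk ?_ ?_
    · refine f1.congr_fderiv ?_
      ext <;> simp
    · refine (f2.const_sub (2 * l)).congr_fderiv ?_
      ext <;> simp
  · intro p hp
    have h3 := (Pp_pos hp).ne'
    rw [det_lin]
    simp only [rf]
    field_simp
    norm_num

/-- the reflection conjugated by the inversion -/
def sg (l : ℝ) (p : ℝ × ℝ) : ℝ × ℝ := iv (rf l (iv p))

lemma isIso_sg (l : ℝ) : IsIso (sg l) := isIso_iv.comp (isIso_rf l)

/-- defining function of the domain -/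
def Qf (l : ℝ) (p : ℝ × ℝ) : ℝ := l * (p.1 ^ 2 + p.2 ^ 2) + p.2

/-- the scaling factor -/
def df (l : ℝ) (p : ℝ × ℝ) : ℝ := (1 + 2 * l * p.2) ^ 2 + 4 * l ^ 2 * p.1 ^ 2

lemma df_eq (l : ℝ) (p : ℝ × ℝ) : df l p = 1 + 4 * l * Qf l p := by
  simp only [df, Qf]; ring

lemma df_pos {l : ℝ} {p : ℝ × ℝ} (hp : p ∈ Pp) : 0 < df l p := by
  have := Pp_pos hp
  rcases eq_or_ne l 0 with rfl | hl
  · simp [df]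
  · rw [df]; positivity

lemma sg_eq {l : ℝ} {p : ℝ × ℝ} (hp : p ∈ Pp) :
    sg l p = (p.1 / df l p, -(p.2 + 2 * l * (p.1 ^ 2 + p.2 ^ 2)) / df l p) := by
  have h1 := (nsq_pos hp).ne'
  have h2 := (df_pos (l := l) hp).ne'
  have h3 := (Pp_pos hp).ne'
  have e : (rf l (iv p)).1 ^ 2 + (rf l (iv p)).2 ^ 2 = df l p / (p.1 ^ 2 + p.2 ^ 2) := by
    simp only [rf, iv, df]; field_simp; ring
  rw [sg, iv, e]
  apply Prod.ext
  · simp only [rf, iv]; field_simp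
  · simp only [rf, iv]; field_simp; ring

lemma sg_Q0 {l : ℝ} {p : ℝ × ℝ} (hp : p ∈ Pp) (h : Qf l p = 0) : sg l p = p := by
  rw [sg_eq hp, df_eq, h]
  apply Prod.ext
  · simp
  · simp only [Qf] at h
    simp; linarith

/-- the domain -/
def Dl (l : ℝ) : Set (ℝ × ℝ) := {p | 0 < p.1 ∧ Qf l p < 0}

lemma mem_Dl_iv {l : ℝ} {p : ℝ × ℝ} (hp : p ∈ Pp) : iv p ∈ Dl l ↔ l < p.2 := by
  have h1 := (nsq_pos hp)
  have : Qf l (iv p) = (l - p.2) / (p.1 ^ 2 + p.2 ^ 2) := by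
    rw [Qf, iv_nsq hp]; simp only [iv]; ring
  constructor
  · rintro ⟨_, h⟩
    rw [this, div_neg_iff] at h
    rcases h with h | h
    · linarith [h.2]
    · linarith [h.1]
  · intro h
    refine ⟨iv_mem hp, ?_⟩
    rw [this]
    exact div_neg_of_neg_of_pos (by linarith) h1

lemma Dl_bound {l : ℝ} (hl : 0 < l) {p : ℝ × ℝ} (hp : 0 ≤ p.1) (hQ : Qf l p ≤ 0) :
    p.1 ≤ 1 / l ∧ -(1 / l) ≤ p.2 ∧ p.2 ≤ 0 := by
  simp only [Qf] at hQ
  have h3 : p.2 ≤ 0 := by nlinarith [sq_nonneg p.1, sq_nonneg p.2]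
  have h2 : -(1 / l) ≤ p.2 := by
    by_contra hc
    push Not at hc
    have : l * p.2 < -1 := by
      have := mul_lt_mul_of_pos_left hc hl
      have e : l * (-(1 / l)) = -1 := by field_simp
      linarith
    have : 0 < (l * p.2 + 1) * p.2 := mul_pos_of_neg_of_neg (by linarith) (by
      by_contra h0; nlinarith)
    nlinarith [sq_nonneg p.1]
  refine ⟨?_, h2, h3⟩
  rw [le_div_iff₀ hl]
  have : (l * p.1) ^ 2 ≤ 1 := by
    have h4 : l * (l * (p.1 ^ 2 + p.2 ^ 2) + p.2) ≤ 0 := mul_nonpos_of_nonneg_of_nonpos hl.le hQ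
    nlinarith [sq_nonneg (l * p.2 + 1 / 2)]
  have : 0 ≤ l * p.1 := by positivity
  nlinarith

lemma Dl_mono {l l' : ℝ} (h : l' ≤ l) : Dl l ⊆ Dl l' := by
  rintro p ⟨h1, h2⟩
  refine ⟨h1, ?_⟩
  simp only [Qf] at *
  nlinarith [sq_nonneg p.1, sq_nonneg p.2]

lemma isOpen_Dl (l : ℝ) : IsOpen (Dl l) := by
  have h : Continuous (Qf l) := by unfold Qf; fun_prop
  exact isOpen_Pp.inter (isOpen_lt h continuous_const)

lemma convex_Dl {l : ℝ} (hl : 0 < l) : Convex ℝ (Dl l) := by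
  rintro p ⟨hp1, hp2⟩ q ⟨hq1, hq2⟩ a b ha hb hab
  simp only [Dl, Qf, mem_ofPred_eq, Prod.fst_add, Prod.snd_add, Prod.smul_fst, Prod.smul_snd,
    smul_eq_mul] at *
  constructor
  · rcases eq_or_lt_of_le ha with h | h
    · have : b = 1 := by linarith
      subst this; rw [← h]; linarith
    · positivity
  · have hb' : b = 1 - a := by linarith
    subst hb'
    have e : l * ((a * p.1 + (1 - a) * q.1) ^ 2 + (a * p.2 + (1 - a) * q.2) ^ 2) + (a * p.2 + (1 - a) * q.2)
        = a * (l * (p.1 ^ 2 + p.2 ^ 2) + p.2) + (1 - a) * (l * (q.1 ^ 2 + q.2 ^ 2) + q.2)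
        - l * (a * (1 - a)) * ((p.1 - q.1) ^ 2 + (p.2 - q.2) ^ 2) := by ring
    rw [e]
    have h1 : 0 ≤ l * (a * (1 - a)) * ((p.1 - q.1) ^ 2 + (p.2 - q.2) ^ 2) := by positivity
    have h2 : a * (l * (p.1 ^ 2 + p.2 ^ 2) + p.2) + (1 - a) * (l * (q.1 ^ 2 + q.2 ^ 2) + q.2) < 0 := by
      rcases eq_or_lt_of_le ha with h | h
      · rw [← h]; linarith
      · nlinarith [mul_neg_of_pos_of_neg h hp2, mul_nonpos_of_nonneg_of_nonpos hb hq2.le]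
    linarith

/-! ### Weak formulation against `C²` test functions -/

lemma test_of {k : WithTop ℕ∞} {φ : H n → ℝ} (hφ : ContDiff ℝ k φ) (hk : 1 ≤ k) (hc : HasCompactSupport φ) :
    IsTest univ φ := ⟨hφ.of_le hk, hc, subset_univ _⟩

lemma IsTest.add {φ ψ : H n → ℝ} (hφ : IsTest univ φ) (hψ : IsTest univ ψ) : IsTest univ (φ + ψ) :=
  ⟨hφ.contDiff.add hψ.contDiff, hφ.compactSupport.add hψ.compactSupport, subset_univ _⟩

lemma Xd_cont {φ : H n → ℝ} (hφ : ContDiff ℝ 1 φ) (i : Fin n) : Continuous (Xd i φ) := by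
  have h1 : Continuous (fderiv ℝ φ) := hφ.continuous_fderiv (by norm_num)
  have h2 : Continuous fun ξ : H n => ((Pi.single i 1, 0, 2 * ξ.2.1 i) : H n) := by fun_prop
  exact h1.clm_apply h2

lemma Yd_cont {φ : H n → ℝ} (hφ : ContDiff ℝ 1 φ) (i : Fin n) : Continuous (Yd i φ) := by
  have h1 : Continuous (fderiv ℝ φ) := hφ.continuous_fderiv (by norm_num)
  have h2 : Continuous fun ξ : H n => ((0, Pi.single i 1, -(2 * ξ.1 i)) : H n) := by fun_prop
  exact h1.clm_apply h2

lemma Xd_supp {φ : H n → ℝ} (hc : HasCompactSupport φ) (i : Fin n) : HasCompactSupport (Xd i φ) :=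
  (hc.fderiv ℝ).mono' (fun ξ hξ => subset_tsupport _ (by
    rw [Function.mem_support] at hξ ⊢
    intro h; apply hξ; rw [Xd, h]; simp))

lemma Yd_supp {φ : H n → ℝ} (hc : HasCompactSupport φ) (i : Fin n) : HasCompactSupport (Yd i φ) :=
  (hc.fderiv ℝ).mono' (fun ξ hξ => subset_tsupport _ (by
    rw [Function.mem_support] at hξ ⊢
    intro h; apply hξ; rw [Yd, h]; simp))

lemma Xd_test {φ : H n → ℝ} (hφ : ContDiff ℝ 2 φ) (hc : HasCompactSupport φ) (i : Fin n) :
    IsTest univ (Xd i φ) := by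
  have h1 : ContDiff ℝ 1 (fderiv ℝ φ) := hφ.fderiv_right (by norm_num)
  have h2 : ContDiff ℝ 1 fun ξ : H n => ((Pi.single i 1, 0, 2 * ξ.2.1 i) : H n) := by fun_prop
  exact ⟨h1.clm_apply h2, Xd_supp hc i, subset_univ _⟩

lemma Yd_test {φ : H n → ℝ} (hφ : ContDiff ℝ 2 φ) (hc : HasCompactSupport φ) (i : Fin n) :
    IsTest univ (Yd i φ) := by
  have h1 : ContDiff ℝ 1 (fderiv ℝ φ) := hφ.fderiv_right (by norm_num)
  have h2 : ContDiff ℝ 1 fun ξ : H n => ((0, Pi.single i 1, -(2 * ξ.1 i)) : H n) := by fun_prop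
  exact ⟨h1.clm_apply h2, Yd_supp hc i, subset_univ _⟩

lemma Xd_add {φ ψ : H n → ℝ} (hφ : IsTest univ φ) (hψ : IsTest univ ψ) (i : Fin n) :
    Xd i (φ + ψ) = Xd i φ + Xd i ψ := by
  ext ξ
  simp only [Xd, Pi.add_apply]
  rw [fderiv_add (hφ.contDiff.differentiable (by norm_num) ξ)
    (hψ.contDiff.differentiable (by norm_num) ξ)]
  rfl

lemma Yd_add {φ ψ : H n → ℝ} (hφ : IsTest univ φ) (hψ : IsTest univ ψ) (i : Fin n) :
    Yd i (φ + ψ) = Yd i φ + Yd i ψ := by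
  ext ξ
  simp only [Yd, Pi.add_apply]
  rw [fderiv_add (hφ.contDiff.differentiable (by norm_num) ξ)
    (hψ.contDiff.differentiable (by norm_num) ξ)]
  rfl

lemma int_cc {u ψ : H n → ℝ} (hu : Continuous u) (hψ : Continuous ψ) (hc : HasCompactSupport ψ) :
    Integrable (fun ξ => u ξ * ψ ξ) :=
  (hu.mul hψ).integrable_of_hasCompactSupport (hc.mul_left)

lemma trick (N : (H n → ℝ) → H n → ℝ) (A : (H n → ℝ) → ℝ) (b : ℕ → H n → ℝ)
    (hb : ∀ k, IsTest univ (b k))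
    (hN : ∀ φ ψ, IsTest univ φ → IsTest univ ψ → N (φ + ψ) = N φ + N ψ)
    (hA : ∀ φ ψ, IsTest univ φ → IsTest univ ψ → A (φ + ψ) = A φ + A ψ)
    (hAN : ∀ φ, IsTest univ φ → A φ = ∫ ξ, N φ ξ)
    (g : H n → ℝ) (hg : ¬ AEStronglyMeasurable g)
    (hlim : ∀ ξ, Tendsto (fun k => N (b k) ξ) atTop (𝓝 (g ξ))) :
    ∀ φ, IsTest univ φ → A φ = 0 := by
  have hz : ∀ φ, IsTest univ φ → ¬ AEStronglyMeasurable (N φ) → A φ = 0 := by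
    intro φ hφ h
    rw [hAN φ hφ]
    exact integral_non_aestronglyMeasurable h
  obtain ⟨k, hk⟩ : ∃ k, ¬ AEStronglyMeasurable (N (b k)) := by
    by_contra hc
    push Not at hc
    exact hg (aestronglyMeasurable_of_tendsto_ae atTop hc (Eventually.of_forall hlim))
  intro φ hφ
  by_cases h : AEStronglyMeasurable (N φ)
  · have h1 : ¬ AEStronglyMeasurable (N (φ + b k)) := by
      intro hc
      apply hk
      have := hc.sub h
      rw [hN _ _ hφ (hb k), add_sub_cancel_left] at this
      exact this
    have h2 := hz _ (hφ.add (hb k)) h1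
    rw [hA _ _ hφ (hb k), hz _ (hb k) hk, add_zero] at h2
    exact h2
  · exact hz φ hφ h

/-- big bumps -/
def bmp (n : ℕ) (k : ℕ) : ContDiffBump (0 : H n) := ⟨k + 1, k + 2, by positivity, by linarith⟩

lemma bmp_one (k : ℕ) (ξ : H n) (h : ‖ξ‖ < k + 1) : (bmp n k : H n → ℝ) =ᶠ[𝓝 ξ] fun _ => 1 := by
  have : Metric.ball (0 : H n) (k + 1) ∈ 𝓝 ξ := Metric.isOpen_ball.mem_nhds (by simpa using h)
  filter_upwards [this] with z hz
  exact (bmp n k).one_of_mem_closedBall (Metric.ball_subset_closedBall hz)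

lemma bmp_ev (ξ : H n) : ∀ᶠ k : ℕ in atTop, (bmp n k : H n → ℝ) =ᶠ[𝓝 ξ] fun _ => 1 := by
  filter_upwards [eventually_gt_atTop ⌈‖ξ‖⌉₊] with k hk
  apply bmp_one
  have := Nat.le_ceil ‖ξ‖
  have : (⌈‖ξ‖⌉₊ : ℝ) < k := by exact_mod_cast hk
  linarith

lemma bmp_test (k : ℕ) : IsTest univ (bmp n k : H n → ℝ) :=
  test_of (k := 1) (bmp n k).contDiff le_rfl (bmp n k).hasCompactSupport

lemma integral_comp_fin_order (e : H n →ₗ[ℝ] H n) (he : ∀ ξ, e (e (e (e ξ))) = ξ) (f : H n → ℝ) :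
    ∫ ξ, f (e ξ) = ∫ ξ, f ξ := by
  have h4 : e ∘ₗ e ∘ₗ e ∘ₗ e = LinearMap.id := by ext1 <;> simp [LinearMap.ext_iff, he]
  have hd : LinearMap.det e ^ 4 = 1 := by
    have := congrArg LinearMap.det h4
    rw [LinearMap.det_comp, LinearMap.det_comp, LinearMap.det_comp, LinearMap.det_id] at this
    rw [← this]; ring
  have hd1 : |LinearMap.det e| = 1 := by
    have : |LinearMap.det e| ^ 4 = 1 := by rw [← abs_pow, hd, abs_one]
    exact (pow_eq_one_iff_of_nonneg (abs_nonneg _) (by norm_num)).1 this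
  have hne : LinearMap.det e ≠ 0 := by intro h; rw [h] at hd1; simp at hd1
  haveI i1 : (volume : Measure ((Fin n → ℝ) × ℝ)).IsAddHaarMeasure :=
    Measure.prod.instIsAddHaarMeasure (volume : Measure (Fin n → ℝ)) (volume : Measure ℝ)
  haveI i2 : (volume : Measure (H n)).IsAddHaarMeasure :=
    Measure.prod.instIsAddHaarMeasure (volume : Measure (Fin n → ℝ)) (volume : Measure ((Fin n → ℝ) × ℝ))
  have hmap := Measure.map_linearMap_addHaar_eq_smul_addHaar (volume : Measure (H n)) hne
  rw [abs_inv, hd1, inv_one, ENNReal.ofReal_one, one_smul] at hmap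
  have hcont : Continuous e := e.continuous_of_finiteDimensional
  let E : H n ≃ H n := ⟨e, fun ξ => e (e (e ξ)), fun ξ => he ξ, fun ξ => he ξ⟩
  have hemb : MeasurableEmbedding e := by
    have : MeasurableEmbedding (MeasurableEquiv.mk E hcont.measurable
      (hcont.comp (hcont.comp hcont)).measurable) := MeasurableEquiv.measurableEmbedding _
    exact this
  have := hemb.integral_map (μ := volume) f
  rw [hmap] at this
  exact this.symm

/-- rotation -/
def Jr (n : ℕ) : H n →ₗ[ℝ] H n where
  toFun ξ := (ξ.2.1, -ξ.1, ξ.2.2)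
  map_add' ξ ζ := by ext <;> simp; ring
  map_smul' c ξ := by ext <;> simp

/-- index permutation -/
def Pm (i j : Fin n) : H n →ₗ[ℝ] H n where
  toFun ξ := (fun k => ξ.1 (Equiv.swap i j k), fun k => ξ.2.1 (Equiv.swap i j k), ξ.2.2)
  map_add' ξ ζ := by ext <;> simp
  map_smul' c ξ := by ext <;> simp

lemma rsq_Jr (ξ : H n) : rsq (Jr n ξ) = rsq ξ := by
  simp [rsq, Jr]; ring

lemma rsq_Pm (i j : Fin n) (ξ : H n) : rsq (Pm i j ξ) = rsq ξ := by
  simp only [rsq, Pm, LinearMap.coe_mk, AddHom.coe_mk]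
  rw [Equiv.sum_comp (Equiv.swap i j) (fun k => ξ.1 k ^ 2),
    Equiv.sum_comp (Equiv.swap i j) (fun k => ξ.2.1 k ^ 2)]

lemma comp_test (e : H n →ₗ[ℝ] H n) (he : ∀ ξ, e (e (e (e ξ))) = ξ) {φ : H n → ℝ}
    (hφ : IsTest univ φ) : IsTest univ (fun ξ => φ (e ξ)) := by
  have hcont : Continuous e := e.continuous_of_finiteDimensional
  let E : H n ≃ₜ H n := ⟨⟨e, fun ξ => e (e (e ξ)), fun ξ => he ξ, fun ξ => he ξ⟩, hcont,
    (hcont.comp (hcont.comp hcont))⟩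
  refine ⟨hφ.contDiff.comp (LinearMap.toContinuousLinearMap e).contDiff, ?_, subset_univ _⟩
  exact hφ.compactSupport.comp_homeomorph E

lemma fderiv_comp_lin (e : H n →ₗ[ℝ] H n) {φ : H n → ℝ} (hφ : IsTest univ φ) (ξ v : H n) :
    fderiv ℝ (fun ξ => φ (e ξ)) ξ v = fderiv ℝ φ (e ξ) (e v) := by
  have h1 : HasFDerivAt (fun ξ => e ξ) (LinearMap.toContinuousLinearMap e) ξ :=
    (LinearMap.toContinuousLinearMap e).hasFDerivAt
  have h2 := (hφ.contDiff.differentiable (by norm_num) (e ξ)).hasFDerivAt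
  have h3 := h2.comp ξ h1
  have : fderiv ℝ (fun ξ => φ (e ξ)) ξ = _ := h3.fderiv
  rw [this]; rfl

lemma Jr_four (ξ : H n) : Jr n (Jr n (Jr n (Jr n ξ))) = ξ := by ext <;> simp [Jr]

lemma Pm_four (i j : Fin n) (ξ : H n) : Pm i j (Pm i j (Pm i j (Pm i j ξ))) = ξ := by
  ext <;> simp [Pm]

lemma sym_int {u : H n → ℝ} (hcyl : IsCylindrical u) (e : H n →ₗ[ℝ] H n)
    (he : ∀ ξ, e (e (e (e ξ))) = ξ) (hr : ∀ ξ, rsq (e ξ) = rsq ξ) (ht : ∀ ξ, (e ξ).2.2 = ξ.2.2)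
    (ψ : H n → ℝ) : ∫ ξ, u ξ * ψ (e ξ) = ∫ ξ, u ξ * ψ ξ := by
  rw [← integral_comp_fin_order e he (fun ξ => u ξ * ψ ξ)]
  refine integral_congr_ae (Eventually.of_forall fun ξ => ?_)
  simp only
  rw [hcyl (e ξ) ξ (hr ξ) (ht ξ)]

lemma Xd_Jr {φ : H n → ℝ} (hφ : IsTest univ φ) (i : Fin n) (ξ : H n) :
    Xd i (fun ξ => φ (Jr n ξ)) ξ = - Yd i φ (Jr n ξ) := by
  rw [Xd, fderiv_comp_lin _ hφ, Yd, ← map_neg]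
  congr 1
  ext <;> simp [Jr]

lemma Yd_Jr {φ : H n → ℝ} (hφ : IsTest univ φ) (i : Fin n) (ξ : H n) :
    Yd i (fun ξ => φ (Jr n ξ)) ξ = Xd i φ (Jr n ξ) := by
  rw [Yd, fderiv_comp_lin _ hφ, Xd]
  congr 1
  ext <;> simp [Jr]

lemma Xd_Pm {φ : H n → ℝ} (hφ : IsTest univ φ) (i j : Fin n) (ξ : H n) :
    Xd i (fun ξ => φ (Pm i j ξ)) ξ = Xd j φ (Pm i j ξ) := by
  rw [Xd, fderiv_comp_lin _ hφ, Xd]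
  congr 1
  have : ∀ k, (Pi.single i 1 : Fin n → ℝ) (Equiv.swap i j k) = (Pi.single j 1 : Fin n → ℝ) k := by
    intro k
    simp only [Pi.single_apply]
    congr 1
    rw [Equiv.swap_apply_eq_iff, Equiv.swap_apply_left]
  ext <;> simp [Pm, this]

lemma sym_all {u : H n → ℝ} (hcyl : IsCylindrical u) (i : Fin n)
    (h : ∀ φ, IsTest univ φ → ∫ ξ, u ξ * Xd i φ ξ = 0) (j : Fin n) (φ : H n → ℝ) (hφ : IsTest univ φ) :
    ∫ ξ, u ξ * Xd j φ ξ = 0 ∧ ∫ ξ, u ξ * Yd j φ ξ = 0 := by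
  have h1 : ∀ φ, IsTest univ φ → ∫ ξ, u ξ * Xd j φ ξ = 0 := by
    intro φ hφ
    rw [← h _ (comp_test (Pm i j) (Pm_four i j) hφ),
      ← sym_int hcyl (Pm i j) (Pm_four i j) (rsq_Pm i j) (fun _ => rfl)]
    simp only [Xd_Pm hφ]
  refine ⟨h1 φ hφ, ?_⟩
  have h2 := h1 _ (comp_test (Jr n) Jr_four hφ)
  simp only [Xd_Jr hφ] at h2
  rw [sym_int hcyl (Jr n) Jr_four rsq_Jr (fun _ => rfl) (fun ξ => - Yd j φ ξ)] at h2
  simpa [integral_neg] using h2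

lemma sym_all' {u : H n → ℝ} (hcyl : IsCylindrical u) (i : Fin n)
    (h : ∀ φ, IsTest univ φ → ∫ ξ, u ξ * Yd i φ ξ = 0) (j : Fin n) (φ : H n → ℝ) (hφ : IsTest univ φ) :
    ∫ ξ, u ξ * Xd j φ ξ = 0 ∧ ∫ ξ, u ξ * Yd j φ ξ = 0 := by
  refine sym_all hcyl i (fun φ hφ => ?_) j φ hφ
  have h2 := h _ (comp_test (Jr n) Jr_four hφ)
  simp only [Yd_Jr hφ] at h2
  rwa [sym_int hcyl (Jr n) Jr_four rsq_Jr (fun _ => rfl) (fun ξ => Xd i φ ξ)] at h2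

lemma int_G {G : H n → (Fin n → ℝ) × (Fin n → ℝ)} {g ψ : H n → ℝ}
    (hsq : ∀ K : Set (H n), K ⊆ univ → IsCompact K → IntegrableOn (fun ξ => ‖G ξ‖ ^ 2) K)
    (hg : AEStronglyMeasurable g) (hgG : ∀ ξ, |g ξ| ≤ ‖G ξ‖) (hψ : Continuous ψ)
    (hc : HasCompactSupport ψ) : Integrable fun ξ => g ξ * ψ ξ := by
  obtain ⟨M, hM⟩ := hψ.bounded_above_of_compact_support hc
  rw [← integrableOn_iff_integrable_of_support_subset (s := tsupport ψ)]
  · have h1 : IntegrableOn (fun ξ => M * (1 + ‖G ξ‖ ^ 2)) (tsupport ψ) :=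
      ((integrableOn_const hc.measure_lt_top.ne).add (hsq _ (subset_univ _) hc)).const_mul M
    refine Integrable.mono' h1 (hg.mul hψ.aestronglyMeasurable).restrict ?_
    refine Eventually.of_forall fun ξ => ?_
    rw [norm_mul, mul_comm]
    have h2 := hM ξ
    have h3 := hgG ξ
    have h0 := norm_nonneg (ψ ξ)
    rw [← Real.norm_eq_abs] at h3
    have h4 : ‖G ξ‖ ≤ 1 + ‖G ξ‖ ^ 2 := by nlinarith [sq_nonneg (‖G ξ‖ - 1), norm_nonneg (G ξ)]
    exact mul_le_mul h2 (h3.trans h4) (norm_nonneg _) (h0.trans h2)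
  · intro ξ hξ
    apply subset_tsupport
    rw [Function.mem_support] at *
    intro h; apply hξ; simp [h]

/-- coordinate times bump -/
def bx (i : Fin n) (k : ℕ) (ξ : H n) : ℝ := ξ.1 i * bmp n k ξ
/-- coordinate times bump -/
def bym (i : Fin n) (k : ℕ) (ξ : H n) : ℝ := ξ.2.1 i * bmp n k ξ

lemma bx_test (i : Fin n) (k : ℕ) : IsTest univ (bx i k) := by
  refine ⟨?_, (bmp n k).hasCompactSupport.mul_left, subset_univ _⟩
  have h1 : ContDiff ℝ 1 fun ξ : H n => ξ.1 i := by fun_prop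
  exact h1.mul (bmp_test k).contDiff

lemma by_test (i : Fin n) (k : ℕ) : IsTest univ (bym i k) := by
  refine ⟨?_, (bmp n k).hasCompactSupport.mul_left, subset_univ _⟩
  have h1 : ContDiff ℝ 1 fun ξ : H n => ξ.2.1 i := by fun_prop
  exact h1.mul (bmp_test k).contDiff

lemma bx_grad (i : Fin n) (ξ : H n) (a : (Fin n → ℝ) × (Fin n → ℝ)) :
    ∀ᶠ k : ℕ in atTop, hdot a (hGrad (bx i k) ξ) = a.1 i := by
  filter_upwards [bmp_ev ξ] with k hk
  have e : bx i k =ᶠ[𝓝 ξ] fun ζ : H n => ζ.1 i := by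
    filter_upwards [hk] with ζ hζ
    rw [bx, hζ, mul_one]
  have h1 : HasFDerivAt (fun ζ : H n => ζ.1 i)
      ((ContinuousLinearMap.proj i).comp (ContinuousLinearMap.fst ℝ (Fin n → ℝ) ((Fin n → ℝ) × ℝ))) ξ :=
    ContinuousLinearMap.hasFDerivAt ((ContinuousLinearMap.proj (R := ℝ) (φ := fun _ : Fin n => ℝ) i).comp
      (ContinuousLinearMap.fst ℝ (Fin n → ℝ) ((Fin n → ℝ) × ℝ)))
  simp only [hdot, hGrad, Xd, Yd, e.fderiv_eq, h1.fderiv]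
  simp [Pi.single_apply]

lemma by_grad (i : Fin n) (ξ : H n) (a : (Fin n → ℝ) × (Fin n → ℝ)) :
    ∀ᶠ k : ℕ in atTop, hdot a (hGrad (bym i k) ξ) = a.2 i := by
  filter_upwards [bmp_ev ξ] with k hk
  have e : bym i k =ᶠ[𝓝 ξ] fun ζ : H n => ζ.2.1 i := by
    filter_upwards [hk] with ζ hζ
    rw [bym, hζ, mul_one]
  have h1 : HasFDerivAt (fun ζ : H n => ζ.2.1 i)
      ((ContinuousLinearMap.proj i).comp ((ContinuousLinearMap.fst ℝ (Fin n → ℝ) ℝ).comp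
        (ContinuousLinearMap.snd ℝ (Fin n → ℝ) ((Fin n → ℝ) × ℝ)))) ξ :=
    ContinuousLinearMap.hasFDerivAt ((ContinuousLinearMap.proj (R := ℝ) (φ := fun _ : Fin n => ℝ) i).comp
      ((ContinuousLinearMap.fst ℝ (Fin n → ℝ) ℝ).comp
        (ContinuousLinearMap.snd ℝ (Fin n → ℝ) ((Fin n → ℝ) × ℝ))))
  simp only [hdot, hGrad, Xd, Yd, e.fderiv_eq, h1.fderiv]
  simp [Pi.single_apply]

lemma hdot_add (a b c : (Fin n → ℝ) × (Fin n → ℝ)) : hdot a (b + c) = hdot a b + hdot a c := by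
  simp only [hdot, Prod.fst_add, Prod.snd_add, Pi.add_apply, mul_add, Finset.sum_add_distrib]
  ring

lemma hGrad_add {φ ψ : H n → ℝ} (hφ : IsTest univ φ) (hψ : IsTest univ ψ) (ξ : H n) :
    hGrad (φ + ψ) ξ = hGrad φ ξ + hGrad ψ ξ := by
  simp only [hGrad, Xd_add hφ hψ, Yd_add hφ hψ]; rfl

lemma weak_C2 {u F : H n → ℝ} (hu : Continuous u) (hcyl : IsCylindrical u) (hF : Continuous F)
    (h : IsWeakSol univ u F) {φ : H n → ℝ} (hφ : ContDiff ℝ 2 φ) (hc : HasCompactSupport φ) :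
    ∫ ξ, u ξ * subLap φ ξ = - ∫ ξ, F ξ * φ ξ := by
  obtain ⟨G, hG, hsol⟩ := h
  have hφt : IsTest univ φ := test_of hφ (by norm_num) hc
  have hX := fun i => Xd_test hφ hc i
  have hY := fun i => Yd_test hφ hc i
  have iX : ∀ i, ∀ ψ, IsTest univ ψ → Integrable fun ξ => u ξ * Xd i ψ ξ := fun i ψ hψ =>
    int_cc hu (Xd_cont hψ.contDiff i) (Xd_supp hψ.compactSupport i)
  have iY : ∀ i, ∀ ψ, IsTest univ ψ → Integrable fun ξ => u ξ * Yd i ψ ξ := fun i ψ hψ =>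
    int_cc hu (Yd_cont hψ.contDiff i) (Yd_supp hψ.compactSupport i)
  have hL : ∫ ξ, u ξ * subLap φ ξ =
      (∑ i, ∫ ξ, u ξ * Xd i (Xd i φ) ξ) + ∑ i, ∫ ξ, u ξ * Yd i (Yd i φ) ξ := by
    simp only [subLap, mul_add, Finset.mul_sum]
    rw [integral_add (integrable_finsetSum _ fun i _ => iX i _ (hX i))
      (integrable_finsetSum _ fun i _ => iY i _ (hY i)),
      integral_finsetSum _ (fun i _ => iX i _ (hX i)), integral_finsetSum _ (fun i _ => iY i _ (hY i))]
  have addF : ∀ φ ψ : H n → ℝ, IsTest univ φ → IsTest univ ψ →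
      ∫ ξ, F ξ * (φ + ψ) ξ = (∫ ξ, F ξ * φ ξ) + ∫ ξ, F ξ * ψ ξ := by
    intro φ ψ hφ hψ
    rw [← integral_add (int_cc hF hφ.contDiff.continuous hφ.compactSupport)
      (int_cc hF hψ.contDiff.continuous hψ.compactSupport)]
    simp only [Pi.add_apply, mul_add]
  have Nadd : ∀ φ ψ : H n → ℝ, IsTest univ φ → IsTest univ ψ →
      (fun ξ => hdot (G ξ) (hGrad (φ + ψ) ξ)) =
        (fun ξ => hdot (G ξ) (hGrad φ ξ)) + (fun ξ => hdot (G ξ) (hGrad ψ ξ)) := by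
    intro φ ψ hφ hψ
    ext ξ
    simp only [hGrad_add hφ hψ, hdot_add, Pi.add_apply]
  by_cases m1 : ∀ i, AEStronglyMeasurable (fun ξ => (G ξ).1 i)
  · by_cases m2 : ∀ i, AEStronglyMeasurable (fun ξ => (G ξ).2 i)
    · have b1 : ∀ i ξ, |(G ξ).1 i| ≤ ‖G ξ‖ := fun i ξ =>
        (norm_le_pi_norm (G ξ).1 i).trans (norm_fst_le _)
      have b2 : ∀ i ξ, |(G ξ).2 i| ≤ ‖G ξ‖ := fun i ξ =>
        (norm_le_pi_norm (G ξ).2 i).trans (norm_snd_le _)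
      have j1 : ∀ i, Integrable fun ξ => (G ξ).1 i * Xd i φ ξ := fun i =>
        int_G hG.locSq (m1 i) (b1 i) (hX i).contDiff.continuous (hX i).compactSupport
      have j2 : ∀ i, Integrable fun ξ => (G ξ).2 i * Yd i φ ξ := fun i =>
        int_G hG.locSq (m2 i) (b2 i) (hY i).contDiff.continuous (hY i).compactSupport
      have e := hsol φ hφt
      simp only [hdot, hGrad] at e
      rw [integral_add (integrable_finsetSum _ fun i _ => j1 i)
        (integrable_finsetSum _ fun i _ => j2 i), integral_finsetSum _ (fun i _ => j1 i),
        integral_finsetSum _ (fun i _ => j2 i)] at e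
      rw [hL, ← e, Finset.sum_congr rfl fun i _ => hG.ibpX i _ (hX i),
        Finset.sum_congr rfl fun i _ => hG.ibpY i _ (hY i)]
      simp only [Finset.sum_neg_distrib]
      ring
    · push Not at m2
      obtain ⟨i, hi⟩ := m2
      have A1 := trick (fun φ ξ => (G ξ).2 i * φ ξ) (fun φ => - ∫ ξ, u ξ * Yd i φ ξ)
        (fun k => bmp n k) bmp_test (fun φ ψ _ _ => by ext ξ; simp [mul_add])
        (fun φ ψ hφ hψ => by
          simp only [Yd_add hφ hψ, Pi.add_apply, mul_add]
          rw [integral_add (iY i _ hφ) (iY i _ hψ)]; ring)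
        (fun φ hφ => by simp only [hG.ibpY i φ hφ, neg_neg]) _ hi
        (fun ξ => by
          refine tendsto_const_nhds.congr' ?_
          filter_upwards [bmp_ev ξ] with k hk
          rw [hk.eq_of_nhds, mul_one])
      have A2 := trick (fun φ ξ => hdot (G ξ) (hGrad φ ξ)) (fun φ => ∫ ξ, F ξ * φ ξ)
        (bym i) (by_test i) Nadd addF (fun φ hφ => (hsol φ hφ).symm) _ hi
        (fun ξ => by
          refine tendsto_const_nhds.congr' ?_
          filter_upwards [by_grad i ξ (G ξ)] with k hk
          rw [hk])
      have A3 := sym_all' hcyl i (fun φ hφ => neg_eq_zero.1 (A1 φ hφ))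
      rw [hL, A2 φ hφt, Finset.sum_congr rfl fun j _ => (A3 j _ (hX j)).1,
        Finset.sum_congr rfl fun j _ => (A3 j _ (hY j)).2]
      simp
  · push Not at m1
    obtain ⟨i, hi⟩ := m1
    have A1 := trick (fun φ ξ => (G ξ).1 i * φ ξ) (fun φ => - ∫ ξ, u ξ * Xd i φ ξ)
      (fun k => bmp n k) bmp_test (fun φ ψ _ _ => by ext ξ; simp [mul_add])
      (fun φ ψ hφ hψ => by
        simp only [Xd_add hφ hψ, Pi.add_apply, mul_add]
        rw [integral_add (iX i _ hφ) (iX i _ hψ)]; ring)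
      (fun φ hφ => by simp only [hG.ibpX i φ hφ, neg_neg]) _ hi
      (fun ξ => by
        refine tendsto_const_nhds.congr' ?_
        filter_upwards [bmp_ev ξ] with k hk
        rw [hk.eq_of_nhds, mul_one])
    have A2 := trick (fun φ ξ => hdot (G ξ) (hGrad φ ξ)) (fun φ => ∫ ξ, F ξ * φ ξ)
      (bx i) (bx_test i) Nadd addF (fun φ hφ => (hsol φ hφ).symm) _ hi
      (fun ξ => by
        refine tendsto_const_nhds.congr' ?_
        filter_upwards [bx_grad i ξ (G ξ)] with k hk
        rw [hk])
    have A3 := sym_all hcyl i (fun φ hφ => neg_eq_zero.1 (A1 φ hφ))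
    rw [hL, A2 φ hφt, Finset.sum_congr rfl fun j _ => (A3 j _ (hX j)).1,
      Finset.sum_congr rfl fun j _ => (A3 j _ (hY j)).2]
    simp

/-! ### Polar reduction -/

/-- squared radius on pairs -/
def rq (z : (Fin n → ℝ) × (Fin n → ℝ)) : ℝ := ∑ i, z.1 i ^ 2 + ∑ i, z.2 i ^ 2

lemma polar_xy (hn : 1 ≤ n) : ∃ C : ℝ, 0 < C ∧ ∀ h : ℝ → ℝ,
    ∫ z : (Fin n → ℝ) × (Fin n → ℝ), h (rq z) = C * ∫ s in Ioi (0 : ℝ), h s * s ^ (n - 1) := by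
  haveI : Nonempty (Fin n) := ⟨⟨0, hn⟩⟩
  let E := EuclideanSpace ℝ (Fin n ⊕ Fin n)
  refine ⟨(2 * n) * (volume : Measure E).real (Metric.ball 0 1) * 2⁻¹, ?_, fun h => ?_⟩
  · have h1 : 0 < (volume : Measure E).real (Metric.ball 0 1) :=
      ENNReal.toReal_pos (Metric.measure_ball_pos _ _ one_pos).ne' measure_ball_lt_top.ne
    have : (0 : ℝ) < n := by exact_mod_cast hn
    positivity
  · have e1 := (volume_measurePreserving_sumPiEquivProdPi (fun _ : Fin n ⊕ Fin n => ℝ)).integral_comp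
      (MeasurableEquiv.measurableEmbedding _)
      (fun z : (Fin n → ℝ) × (Fin n → ℝ) => h (rq z))
    have e2 := (EuclideanSpace.volume_preserving_symm_measurableEquiv_toLp (Fin n ⊕ Fin n)).integral_comp
      (MeasurableEquiv.measurableEmbedding _)
      (fun x : Fin n ⊕ Fin n → ℝ => h (rq (MeasurableEquiv.sumPiEquivProdPi (fun _ : Fin n ⊕ Fin n => ℝ) x)))
    rw [← e1, ← e2]
    have e3 : ∀ x : E, rq (MeasurableEquiv.sumPiEquivProdPi (fun _ : Fin n ⊕ Fin n => ℝ)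
        ((MeasurableEquiv.toLp 2 (Fin n ⊕ Fin n → ℝ)).symm x)) = ‖x‖ ^ 2 := by
      intro x
      rw [EuclideanSpace.norm_sq_eq, Fintype.sum_sum_type]
      simp only [Real.norm_eq_abs, sq_abs]
      rfl
    have e4 := integral_fun_norm_addHaar (volume : Measure E) (fun r => h (r ^ 2))
    have hd : Module.finrank ℝ E = 2 * n := by simp [E]; ring
    rw [hd] at e4
    have e5 := integral_comp_rpow_Ioi_of_pos (g := fun s => h s * s ^ (n - 1)) (p := 2) (by norm_num)
    rw [← e5]
    refine Eq.trans ?_ (e4.trans ?_)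
    · exact integral_congr_ae (Eventually.of_forall fun x => by simp only [e3])
    · have : ∫ y in Ioi (0 : ℝ), ((2 : ℝ) * y ^ ((2 : ℝ) - 1)) • (h (y ^ (2 : ℝ)) * (y ^ (2 : ℝ)) ^ (n - 1))
          = ∫ y in Ioi (0 : ℝ), 2 * (y ^ (2 * n - 1) • h (y ^ 2)) := by
        refine setIntegral_congr_fun measurableSet_Ioi fun y hy => ?_
        have k : 2 * n - 1 = 1 + 2 * (n - 1) := by omega
        simp only [smul_eq_mul]
        rw [k, show (2 : ℝ) - 1 = 1 by norm_num, rpow_one, rpow_two, pow_add, pow_mul, pow_one]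
        ring
      rw [this, integral_const_mul]
      simp only [smul_eq_mul, nsmul_eq_mul]
      push_cast
      ring

lemma polar_H (hn : 1 ≤ n) : ∃ C : ℝ, 0 < C ∧ ∀ g : ℝ × ℝ → ℝ,
    Integrable (fun ξ : H n => g (rsq ξ, ξ.2.2)) → IntegrableOn (fun p => g p * p.1 ^ (n - 1)) Pp →
    ∫ ξ : H n, g (rsq ξ, ξ.2.2) = C * ∫ p in Pp, g p * p.1 ^ (n - 1) := by
  obtain ⟨C, hC, hp⟩ := polar_xy hn
  refine ⟨C, hC, fun g h1 h2 => ?_⟩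
  have mp : MeasurePreserving (MeasurableEquiv.prodAssoc (α := Fin n → ℝ) (β := Fin n → ℝ) (γ := ℝ))
      volume volume := measurePreserving_prodAssoc volume volume volume
  have e1 := mp.integral_comp (MeasurableEquiv.measurableEmbedding _)
    (fun ξ : H n => g (rsq ξ, ξ.2.2))
  have i1 := (mp.integrable_comp_emb (MeasurableEquiv.measurableEmbedding _)).2 h1
  have hf : ∀ z : ((Fin n → ℝ) × (Fin n → ℝ)) × ℝ,
      g (rsq (MeasurableEquiv.prodAssoc z), (MeasurableEquiv.prodAssoc z).2.2) = g (rq z.1, z.2) :=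
    fun z => rfl
  rw [← e1]
  simp only [hf]
  have i2 : Integrable (fun z : ((Fin n → ℝ) × (Fin n → ℝ)) × ℝ => g (rq z.1, z.2))
    ((volume : Measure ((Fin n → ℝ) × (Fin n → ℝ))).prod (volume : Measure ℝ)) := i1
  have hP : Pp = Ioi (0 : ℝ) ×ˢ (univ : Set ℝ) := by ext p; simp [Pp]
  have hv : (volume : Measure (ℝ × ℝ)).restrict Pp = (volume.restrict (Ioi 0)).prod volume := by
    rw [hP, Measure.volume_eq_prod, ← Measure.prod_restrict, Measure.restrict_univ]
  rw [IntegrableOn, hv] at h2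
  rw [hv, integral_prod_symm _ h2, ← integral_const_mul]
  refine (integral_prod_symm _ i2).trans ?_
  refine integral_congr_ae (Eventually.of_forall fun t => ?_)
  exact hp (fun s => g (s, t))

/-! ### Cylindrical test functions -/

/-- Extension by zero off the half plane. -/
def ex (a : ℝ × ℝ → ℝ) : ℝ × ℝ → ℝ := Pp.indicator a

lemma ex_of {a : ℝ × ℝ → ℝ} {p : ℝ × ℝ} (hp : p ∈ Pp) : ex a p = a p := indicator_of_mem hp a

lemma ex_off {a : ℝ × ℝ → ℝ} {K : Set (ℝ × ℝ)} (hz : ∀ p ∈ Pp, p ∉ K → a p = 0) {p : ℝ × ℝ}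
    (hp : p ∉ K) : ex a p = 0 := by
  by_cases h : p ∈ Pp
  · rw [ex_of h, hz p h hp]
  · exact indicator_of_notMem h a

lemma ex_near {a : ℝ × ℝ → ℝ} {p : ℝ × ℝ} (hp : p ∈ Pp) : ex a =ᶠ[𝓝 p] a := by
  filter_upwards [isOpen_Pp.mem_nhds hp] with q hq using ex_of hq

lemma ex_far {a : ℝ × ℝ → ℝ} {K : Set (ℝ × ℝ)} (hK : IsCompact K)
    (hz : ∀ p ∈ Pp, p ∉ K → a p = 0) {p : ℝ × ℝ} (hp : p ∉ K) : ex a =ᶠ[𝓝 p] fun _ => 0 := by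
  filter_upwards [hK.isClosed.isOpen_compl.mem_nhds hp] with q hq using ex_off hz hq

lemma ex_cont {a : ℝ × ℝ → ℝ} {K : Set (ℝ × ℝ)} (hK : IsCompact K) (hKP : K ⊆ Pp)
    (hz : ∀ p ∈ Pp, p ∉ K → a p = 0) (ha : ContinuousOn a Pp) : Continuous (ex a) := by
  rw [continuous_iff_continuousAt]
  intro p
  by_cases h : p ∈ K
  · exact ((ha.continuousAt (isOpen_Pp.mem_nhds (hKP h))).congr (ex_near (hKP h)).symm)
  · exact continuousAt_const.congr (ex_far hK hz h).symm

lemma ex_fd {a b c : ℝ × ℝ → ℝ} {K : Set (ℝ × ℝ)} (hK : IsCompact K) (hKP : K ⊆ Pp)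
    (hz : ∀ p ∈ Pp, p ∉ K → a p = 0) (hd : ∀ p ∈ Pp, HasFDerivAt a (lin (b p) (c p)) p) :
    (∀ p ∈ Pp, p ∉ K → b p = 0) ∧ (∀ p ∈ Pp, p ∉ K → c p = 0) ∧
      ∀ p, HasFDerivAt (ex a) (lin (ex b p) (ex c p)) p := by
  have key : ∀ p ∈ Pp, p ∉ K → lin (b p) (c p) = 0 := by
    intro p hp hpK
    have h1 : HasFDerivAt (ex a) (lin (b p) (c p)) p := (hd p hp).congr_of_eventuallyEq (ex_near hp)
    have h2 : HasFDerivAt (ex a) (0 : ℝ × ℝ →L[ℝ] ℝ) p :=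
      (hasFDerivAt_const (0 : ℝ) p).congr_of_eventuallyEq (ex_far hK hz hpK)
    exact h1.unique h2
  have hb : ∀ p ∈ Pp, p ∉ K → b p = 0 := by
    intro p hp hpK
    have := congrArg (fun L : ℝ × ℝ →L[ℝ] ℝ => L (1, 0)) (key p hp hpK)
    simpa using this
  have hc : ∀ p ∈ Pp, p ∉ K → c p = 0 := by
    intro p hp hpK
    have := congrArg (fun L : ℝ × ℝ →L[ℝ] ℝ => L (0, 1)) (key p hp hpK)
    simpa using this
  refine ⟨hb, hc, fun p => ?_⟩
  by_cases h : p ∈ K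
  · rw [ex_of (hKP h), ex_of (hKP h)]
    exact (hd p (hKP h)).congr_of_eventuallyEq (ex_near (hKP h))
  · rw [ex_off hb h, ex_off hc h]
    have : lin 0 0 = 0 := by simp [lin]
    rw [this]
    exact (hasFDerivAt_const (0 : ℝ) p).congr_of_eventuallyEq (ex_far hK hz h)

/-- The cylindrical projection. -/
def Rp (ξ : H n) : ℝ × ℝ := (rsq ξ, ξ.2.2)

lemma rsq_nonneg (ξ : H n) : 0 ≤ rsq ξ := by unfold rsq; positivity

lemma rsq_cont : Continuous (rsq : H n → ℝ) := by unfold rsq; fun_prop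

lemma Rp_cont : Continuous (Rp : H n → ℝ × ℝ) := by
  have := rsq_cont (n := n)
  unfold Rp; fun_prop

lemma Rp_contDiff (k : WithTop ℕ∞) : ContDiff ℝ k (Rp : H n → ℝ × ℝ) := by
  unfold Rp rsq
  refine ContDiff.prodMk (ContDiff.add (ContDiff.sum fun i _ => ?_) (ContDiff.sum fun i _ => ?_)) ?_
  all_goals fun_prop

lemma rsq_X (ξ : H n) (i : Fin n) :
    fderiv ℝ Rp ξ (Pi.single i 1, 0, 2 * ξ.2.1 i) = (2 * ξ.1 i, 2 * ξ.2.1 i) := by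
  have hx : ∀ j, HasFDerivAt (fun ζ : H n => ζ.1 j)
      ((ContinuousLinearMap.proj (R := ℝ) (φ := fun _ : Fin n => ℝ) j).comp
      (ContinuousLinearMap.fst ℝ (Fin n → ℝ) ((Fin n → ℝ) × ℝ))) ξ := fun j =>
    ContinuousLinearMap.hasFDerivAt ((ContinuousLinearMap.proj (R := ℝ) (φ := fun _ : Fin n => ℝ) j).comp
      (ContinuousLinearMap.fst ℝ (Fin n → ℝ) ((Fin n → ℝ) × ℝ)))
  have hy : ∀ j, HasFDerivAt (fun ζ : H n => ζ.2.1 j)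
      ((ContinuousLinearMap.proj (R := ℝ) (φ := fun _ : Fin n => ℝ) j).comp
      ((ContinuousLinearMap.fst ℝ (Fin n → ℝ) ℝ).comp
        (ContinuousLinearMap.snd ℝ (Fin n → ℝ) ((Fin n → ℝ) × ℝ)))) ξ := fun j =>
    ContinuousLinearMap.hasFDerivAt ((ContinuousLinearMap.proj (R := ℝ) (φ := fun _ : Fin n => ℝ) j).comp
      ((ContinuousLinearMap.fst ℝ (Fin n → ℝ) ℝ).comp
        (ContinuousLinearMap.snd ℝ (Fin n → ℝ) ((Fin n → ℝ) × ℝ))))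
  have ht : HasFDerivAt (fun ζ : H n => ζ.2.2) ((ContinuousLinearMap.snd ℝ (Fin n → ℝ) ℝ).comp
        (ContinuousLinearMap.snd ℝ (Fin n → ℝ) ((Fin n → ℝ) × ℝ))) ξ :=
    ContinuousLinearMap.hasFDerivAt ((ContinuousLinearMap.snd ℝ (Fin n → ℝ) ℝ).comp
        (ContinuousLinearMap.snd ℝ (Fin n → ℝ) ((Fin n → ℝ) × ℝ)))
  have hR : HasFDerivAt Rp _ ξ := ((HasFDerivAt.fun_sum (u := Finset.univ) fun j _ => (hx j).pow 2).add
    (HasFDerivAt.fun_sum (u := Finset.univ) fun j _ => (hy j).pow 2)).prodMk ht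
  rw [hR.fderiv]
  ext <;> simp [Pi.single_apply]

lemma rsq_Y (ξ : H n) (i : Fin n) :
    fderiv ℝ Rp ξ (0, Pi.single i 1, -(2 * ξ.1 i)) = (2 * ξ.2.1 i, -(2 * ξ.1 i)) := by
  have hx : ∀ j, HasFDerivAt (fun ζ : H n => ζ.1 j)
      ((ContinuousLinearMap.proj (R := ℝ) (φ := fun _ : Fin n => ℝ) j).comp
      (ContinuousLinearMap.fst ℝ (Fin n → ℝ) ((Fin n → ℝ) × ℝ))) ξ := fun j =>
    ContinuousLinearMap.hasFDerivAt ((ContinuousLinearMap.proj (R := ℝ) (φ := fun _ : Fin n => ℝ) j).comp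
      (ContinuousLinearMap.fst ℝ (Fin n → ℝ) ((Fin n → ℝ) × ℝ)))
  have hy : ∀ j, HasFDerivAt (fun ζ : H n => ζ.2.1 j)
      ((ContinuousLinearMap.proj (R := ℝ) (φ := fun _ : Fin n => ℝ) j).comp
      ((ContinuousLinearMap.fst ℝ (Fin n → ℝ) ℝ).comp
        (ContinuousLinearMap.snd ℝ (Fin n → ℝ) ((Fin n → ℝ) × ℝ)))) ξ := fun j =>
    ContinuousLinearMap.hasFDerivAt ((ContinuousLinearMap.proj (R := ℝ) (φ := fun _ : Fin n => ℝ) j).comp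
      ((ContinuousLinearMap.fst ℝ (Fin n → ℝ) ℝ).comp
        (ContinuousLinearMap.snd ℝ (Fin n → ℝ) ((Fin n → ℝ) × ℝ))))
  have ht : HasFDerivAt (fun ζ : H n => ζ.2.2) ((ContinuousLinearMap.snd ℝ (Fin n → ℝ) ℝ).comp
        (ContinuousLinearMap.snd ℝ (Fin n → ℝ) ((Fin n → ℝ) × ℝ))) ξ :=
    ContinuousLinearMap.hasFDerivAt ((ContinuousLinearMap.snd ℝ (Fin n → ℝ) ℝ).comp
        (ContinuousLinearMap.snd ℝ (Fin n → ℝ) ((Fin n → ℝ) × ℝ)))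
  have hR : HasFDerivAt Rp _ ξ := ((HasFDerivAt.fun_sum (u := Finset.univ) fun j _ => (hx j).pow 2).add
    (HasFDerivAt.fun_sum (u := Finset.univ) fun j _ => (hy j).pow 2)).prodMk ht
  rw [hR.fderiv]
  ext <;> simp [Pi.single_apply]

lemma cyl_fd {A B C : ℝ × ℝ → ℝ} (h : ∀ p, HasFDerivAt A (lin (B p) (C p)) p) (ξ : H n) :
    HasFDerivAt (fun ξ => A (Rp ξ)) ((lin (B (Rp ξ)) (C (Rp ξ))).comp (fderiv ℝ Rp ξ)) ξ :=
  (h (Rp ξ)).comp ξ ((Rp_contDiff 1).differentiable (by norm_num) ξ).hasFDerivAt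

lemma Xd_cyl {A B C : ℝ × ℝ → ℝ} (h : ∀ p, HasFDerivAt A (lin (B p) (C p)) p) (i : Fin n) :
    Xd i (fun ξ => A (Rp ξ)) = fun ξ => B (Rp ξ) * (2 * ξ.1 i) + C (Rp ξ) * (2 * ξ.2.1 i) := by
  ext ξ
  rw [Xd, (cyl_fd h ξ).fderiv, ContinuousLinearMap.comp_apply, rsq_X, lin_apply]

lemma Yd_cyl {A B C : ℝ × ℝ → ℝ} (h : ∀ p, HasFDerivAt A (lin (B p) (C p)) p) (i : Fin n) :
    Yd i (fun ξ => A (Rp ξ)) = fun ξ => B (Rp ξ) * (2 * ξ.2.1 i) - C (Rp ξ) * (2 * ξ.1 i) := by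
  ext ξ
  rw [Yd, (cyl_fd h ξ).fderiv, ContinuousLinearMap.comp_apply, rsq_Y, lin_apply]
  ring

lemma subLap_cyl {A B C BB BC CC : ℝ × ℝ → ℝ} (h : ∀ p, HasFDerivAt A (lin (B p) (C p)) p)
    (hB : ∀ p, HasFDerivAt B (lin (BB p) (BC p)) p) (hC : ∀ p, HasFDerivAt C (lin (BC p) (CC p)) p)
    (ξ : H n) : subLap (fun ξ => A (Rp ξ)) ξ =
      4 * (rsq ξ * (BB (Rp ξ) + CC (Rp ξ)) + n * B (Rp ξ)) := by
  have hx : ∀ j, HasFDerivAt (fun ζ : H n => 2 * ζ.1 j)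
      ((2 : ℝ) • (ContinuousLinearMap.proj (R := ℝ) (φ := fun _ : Fin n => ℝ) j).comp
      (ContinuousLinearMap.fst ℝ (Fin n → ℝ) ((Fin n → ℝ) × ℝ))) ξ := fun j =>
    (ContinuousLinearMap.hasFDerivAt ((ContinuousLinearMap.proj (R := ℝ) (φ := fun _ : Fin n => ℝ) j).comp
      (ContinuousLinearMap.fst ℝ (Fin n → ℝ) ((Fin n → ℝ) × ℝ)))).const_mul 2
  have hy : ∀ j, HasFDerivAt (fun ζ : H n => 2 * ζ.2.1 j)
      ((2 : ℝ) • (ContinuousLinearMap.proj (R := ℝ) (φ := fun _ : Fin n => ℝ) j).comp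
      ((ContinuousLinearMap.fst ℝ (Fin n → ℝ) ℝ).comp
        (ContinuousLinearMap.snd ℝ (Fin n → ℝ) ((Fin n → ℝ) × ℝ)))) ξ := fun j =>
    (ContinuousLinearMap.hasFDerivAt ((ContinuousLinearMap.proj (R := ℝ) (φ := fun _ : Fin n => ℝ) j).comp
      ((ContinuousLinearMap.fst ℝ (Fin n → ℝ) ℝ).comp
        (ContinuousLinearMap.snd ℝ (Fin n → ℝ) ((Fin n → ℝ) × ℝ))))).const_mul 2
  have eX : ∀ i, Xd i (Xd i fun ξ : H n => A (Rp ξ)) ξ =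
      4 * (BB (Rp ξ) * ξ.1 i ^ 2 + 2 * (BC (Rp ξ) * (ξ.1 i * ξ.2.1 i)) + CC (Rp ξ) * ξ.2.1 i ^ 2)
        + 2 * B (Rp ξ) := by
    intro i
    have h1 : HasFDerivAt (Xd i fun ξ : H n => A (Rp ξ)) _ ξ :=
      (((cyl_fd hB ξ).mul (hx i)).add ((cyl_fd hC ξ).mul (hy i))).congr_of_eventuallyEq
        (Eventually.of_forall fun ζ => congrFun (Xd_cyl h i) ζ)
    rw [Xd, h1.fderiv]
    simp only [add_apply, smul_apply, ContinuousLinearMap.comp_apply, rsq_X, lin_apply]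
    simp
    ring
  have eY : ∀ i, Yd i (Yd i fun ξ : H n => A (Rp ξ)) ξ =
      4 * (BB (Rp ξ) * ξ.2.1 i ^ 2 - 2 * (BC (Rp ξ) * (ξ.1 i * ξ.2.1 i)) + CC (Rp ξ) * ξ.1 i ^ 2)
        + 2 * B (Rp ξ) := by
    intro i
    have h1 : HasFDerivAt (Yd i fun ξ : H n => A (Rp ξ)) _ ξ :=
      (((cyl_fd hB ξ).mul (hy i)).sub ((cyl_fd hC ξ).mul (hx i))).congr_of_eventuallyEq
        (Eventually.of_forall fun ζ => congrFun (Yd_cyl h i) ζ)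
    rw [Yd, h1.fderiv]
    simp only [add_apply, sub_apply, smul_apply, ContinuousLinearMap.comp_apply, rsq_Y, lin_apply]
    simp
    ring
  rw [subLap, ← Finset.sum_add_distrib]
  have : ∀ i : Fin n, Xd i (Xd i fun ξ : H n => A (Rp ξ)) ξ + Yd i (Yd i fun ξ : H n => A (Rp ξ)) ξ =
      (4 * (BB (Rp ξ) + CC (Rp ξ))) * (ξ.1 i ^ 2 + ξ.2.1 i ^ 2) + 4 * B (Rp ξ) := by
    intro i
    rw [eX, eY]; ring
  rw [Finset.sum_congr rfl fun i _ => this i, Finset.sum_add_distrib, ← Finset.mul_sum,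
    Finset.sum_add_distrib, rsq]
  simp
  ring

lemma contDiff_two {A B C BB BC CC : ℝ × ℝ → ℝ} (h : ∀ p, HasFDerivAt A (lin (B p) (C p)) p)
    (hB : ∀ p, HasFDerivAt B (lin (BB p) (BC p)) p) (hC : ∀ p, HasFDerivAt C (lin (BC p) (CC p)) p)
    (c1 : Continuous BB) (c2 : Continuous BC) (c3 : Continuous CC) : ContDiff ℝ 2 A := by
  have hl : ∀ {a b : ℝ × ℝ → ℝ}, Continuous a → Continuous b → Continuous fun p => lin (a p) (b p) := by
    intro a b ha hb; unfold lin; fun_prop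
  have dB : ContDiff ℝ 1 B := contDiff_one_iff_hasFDerivAt.2 ⟨_, hl c1 c2, hB⟩
  have dC : ContDiff ℝ 1 C := contDiff_one_iff_hasFDerivAt.2 ⟨_, hl c2 c3, hC⟩
  have : ContDiff ℝ ((1 : ℕ) + 1) A := by
    refine contDiff_succ_iff_hasFDerivAt.2 ⟨_, ?_, h⟩
    have : ContDiff ℝ 1 fun p => lin (B p) (C p) := by
      unfold lin
      exact (dB.smul contDiff_const).add (dC.smul contDiff_const)
    exact_mod_cast this
  convert this using 1
  norm_num

lemma supp_cyl {A : ℝ × ℝ → ℝ} {K : Set (ℝ × ℝ)} (hK : IsCompact K) (hz : ∀ p, p ∉ K → A p = 0) :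
    HasCompactSupport fun ξ : H n => A (Rp ξ) := by
  obtain ⟨M, hM⟩ := hK.isBounded.exists_norm_le
  refine HasCompactSupport.intro (isCompact_closedBall (0 : H n) (1 + M)) fun ξ hξ => hz _ fun hc => hξ ?_
  have h1 := hM _ hc
  have hr : rsq ξ ≤ M := (le_abs_self _).trans ((norm_fst_le (Rp ξ)).trans h1)
  have ht : |ξ.2.2| ≤ M := (norm_snd_le (Rp ξ)).trans h1
  have hM0 : 0 ≤ M := (abs_nonneg _).trans ht
  have sq : ∀ x : ℝ, x ^ 2 ≤ M → |x| ≤ 1 + M := fun x hx => by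
    rw [← sq_abs] at hx; nlinarith [abs_nonneg x]
  have hx : ∀ i, ξ.1 i ^ 2 ≤ M := fun i => by
    have h2 := Finset.single_le_sum (f := fun i => ξ.1 i ^ 2) (fun i _ => sq_nonneg _) (Finset.mem_univ i)
    have h3 : 0 ≤ ∑ i, ξ.2.1 i ^ 2 := by positivity
    have : rsq ξ = ∑ i, ξ.1 i ^ 2 + ∑ i, ξ.2.1 i ^ 2 := rfl
    linarith
  have hy : ∀ i, ξ.2.1 i ^ 2 ≤ M := fun i => by
    have h2 := Finset.single_le_sum (f := fun i => ξ.2.1 i ^ 2) (fun i _ => sq_nonneg _) (Finset.mem_univ i)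
    have h3 : 0 ≤ ∑ i, ξ.1 i ^ 2 := by positivity
    have : rsq ξ = ∑ i, ξ.1 i ^ 2 + ∑ i, ξ.2.1 i ^ 2 := rfl
    linarith
  rw [mem_closedBall_zero_iff]
  refine max_le ?_ (max_le ?_ ?_)
  · exact (pi_norm_le_iff_of_nonneg (by positivity)).2 fun i => sq _ (hx i)
  · exact (pi_norm_le_iff_of_nonneg (by positivity)).2 fun i => sq _ (hy i)
  · exact ht.trans (by linarith)

/-! ### The reduced equation -/

/-- A point with given cylindrical coordinates. -/
def pt (hn : 1 ≤ n) (p : ℝ × ℝ) : H n := (Pi.single ⟨0, hn⟩ (√p.1), 0, p.2)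

lemma pt_cont (hn : 1 ≤ n) : Continuous (pt hn) := by
  unfold pt
  refine Continuous.prodMk ?_ (by fun_prop)
  exact (continuous_single (A := fun _ : Fin n => ℝ) (⟨0, hn⟩ : Fin n)).comp (by fun_prop)

lemma rsq_pt (hn : 1 ≤ n) {p : ℝ × ℝ} (hp : 0 ≤ p.1) : rsq (pt hn p) = p.1 := by
  simp only [rsq, pt]
  rw [Finset.sum_eq_single (⟨0, hn⟩ : Fin n)]
  · simp [Real.sq_sqrt hp]
  · intro b _ hb; simp [hb]
  · simp

/-- The reduced function `s^{n/2} u`. -/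
def wr (hn : 1 ≤ n) (u : H n → ℝ) (p : ℝ × ℝ) : ℝ := p.1 ^ ((n : ℝ) / 2) * u (pt hn p)

lemma wr_cont (hn : 1 ≤ n) {u : H n → ℝ} (hu : Continuous u) : ContinuousOn (wr hn u) Pp := by
  unfold wr
  refine ContinuousOn.mul ?_ (hu.comp (pt_cont hn)).continuousOn
  exact ContinuousOn.rpow_const (by fun_prop) fun p hp => Or.inl (Pp_pos hp).ne'

lemma cyl_pt (hn : 1 ≤ n) {u : H n → ℝ} (hcyl : IsCylindrical u) (ξ : H n) : u ξ = u (pt hn (Rp ξ)) :=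
  hcyl _ _ (rsq_pt hn (p := Rp ξ) (rsq_nonneg ξ)).symm rfl

/-- The zeroth-order constant. -/
def mn (n : ℕ) : ℝ := ((n : ℝ) / 2) ^ 2 - (n : ℝ) / 2

lemma polar_K (hn : 1 ≤ n) {K : Set (ℝ × ℝ)} (hK : IsCompact K) (hKP : K ⊆ Pp) :
    ∃ C : ℝ, 0 < C ∧ ∀ b c : ℝ × ℝ → ℝ, Continuous b → Continuous c → (∀ p, p ∉ K → c p = 0) →
      ∫ ξ : H n, (fun p => b p * c p) (rsq ξ, ξ.2.2) = C * ∫ p in Pp, (b p * c p) * p.1 ^ (n - 1) := by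
  obtain ⟨C, hC, pol⟩ := polar_H hn
  refine ⟨C, hC, fun b c hb hc hz => pol (fun p => b p * c p) ?_ ?_⟩
  · have s1 : HasCompactSupport fun ξ : H n => (fun p => b p * c p) (Rp ξ) :=
      supp_cyl (A := fun p => b p * c p) hK (fun p hp => by simp only [hz p hp, mul_zero])
    have s2 : Continuous fun ξ : H n => (fun p => b p * c p) (Rp ξ) := (hb.mul hc).comp Rp_cont
    have s3 : Integrable (fun ξ : H n => (fun p => b p * c p) (Rp ξ)) :=
      s2.integrable_of_hasCompactSupport s1
    exact s3
  · refine integrableOn_of_compact (by fun_prop) hK hKP fun p _ hp => ?_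
    simp only [hz p hp]; ring

set_option maxHeartbeats 1000000 in
lemma weakRad_sol (hn : 1 ≤ n) {u F : H n → ℝ} (hu : Continuous u) (hcyl : IsCylindrical u)
    (hF : Continuous F) (hFcyl : IsCylindrical F) (h : IsWeakSol univ u F)
    {p0 : ℝ × ℝ} (h0 : p0 ∈ Pp) {η : ℝ} (hη : 0 < η) :
    WeakRad (mn n) p0 η (wr hn u) (fun p => -(1 / 4) * (p.1 ^ ((n : ℝ) / 2 + 1) * F (pt hn p))) := by
  intro χ χ1 χ2 hχ
  set a : ℝ := -((n : ℝ) / 2) with ha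
  set X := J2.rad p0 χ χ1 χ2 with hX
  have hXv : X.Valid := J2.rad_valid h0 hχ
  set j := (J2.spow a).mul X with hj
  have hjv : j.Valid := (J2.spow_valid a).mul hXv
  have hK := Bc_compact h0 hη
  have hKP := Bc_sub p0 η
  have z0 : ∀ p ∈ Pp, p ∉ Bc p0 η → j.v p = 0 := by
    intro p hp hpn
    have : 1 + η ≤ cc p0 p := by
      by_contra hc
      exact hpn ⟨hp, (not_le.1 hc).le⟩
    have e : X.v p = 0 := hχ.z0 _ this
    simp [hj, J2.mul, e]
  obtain ⟨zs, zt, d⟩ := ex_fd hK hKP z0 hjv.d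
  obtain ⟨zss, zst, ds⟩ := ex_fd hK hKP zs hjv.ds
  obtain ⟨_, ztt, dt⟩ := ex_fd hK hKP zt hjv.dt
  have cv := ex_cont hK hKP z0 hjv.cv
  have cs := ex_cont hK hKP zs hjv.cs
  have css := ex_cont hK hKP zss hjv.css
  have cst := ex_cont hK hKP zst hjv.cst
  have ctt := ex_cont hK hKP ztt hjv.ctt
  have hC2 : ContDiff ℝ 2 fun ξ : H n => ex j.v (Rp ξ) :=
    (contDiff_two d ds dt css cst ctt).comp (Rp_contDiff 2)
  have hcs : HasCompactSupport fun ξ : H n => ex j.v (Rp ξ) := supp_cyl hK fun p hp => ex_off z0 hp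
  have key := weak_C2 hu hcyl hF h hC2 hcs
  set L : ℝ × ℝ → ℝ := fun p => 4 * (p.1 * (ex j.ss p + ex j.tt p) + n * ex j.s p) with hL
  have cL : Continuous L := by simp only [hL]; fun_prop
  have zL : ∀ p, p ∉ Bc p0 η → L p = 0 := fun p hp => by
    simp only [hL, ex_off zss hp, ex_off ztt hp, ex_off zs hp]; ring
  have eL : ∀ ξ : H n, u ξ * subLap (fun ξ : H n => ex j.v (Rp ξ)) ξ =
      (fun p => u (pt hn p) * L p) (rsq ξ, ξ.2.2) := by
    intro ξ
    rw [subLap_cyl d ds dt, cyl_pt hn hcyl ξ]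
    rfl
  have eF : ∀ ξ : H n, F ξ * ex j.v (Rp ξ) = (fun p => F (pt hn p) * ex j.v p) (rsq ξ, ξ.2.2) := by
    intro ξ
    rw [cyl_pt hn hFcyl ξ]
    rfl
  simp only [eL, eF] at key
  obtain ⟨C, hC, mkI⟩ := polar_K hn hK hKP
  have cu := hu.comp (pt_cont hn)
  have cF := hF.comp (pt_cont hn)
  have k1 := mkI (fun p => u (pt hn p)) L cu cL zL
  have k2 := mkI (fun p => F (pt hn p)) (ex j.v) cF cv (fun p hp => ex_off z0 hp)
  rw [k1, k2, ← mul_neg] at key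
  have key2 := mul_left_cancel₀ hC.ne' key
  have nn : (n : ℝ) = -2 * a := by rw [ha]; ring
  have t1 : ∫ p in Pp, u (pt hn p) * L p * p.1 ^ (n - 1) =
      4 * ∫ p in Pp, wr hn u p * Lc (mn n) χ χ1 χ2 (cc p0 p) / p.1 ^ 2 := by
    rw [← integral_const_mul]
    refine setIntegral_congr_fun isOpen_Pp.measurableSet fun p hp => ?_
    have hs := Pp_pos hp
    have lap := J2.rad_lap h0 hp χ χ1 χ2
    rw [← hX] at lap
    have e1 : Lc (mn n) χ χ1 χ2 (cc p0 p) = p.1 ^ 2 * (X.ss p + X.tt p) - mn n * X.v p := by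
      rw [lap]; rfl
    have q1 : p.1 ^ (a - 1) = p.1 ^ a / p.1 := by rw [rpow_sub_one hs.ne']
    have q2 : p.1 ^ (a - 1 - 1) = p.1 ^ a / p.1 / p.1 := by rw [rpow_sub_one hs.ne', q1]
    have q3 : p.1 ^ ((n : ℝ) / 2) = p.1 ^ (n - 1) * p.1 * p.1 ^ a := by
      rw [← pow_succ, Nat.sub_add_cancel hn, ← rpow_natCast, ← rpow_add hs, ha]
      congr 1; ring
    simp only [hL, ex_of hp]
    rw [e1, wr, q3]
    simp only [hj, J2.mul, J2.spow, J2.comp, J2.S, q1, q2, mn, nn]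
    field_simp
    ring
  have t2 : ∫ p in Pp, F (pt hn p) * ex j.v p * p.1 ^ (n - 1) =
      ∫ p in Pp, p.1 ^ ((n : ℝ) / 2 + 1) * F (pt hn p) * χ (cc p0 p) / p.1 ^ 2 := by
    refine setIntegral_congr_fun isOpen_Pp.measurableSet fun p hp => ?_
    have hs := Pp_pos hp
    have q3 : p.1 ^ ((n : ℝ) / 2 + 1) = p.1 ^ (n - 1) * p.1 ^ 2 * p.1 ^ a := by
      rw [← pow_add, ← rpow_natCast, ← rpow_add hs, ha]
      congr 1
      have : n - 1 + 2 = n + 1 := by omega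
      rw [this]; push_cast; ring
    have e1 : X.v p = χ (cc p0 p) := rfl
    simp only [ex_of hp]
    rw [q3]
    simp only [hj, J2.mul, J2.spow, J2.comp, J2.S, e1]
    field_simp
  rw [t1, t2] at key2
  have t3 : ∫ p in Pp, -(1 / 4) * (p.1 ^ ((n : ℝ) / 2 + 1) * F (pt hn p)) * χ (cc p0 p) / p.1 ^ 2 =
      -(1 / 4) * ∫ p in Pp, p.1 ^ ((n : ℝ) / 2 + 1) * F (pt hn p) * χ (cc p0 p) / p.1 ^ 2 := by
    rw [← integral_const_mul]
    refine setIntegral_congr_fun isOpen_Pp.measurableSet fun p hp => ?_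
    ring
  rw [t3]
  linarith

/-! ### Comparison with a barrier -/

lemma WeakRad.sub_mul {m : ℝ} {p0 : ℝ × ℝ} {η k : ℝ} {W1 G1 W2 G2 : ℝ × ℝ → ℝ} (h0 : p0 ∈ Pp)
    (hη : 0 < η) (c1 : ContinuousOn W1 Pp) (c2 : ContinuousOn W2 Pp) (d1 : ContinuousOn G1 Pp)
    (d2 : ContinuousOn G2 Pp) (h1 : WeakRad m p0 η W1 G1) (h2 : WeakRad m p0 η W2 G2) :
    WeakRad m p0 η (fun p => W1 p - k * W2 p) (fun p => G1 p - k * G2 p) := by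
  intro χ χ1 χ2 hχ
  have e1 := h1 χ χ1 χ2 hχ
  have e2 := h2 χ χ1 χ2 hχ
  have i1 := integrable_rad h0 hη c1 (Lc_cont (m := m) hχ) (fun c hc => Lc_zero hχ hc)
  have i2 := integrable_rad h0 hη c2 (Lc_cont (m := m) hχ) (fun c hc => Lc_zero hχ hc)
  have i3 := integrable_rad h0 hη d1 hχ.c0 hχ.z0
  have i4 := integrable_rad h0 hη d2 hχ.c0 hχ.z0
  have a1 : ∀ (W1 W2 : ℝ × ℝ → ℝ) (b : ℝ × ℝ → ℝ) (p : ℝ × ℝ), (W1 p - k * W2 p) * b p / p.1 ^ 2 =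
      W1 p * b p / p.1 ^ 2 - k * (W2 p * b p / p.1 ^ 2) := by
    intro W1 W2 b p; ring
  rw [integral_congr_ae (Eventually.of_forall fun p => a1 W1 W2 (fun p => Lc m χ χ1 χ2 (cc p0 p)) p),
    integral_congr_ae (Eventually.of_forall fun p => a1 G1 G2 (fun p => χ (cc p0 p)) p),
    integral_sub i1 (i2.const_mul k), integral_sub i3 (i4.const_mul k), integral_const_mul,
    integral_const_mul, e1, e2]

lemma exists_Bc {p0 : ℝ × ℝ} (h0 : p0 ∈ Pp) {V : Set (ℝ × ℝ)} (hV : V ∈ 𝓝 p0) (m : ℝ) :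
    ∃ η : ℝ, 0 < η ∧ |m| * η < 1 ∧ Bc p0 η ⊆ V := by
  obtain ⟨r, hr, hrV⟩ := Metric.mem_nhds_iff.1 hV
  have h1 := Pp_pos h0
  have t1 : Tendsto (fun e : ℝ => p0.1 * √(4 * (1 + 1) * e)) (𝓝 0) (𝓝 0) := by
    have : Continuous fun e : ℝ => p0.1 * √(4 * (1 + 1) * e) := by fun_prop
    simpa using this.tendsto 0
  have t2 : Tendsto (fun e : ℝ => |m| * e) (𝓝 0) (𝓝 0) := by
    have : Continuous fun e : ℝ => |m| * e := by fun_prop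
    simpa using this.tendsto 0
  have ev := ((t1.eventually (gt_mem_nhds hr)).and ((t2.eventually (gt_mem_nhds one_pos)).and
    (gt_mem_nhds one_pos)))
  obtain ⟨e, ⟨e1, e2, e3⟩, e4⟩ := ((ev.filter_mono nhdsWithin_le_nhds).and
    (self_mem_nhdsWithin (a := (0 : ℝ)) (s := Ioi 0))).exists
  refine ⟨e, e4, e2, fun p hp => hrV ?_⟩
  have := Bc_ball h0 hp (le_of_lt e3) (le_of_lt e4)
  exact lt_of_le_of_lt this e1

lemma cc_near {p0 : ℝ × ℝ} (h0 : p0 ∈ Pp) {η : ℝ} (hη : 0 < η) :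
    ∀ᶠ p in 𝓝 p0, p ∈ Pp ∧ cc p0 p < 1 + η := by
  have h1 : cc p0 p0 < 1 + η := by rw [cc_self]; linarith
  have h2 : ∀ᶠ p in 𝓝 p0, p ∈ Pp := isOpen_Pp.mem_nhds h0
  exact h2.and ((cc_contAt h0 h0).eventually (gt_mem_nhds h1))

lemma visc {m : ℝ} {p0 : ℝ × ℝ} {W G : ℝ × ℝ → ℝ} (h0 : p0 ∈ Pp) (cW : ContinuousOn W Pp)
    (cG : ContinuousOn G Pp) (hw : ∀ η, 0 < η → WeakRad m p0 η W G) {V : Set (ℝ × ℝ)} (hV : V ∈ 𝓝 p0)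
    (hWV : ∀ p ∈ V, W p ≤ 0) (hGV : ∀ p ∈ V, 0 ≤ G p) (hW0 : W p0 = 0) :
    (∀ᶠ p in 𝓝 p0, W p = 0) ∧ G p0 = 0 := by
  obtain ⟨η, hη, hm, hB⟩ := exists_Bc h0 hV m
  have hz := key_max h0 hη hm cW (fun p hp => hWV p (hB hp)) hW0 (fun p hp => hGV p (hB hp)) (hw η hη)
  refine ⟨(cc_near h0 hη).mono fun p hp => hz p hp.1 hp.2, ?_⟩
  exact zero_rhs h0 hη cG hz (fun p hp => hGV p (hB hp)) (hw η hη)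

/-- Constant jet. -/
def J2.const (c : ℝ) : J2 := ⟨fun _ => c, fun _ => 0, fun _ => 0, fun _ => 0, fun _ => 0, fun _ => 0⟩

lemma J2.const_valid (c : ℝ) : (J2.const c).Valid := by
  refine ⟨fun p _ => ?_, fun p _ => ?_, fun p _ => ?_, continuousOn_const, continuousOn_const,
    continuousOn_const⟩
  all_goals
    refine (hasFDerivAt_const _ p).congr_fderiv ?_
    ext <;> simp [J2.const]

/-- Jet of `Qf`. -/
def J2.Q (l : ℝ) : J2 := ⟨Qf l, fun p => 2 * l * p.1, fun p => 2 * l * p.2 + 1, fun _ => 2 * l,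
  fun _ => 0, fun _ => 2 * l⟩

lemma J2.Q_valid (l : ℝ) : (J2.Q l).Valid := by
  refine ⟨fun p _ => ?_, fun p _ => ?_, fun p _ => ?_, continuousOn_const, continuousOn_const,
    continuousOn_const⟩
  · have h1 := (((hasFDerivAt_fst (𝕜 := ℝ) (p := p)).pow 2).add
      ((hasFDerivAt_snd (𝕜 := ℝ) (p := p)).pow 2)).const_mul l
    refine (h1.add (hasFDerivAt_snd (𝕜 := ℝ) (p := p))).congr_fderiv ?_
    ext <;> simp [J2.Q] <;> ring
  · refine ((hasFDerivAt_fst (𝕜 := ℝ) (p := p)).const_mul (2 * l)).congr_fderiv ?_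
    ext <;> simp [J2.Q]
  · refine (((hasFDerivAt_snd (𝕜 := ℝ) (p := p)).const_mul (2 * l)).add_const 1).congr_fderiv ?_
    ext <;> simp [J2.Q]

/-- The barrier. -/
def J2.Phi (l N B : ℝ) : J2 :=
  J2.comb 1 (-1) (J2.comb 1 (-1) (J2.comb 1 (-1) (J2.const (B + 2))
    (J2.comp Real.log (fun x => x⁻¹) (fun x => -(x ^ 2)⁻¹) J2.S)) (J2.spow (1 / 2)))
    (J2.comp (fun x => Real.exp (N * x)) (fun x => N * Real.exp (N * x))
      (fun x => N * (N * Real.exp (N * x))) (J2.Q l))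

lemma hasDerivAt_expN (N x : ℝ) : HasDerivAt (fun x => Real.exp (N * x)) (N * Real.exp (N * x)) x := by
  have h1 : HasDerivAt (fun x : ℝ => N * x) N x := by simpa using (hasDerivAt_id x).const_mul N
  have := h1.exp
  rwa [mul_comm] at this

lemma J2.Phi_valid (l N B : ℝ) : (J2.Phi l N B).Valid := by
  refine J2.Valid.comb _ _ (J2.Valid.comb _ _ (J2.Valid.comb _ _ (J2.const_valid _) ?_)
    (J2.spow_valid _)) ?_
  · refine J2.S_valid.comp (fun p hp => ?_) (fun p hp => ?_) (fun p hp => ?_)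
    · exact Real.hasDerivAt_log (Pp_pos hp).ne'
    · exact hasDerivAt_inv (Pp_pos hp).ne'
    · have h1 : J2.S.v p ^ 2 ≠ 0 := pow_ne_zero 2 (Pp_pos hp).ne'
      exact ((continuous_pow 2).continuousAt.inv₀ h1).neg
  · refine (J2.Q_valid l).comp (fun p _ => ?_) (fun p _ => ?_) (fun p _ => ?_)
    · exact hasDerivAt_expN _ _
    · exact (hasDerivAt_expN _ _).const_mul N
    · fun_prop

lemma Phi_v (l N B : ℝ) (p : ℝ × ℝ) : (J2.Phi l N B).v p =
    B + 2 - Real.log p.1 - p.1 ^ (1 / 2 : ℝ) - Real.exp (N * Qf l p) := by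
  simp [J2.Phi, J2.comb, J2.comp, J2.spow, J2.S, J2.Q, J2.const]
  ring

lemma Phi_L (hn : 1 ≤ n) {l N B : ℝ} (hl : 0 < l) (hN : 0 < N) {p : ℝ × ℝ} (hp : p ∈ Pp) :
    4 * (p.1 * ((J2.Phi l N B).ss p + (J2.Phi l N B).tt p) + n * (J2.Phi l N B).s p) ≤
      -(p.1 ^ (-1 / 2 : ℝ) + 4 * p.1 * N ^ 2 * df l p * Real.exp (N * Qf l p)) := by
  have hs := Pp_pos hp
  have hn' : (1 : ℝ) ≤ n := by exact_mod_cast hn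
  have q1 : p.1 ^ ((1 : ℝ) / 2 - 1) = p.1 ^ (-1 / 2 : ℝ) := by norm_num
  have q2 : p.1 ^ ((1 : ℝ) / 2 - 1 - 1) = p.1 ^ (-1 / 2 : ℝ) / p.1 := by rw [rpow_sub_one hs.ne', q1]
  have hdf : df l p = (2 * l * p.1) ^ 2 + (2 * l * p.2 + 1) ^ 2 := by
    rw [df_eq, Qf]; ring
  have e : 4 * (p.1 * ((J2.Phi l N B).ss p + (J2.Phi l N B).tt p) + n * (J2.Phi l N B).s p) =
      -(4 * (n - 1) / p.1 + (2 * n - 1) * p.1 ^ (-1 / 2 : ℝ) +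
        4 * Real.exp (N * Qf l p) * (p.1 * N ^ 2 * df l p + N * (4 * l + 2 * n * l) * p.1)) := by
    rw [hdf]
    simp only [J2.Phi, J2.comb, J2.comp, J2.spow, J2.S, J2.Q, J2.const, q1, q2]
    field_simp
    ring
  rw [e]
  have hE := Real.exp_pos (N * Qf l p)
  have hr : 0 < p.1 ^ (-1 / 2 : ℝ) := by positivity
  have a1 : 0 ≤ 4 * ((n : ℝ) - 1) / p.1 := div_nonneg (by linarith) hs.le
  have a2 : p.1 ^ (-1 / 2 : ℝ) ≤ (2 * n - 1) * p.1 ^ (-1 / 2 : ℝ) := by nlinarith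
  have a3 : 0 ≤ 4 * Real.exp (N * Qf l p) * (N * (4 * l + 2 * n * l) * p.1) := by positivity
  nlinarith

lemma mul_lap (n : ℕ) {j : J2} {p : ℝ × ℝ} (hp : p ∈ Pp) :
    p.1 ^ 2 * (((J2.spow ((n : ℝ) / 2)).mul j).ss p + ((J2.spow ((n : ℝ) / 2)).mul j).tt p)
      - mn n * ((J2.spow ((n : ℝ) / 2)).mul j).v p =
    p.1 ^ ((n : ℝ) / 2) * p.1 / 4 * (4 * (p.1 * (j.ss p + j.tt p) + n * j.s p)) := by
  have hs := Pp_pos hp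
  set a := (n : ℝ) / 2 with ha
  have nn : (n : ℝ) = 2 * a := by rw [ha]; ring
  have q1 : p.1 ^ (a - 1) = p.1 ^ a / p.1 := by rw [rpow_sub_one hs.ne']
  have q2 : p.1 ^ (a - 1 - 1) = p.1 ^ a / p.1 / p.1 := by rw [rpow_sub_one hs.ne', q1]
  simp only [J2.mul, J2.spow, J2.comp, J2.S, q1, q2, mn, ← ha]
  rw [nn]
  field_simp
  ring

/-! ### The barrier lemma -/

/-- Lower bound of the operator on the barrier. -/
def Rf (l N : ℝ) (p : ℝ × ℝ) : ℝ :=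
  p.1 ^ (-1 / 2 : ℝ) + 4 * p.1 * N ^ 2 * df l p * Real.exp (N * Qf l p)

lemma Qf_cont (l : ℝ) : Continuous (Qf l) := by unfold Qf; fun_prop

lemma Rf_cont (l N : ℝ) : ContinuousOn (Rf l N) Pp := by
  have h1 := Qf_cont l
  have h2 : Continuous (df l) := by
    have : df l = fun p => 1 + 4 * l * Qf l p := by ext p; exact df_eq l p
    rw [this]; fun_prop
  unfold Rf
  refine ContinuousOn.add ?_ (by fun_prop)
  exact ContinuousOn.rpow_const (by fun_prop) fun p hp => Or.inl (Pp_pos hp).ne'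

lemma Dl_sub (l : ℝ) : Dl l ⊆ Pp := fun _ h => h.1

lemma barrier_step (hn : 1 ≤ n) {l N B C k : ℝ} (hl : 0 < l) (hN : 0 < N) (hC : 0 ≤ C) (hk : 0 < k)
    {W Z G : ℝ × ℝ → ℝ} (cW : ContinuousOn W Pp) (cG : ContinuousOn G Pp) {q : ℝ × ℝ} (hq : q ∈ Dl l)
    (hw : ∀ η, 0 < η → WeakRad (mn n) q η W G)
    (hG : ∀ p ∈ Dl l, -(1 / 4) * C * p.1 * max (Z p) 0 ≤ G p)
    (hPhi : ∀ p ∈ Dl l, 0 ≤ (J2.Phi l N B).v p)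
    (hW : ∀ p ∈ Dl l, W p ≤ k * (p.1 ^ ((n : ℝ) / 2) * (J2.Phi l N B).v p))
    (hZ : ∀ p ∈ Dl l, Z p ≤ k * (p.1 ^ ((n : ℝ) / 2) * (J2.Phi l N B).v p))
    (hWq : W q = k * (q.1 ^ ((n : ℝ) / 2) * (J2.Phi l N B).v q))
    (good : C * (J2.Phi l N B).v q < Rf l N q) : False := by
  have hPv := J2.Phi_valid l N B
  set j := J2.Phi l N B with hj
  have hjv : ((J2.spow ((n : ℝ) / 2)).mul j).Valid := (J2.spow_valid _).mul hPv
  set Ps := (J2.spow ((n : ℝ) / 2)).mul j with hPs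
  have hqP := Dl_sub l hq
  have ev : ∀ p, Ps.v p = p.1 ^ ((n : ℝ) / 2) * j.v p := fun p => rfl
  have cGP : ContinuousOn (fun p => p.1 ^ 2 * (Ps.ss p + Ps.tt p) - mn n * Ps.v p) Pp := by
    have := hjv.cv; have := hjv.css; have := hjv.ctt
    fun_prop
  set GP := fun p : ℝ × ℝ => p.1 ^ 2 * (Ps.ss p + Ps.tt p) - mn n * Ps.v p with hGP
  have low : ∀ p ∈ Dl l,
      1 / 4 * k * (p.1 ^ ((n : ℝ) / 2) * p.1) * (Rf l N p - C * j.v p) ≤ G p - k * GP p := by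
    intro p hp
    have hs := Pp_pos (Dl_sub l hp)
    have h1 : GP p = p.1 ^ ((n : ℝ) / 2) * p.1 / 4 * (4 * (p.1 * (j.ss p + j.tt p) + n * j.s p)) :=
      mul_lap n (Dl_sub l hp)
    have h2 : 4 * (p.1 * (j.ss p + j.tt p) + n * j.s p) ≤ - Rf l N p :=
      Phi_L hn hl hN (Dl_sub l hp)
    have ha : 0 < p.1 ^ ((n : ℝ) / 2) := by positivity
    have h3 : GP p ≤ p.1 ^ ((n : ℝ) / 2) * p.1 / 4 * (- Rf l N p) := by
      rw [h1]; exact mul_le_mul_of_nonneg_left h2 (by positivity)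
    have h4 : max (Z p) 0 ≤ k * (p.1 ^ ((n : ℝ) / 2) * j.v p) :=
      max_le (hZ p hp) (by have := hPhi p hp; positivity)
    have h5 : C * p.1 * max (Z p) 0 ≤ C * p.1 * (k * (p.1 ^ ((n : ℝ) / 2) * j.v p)) :=
      mul_le_mul_of_nonneg_left h4 (by positivity)
    have h6 := hG p hp
    have h7 := mul_le_mul_of_nonneg_left h3 hk.le
    nlinarith
  have cgood : ContinuousOn (fun p => Rf l N p - C * j.v p) Pp :=
    (Rf_cont l N).sub (continuousOn_const.mul hPv.cv)
  have evg : ∀ᶠ p in 𝓝 q, 0 < Rf l N p - C * j.v p :=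
    (cgood.continuousAt (isOpen_Pp.mem_nhds hqP)).eventually (lt_mem_nhds (by linarith))
  have evD : ∀ᶠ p in 𝓝 q, p ∈ Dl l := (isOpen_Dl l).mem_nhds hq
  have hvisc := visc (m := mn n) (p0 := q) (W := fun p => W p - k * Ps.v p) (G := fun p => G p - k * GP p)
    hqP (cW.sub (continuousOn_const.mul hjv.cv)) (cG.sub (continuousOn_const.mul cGP))
    (fun η hη => WeakRad.sub_mul hqP hη cW hjv.cv cG cGP (hw η hη) (WeakRad_of_jet hjv hqP hη _))
    (V := {p | p ∈ Dl l ∧ 0 < Rf l N p - C * j.v p}) (evD.and evg)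
    (fun p hp => by
      have := hW p hp.1
      rw [ev]; linarith)
    (fun p hp => by
      refine le_trans ?_ (low p hp.1)
      have hs := Pp_pos (Dl_sub l hp.1)
      have := hp.2
      positivity)
    (by simp only [ev, hWq]; ring)
  have h1 := low q hq
  rw [hvisc.2] at h1
  have hs := Pp_pos hqP
  have : 0 < 1 / 4 * k * (q.1 ^ ((n : ℝ) / 2) * q.1) * (Rf l N q - C * j.v q) := by
    have : 0 < Rf l N q - C * j.v q := by linarith
    positivity
  linarith

lemma Phi_low {l N S0 : ℝ} (hl : 0 < l) (hN : 0 < N) (hS : 1 / l ≤ S0) {p : ℝ × ℝ} (hp : p ∈ Pp)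
    (hQ : Qf l p ≤ 0) :
    1 + (Real.log S0 - Real.log p.1) ≤ (J2.Phi l N (Real.log S0 + S0 ^ (1 / 2 : ℝ))).v p ∧
      Real.log p.1 ≤ Real.log S0 := by
  have hs := Pp_pos hp
  have h1 : p.1 ≤ S0 := (Dl_bound hl hs.le hQ).1.trans hS
  have h2 : p.1 ^ (1 / 2 : ℝ) ≤ S0 ^ (1 / 2 : ℝ) := Real.rpow_le_rpow hs.le h1 (by norm_num)
  have h3 : Real.exp (N * Qf l p) ≤ 1 := Real.exp_le_one_iff.2 (mul_nonpos_of_nonneg_of_nonpos hN.le hQ)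
  refine ⟨?_, Real.log_le_log hs h1⟩
  rw [Phi_v]
  linarith

lemma barrier_core (hn : 1 ≤ n) {l N S0 C M : ℝ} (hl : 0 < l) (hN : 0 < N) (hC : 0 ≤ C)
    (hS : 1 / l ≤ S0)
    {W Z GW GZ : ℝ × ℝ → ℝ} (cW : ContinuousOn W Pp) (cZ : ContinuousOn Z Pp)
    (cGW : ContinuousOn GW Pp) (cGZ : ContinuousOn GZ Pp) {K : Set (ℝ × ℝ)}
    (hw : ∀ p ∈ Pp, ∀ η, 0 < η → WeakRad (mn n) p η W GW)
    (hz : ∀ p ∈ Pp, ∀ η, 0 < η → WeakRad (mn n) p η Z GZ)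
    (hGW : ∀ p ∈ Dl l, -(1 / 4) * C * p.1 * max (Z p) 0 ≤ GW p)
    (hGZ : ∀ p ∈ Dl l, -(1 / 4) * C * p.1 * max (W p) 0 ≤ GZ p)
    (bW : ∀ p ∈ Pp, Qf l p = 0 → W p = 0) (bZ : ∀ p ∈ Pp, Qf l p = 0 → Z p = 0)
    (gW : ∀ p ∈ Dl l, W p ≤ M * p.1 ^ ((n : ℝ) / 2)) (gZ : ∀ p ∈ Dl l, Z p ≤ M * p.1 ^ ((n : ℝ) / 2))
    (hK : ∀ p ∈ Dl l, p ∈ K → W p ≤ 0 ∧ Z p ≤ 0)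
    (good : ∀ p ∈ Dl l, p ∉ K →
      C * (J2.Phi l N (Real.log S0 + S0 ^ (1 / 2 : ℝ))).v p < Rf l N p) :
    ∀ p ∈ Dl l, W p ≤ 0 ∧ Z p ≤ 0 := by
  have hPv := J2.Phi_valid l N (Real.log S0 + S0 ^ (1 / 2 : ℝ))
  have hlow : ∀ p ∈ Pp, Qf l p ≤ 0 → _ := fun p hp hQ => Phi_low (S0 := S0) hl hN hS hp hQ
  set B := Real.log S0 + S0 ^ (1 / 2 : ℝ) with hB
  set j := J2.Phi l N B with hj
  set m : ℝ × ℝ → ℝ := fun p => max (W p) (Z p) with hm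
  have cm : ContinuousOn m Pp := cW.sup cZ
  have pos : ∀ p ∈ Pp, Qf l p ≤ 0 → 0 < p.1 ^ ((n : ℝ) / 2) * j.v p := by
    intro p hp hQ
    have h1 := hlow p hp hQ
    have hs := Pp_pos hp
    have : 0 < j.v p := by linarith [h1.1, h1.2]
    positivity
  set r : ℝ × ℝ → ℝ := fun p => m p / (p.1 ^ ((n : ℝ) / 2) * j.v p) with hr
  suffices hm0 : ∀ p ∈ Dl l, m p ≤ 0 by
    intro p hp
    exact ⟨(le_max_left _ _).trans (hm0 p hp), (le_max_right _ _).trans (hm0 p hp)⟩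
  by_contra hcon
  push Not at hcon
  obtain ⟨p1, hp1, hmp⟩ := hcon
  have hp1P := Dl_sub l hp1
  set e := r p1 with he
  have hepos : 0 < e := div_pos hmp (pos p1 hp1P hp1.2.le)
  set δ := Real.exp (1 + Real.log S0 - M / e) with hδ
  have small : ∀ p ∈ Dl l, p.1 < δ → r p < e := by
    intro p hp hps
    have hs := Pp_pos (Dl_sub l hp)
    have h1 := hlow p (Dl_sub l hp) hp.2.le
    have h2 : Real.log p.1 < 1 + Real.log S0 - M / e := by
      rw [hδ] at hps
      exact (Real.log_lt_iff_lt_exp hs).2 hps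
    have h3 : M / e < j.v p := by linarith [h1.1]
    rw [div_lt_iff₀ hepos] at h3
    have h4 : m p ≤ M * p.1 ^ ((n : ℝ) / 2) := max_le (gW p hp) (gZ p hp)
    have ha : 0 < p.1 ^ ((n : ℝ) / 2) := by positivity
    rw [hr]
    simp only
    rw [div_lt_iff₀ (pos p (Dl_sub l hp) hp.2.le)]
    nlinarith
  set T : Set (ℝ × ℝ) := {p | δ ≤ p.1 ∧ Qf l p ≤ 0} with hT
  have hδ0 : 0 < δ := Real.exp_pos _
  have hTP : T ⊆ Pp := fun p hp => hδ0.trans_le hp.1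
  have hTc : IsCompact T := by
    refine Metric.isCompact_of_isClosed_isBounded ?_ ?_
    · exact (isClosed_le continuous_const continuous_fst).inter
        (isClosed_le (Qf_cont l) continuous_const)
    · refine (Metric.isBounded_closedBall (x := (0 : ℝ × ℝ)) (r := 1 / l)).subset fun p hp => ?_
      have hs := Pp_pos (hTP hp)
      have h1 := Dl_bound hl hs.le hp.2
      have h2 : 0 < 1 / l := by positivity
      rw [mem_closedBall_zero_iff]
      refine max_le ?_ ?_
      · rw [Real.norm_eq_abs, abs_le]; constructor <;> linarith [h1.1]
      · rw [Real.norm_eq_abs, abs_le]; constructor <;> linarith [h1.2.1, h1.2.2]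
  have cr : ContinuousOn r T := by
    refine ContinuousOn.div (cm.mono hTP) (ContinuousOn.mul ?_ (hPv.cv.mono hTP)) ?_
    · exact ContinuousOn.rpow_const (by fun_prop) fun p hp => Or.inl (Pp_pos (hTP hp)).ne'
    · exact fun p hp => (pos p (hTP hp) hp.2).ne'
  have hp1T : p1 ∈ T := by
    refine ⟨?_, hp1.2.le⟩
    by_contra hc
    exact lt_irrefl _ (small p1 hp1 (not_le.1 hc))
  obtain ⟨q, hqT, hqmax⟩ := hTc.exists_isMaxOn ⟨p1, hp1T⟩ cr
  have hqP := hTP hqT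
  have hk : e ≤ r q := hqmax hp1T
  set k := r q with hkdef
  have hkpos : 0 < k := hepos.trans_le hk
  have hmq : m q = k * (q.1 ^ ((n : ℝ) / 2) * j.v q) := by
    rw [hkdef, hr]
    simp only
    rw [div_mul_cancel₀ _ (pos q hqP hqT.2).ne']
  have hmqpos : 0 < m q := by rw [hmq]; exact mul_pos hkpos (pos q hqP hqT.2)
  have hqD : q ∈ Dl l := by
    refine ⟨hqP, lt_of_le_of_ne hqT.2 fun h0 => ?_⟩
    have : m q = 0 := by simp only [hm]; rw [bW q hqP h0, bZ q hqP h0, max_self]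
    linarith
  have hqK : q ∉ K := by
    intro h
    have := hK q hqD h
    have : m q ≤ 0 := max_le this.1 this.2
    linarith
  have hall : ∀ p ∈ Dl l, m p ≤ k * (p.1 ^ ((n : ℝ) / 2) * j.v p) := by
    intro p hp
    rw [← div_le_iff₀ (pos p (Dl_sub l hp) hp.2.le)]
    by_cases h : p.1 < δ
    · exact ((small p hp h).le).trans hk
    · exact hqmax ⟨not_lt.1 h, hp.2.le⟩
  have hPhi0 : ∀ p ∈ Dl l, 0 ≤ j.v p := fun p hp => by
    have h1 := hlow p (Dl_sub l hp) hp.2.le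
    linarith [h1.1, h1.2]
  have hWl : ∀ p ∈ Dl l, W p ≤ k * (p.1 ^ ((n : ℝ) / 2) * j.v p) := fun p hp =>
    (le_max_left _ _).trans (hall p hp)
  have hZl : ∀ p ∈ Dl l, Z p ≤ k * (p.1 ^ ((n : ℝ) / 2) * j.v p) := fun p hp =>
    (le_max_right _ _).trans (hall p hp)
  rcases le_total (Z q) (W q) with h | h
  · have e1 : W q = k * (q.1 ^ ((n : ℝ) / 2) * j.v q) := by rw [← hmq, hm]; exact (max_eq_left h).symm
    exact barrier_step hn hl hN hC hkpos cW cGW hqD (hw q hqP) hGW hPhi0 hWl hZl e1 (good q hqD hqK)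
  · have e1 : Z q = k * (q.1 ^ ((n : ℝ) / 2) * j.v q) := by rw [← hmq, hm]; exact (max_eq_right h).symm
    exact barrier_step hn hl hN hC hkpos cZ cGZ hqD (hz q hqP) hGZ hPhi0 hZl hWl e1 (good q hqD hqK)

/-! ### The nonlinearity -/

/-- Structural hypotheses on the nonlinearity. -/
structure NL (n : ℕ) (f : ℝ → ℝ) : Prop where
  cont : ContinuousOn f (Set.Ici 0)
  mono : ∀ s t : ℝ, 0 < s → s ≤ t → f s ≤ f t
  anti : ∀ s t : ℝ, 0 < s → s ≤ t → f t / t ^ tau n ≤ f s / s ^ tau n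

lemma tau_gt (hn : 1 ≤ n) : 1 < tau n := by
  have : (1 : ℝ) ≤ n := by exact_mod_cast hn
  unfold tau
  rw [lt_div_iff₀ (by linarith)]; linarith

lemma tau_mul (hn : 1 ≤ n) : (n : ℝ) / 2 * tau n = (n : ℝ) / 2 + 1 := by
  have : (1 : ℝ) ≤ n := by exact_mod_cast hn
  unfold tau
  field_simp
  ring

lemma NL.nonneg (hn : 1 ≤ n) {f : ℝ → ℝ} (hf : NL n f) {s : ℝ} (hs : 0 < s) : 0 ≤ f s := by
  by_contra hneg
  push Not at hneg
  have ht := tau_gt hn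
  have h1 := hf.mono (s / 2) s (by linarith) (by linarith)
  have h2 := hf.anti (s / 2) s (by linarith) (by linarith)
  have p1 : 0 < s ^ tau n := rpow_pos_of_pos hs _
  have p2 : 0 < (s / 2) ^ tau n := rpow_pos_of_pos (by linarith) _
  have p3 : (s / 2) ^ tau n < s ^ tau n := rpow_lt_rpow (by linarith) (by linarith) (by linarith)
  rw [div_le_div_iff₀ p1 p2] at h2
  nlinarith

lemma NL.scale (hn : 1 ≤ n) (f : ℝ → ℝ) {s v : ℝ} (hs : 0 < s) (hv : 0 < v) :
    s ^ ((n : ℝ) / 2 + 1) * f v = (f v / v ^ tau n) * (s ^ ((n : ℝ) / 2) * v) ^ tau n := by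
  have p1 : 0 < v ^ tau n := rpow_pos_of_pos hv _
  rw [mul_rpow (by positivity) hv.le, ← rpow_mul hs.le, tau_mul hn]
  field_simp

lemma NL.le (hn : 1 ≤ n) {f : ℝ → ℝ} (hf : NL n f) {s s' v v' : ℝ} (hs : 0 < s) (hss : s < s')
    (hv : 0 < v) (hv' : 0 < v') (hab : s ^ ((n : ℝ) / 2) * v ≤ s' ^ ((n : ℝ) / 2) * v') :
    s ^ ((n : ℝ) / 2 + 1) * f v ≤ s' ^ ((n : ℝ) / 2 + 1) * f v' := by
  have ht := tau_gt hn
  have hs' : 0 < s' := hs.trans hss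
  rcases le_total v v' with h | h
  · have h1 := hf.mono v v' hv h
    have h0 := hf.nonneg hn hv
    have : s ^ ((n : ℝ) / 2 + 1) ≤ s' ^ ((n : ℝ) / 2 + 1) :=
      rpow_le_rpow hs.le hss.le (by positivity)
    gcongr
  · rw [NL.scale hn f hs hv, NL.scale hn f hs' hv']
    have h1 := hf.anti v' v hv' h
    have h0 : 0 ≤ f v' / v' ^ tau n := div_nonneg (hf.nonneg hn hv') (by positivity)
    have : (s ^ ((n : ℝ) / 2) * v) ^ tau n ≤ (s' ^ ((n : ℝ) / 2) * v') ^ tau n :=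
      rpow_le_rpow (by positivity) hab (by linarith)
    gcongr

lemma NL.eq (hn : 1 ≤ n) {f : ℝ → ℝ} (hf : NL n f) {s s' v v' : ℝ} (hs : 0 < s) (hss : s < s')
    (hv : 0 < v) (hv' : 0 < v') (hab : s ^ ((n : ℝ) / 2) * v < s' ^ ((n : ℝ) / 2) * v')
    (he : s ^ ((n : ℝ) / 2 + 1) * f v = s' ^ ((n : ℝ) / 2 + 1) * f v') : ∀ t, 0 < t → f t = 0 := by
  have ht := tau_gt hn
  have hs' : 0 < s' := hs.trans hss
  have h0 := hf.nonneg hn hv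
  have h0' := hf.nonneg hn hv'
  have key : ∃ w, 0 < w ∧ f w = 0 := by
    rcases le_total v v' with h | h
    · refine ⟨v, hv, ?_⟩
      have h1 := hf.mono v v' hv h
      have h2 : s ^ ((n : ℝ) / 2 + 1) < s' ^ ((n : ℝ) / 2 + 1) :=
        rpow_lt_rpow hs.le hss (by positivity)
      have h3 : 0 < s ^ ((n : ℝ) / 2 + 1) := by positivity
      nlinarith
    · refine ⟨v', hv', ?_⟩
      rw [NL.scale hn f hs hv, NL.scale hn f hs' hv'] at he
      have h1 := hf.anti v' v hv' h
      have h2 : (s ^ ((n : ℝ) / 2) * v) ^ tau n < (s' ^ ((n : ℝ) / 2) * v') ^ tau n :=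
        rpow_lt_rpow (by positivity) hab (by linarith)
      have h3 : 0 < (s ^ ((n : ℝ) / 2) * v) ^ tau n := by positivity
      have h4 : 0 ≤ f v' / v' ^ tau n := div_nonneg h0' (by positivity)
      have h5 : f v' / v' ^ tau n = 0 := by nlinarith
      have p1 : 0 < v' ^ tau n := rpow_pos_of_pos hv' _
      rcases div_eq_zero_iff.1 h5 with h | h
      · exact h
      · exact absurd h p1.ne'
  obtain ⟨w, hw, hfw⟩ := key
  intro t htp
  have h6 := hf.nonneg hn htp
  rcases le_total t w with h | h
  · have := hf.mono t w htp h; linarith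
  · have h7 := hf.anti w t hw h
    rw [hfw, zero_div] at h7
    have p1 : 0 < t ^ tau n := rpow_pos_of_pos htp _
    have h8 : 0 ≤ f t / t ^ tau n := div_nonneg h6 p1.le
    rcases div_eq_zero_iff.1 (le_antisymm h7 h8) with h | h
    · exact h
    · exact absurd h p1.ne'

lemma rpow_bern {a b t : ℝ} (ha : 0 < a) (hb : 0 ≤ b) (ht : 1 ≤ t) :
    a ^ t - b ^ t ≤ t * a ^ t / a * (a - b) := by
  have h := one_add_mul_self_le_rpow_one_add (s := b / a - 1) (by
    have : 0 ≤ b / a := by positivity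
    linarith) ht
  have e : (1 + (b / a - 1)) ^ t = b ^ t / a ^ t := by
    rw [show 1 + (b / a - 1) = b / a by ring, div_rpow hb ha.le]
  rw [e, le_div_iff₀ (by positivity)] at h
  have : t * a ^ t / a * (a - b) = - (t * (b / a - 1)) * a ^ t := by field_simp; ring
  rw [this]; nlinarith

lemma NL.lip (hn : 1 ≤ n) {f : ℝ → ℝ} (hf : NL n f) {s s' v v' : ℝ} (hs : 0 < s) (hss : s < s')
    (hv : 0 < v) (hv' : 0 < v') :
    s ^ ((n : ℝ) / 2 + 1) * f v - s' ^ ((n : ℝ) / 2 + 1) * f v' ≤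
      tau n * (f v / v) * s * max (s ^ ((n : ℝ) / 2) * v - s' ^ ((n : ℝ) / 2) * v') 0 := by
  have ht := tau_gt hn
  have hs' : 0 < s' := hs.trans hss
  have h0 := hf.nonneg hn hv
  have h0' := hf.nonneg hn hv'
  rcases le_total (s ^ ((n : ℝ) / 2) * v) (s' ^ ((n : ℝ) / 2) * v') with hab | hab
  · rw [max_eq_right (by linarith), mul_zero]
    linarith [hf.le hn hs hss hv hv' hab]
  · rw [max_eq_left (by linarith)]
    have hvv : v' ≤ v := by
      by_contra hc
      push Not at hc
      have : s ^ ((n : ℝ) / 2) ≤ s' ^ ((n : ℝ) / 2) := rpow_le_rpow hs.le hss.le (by positivity)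
      have p : 0 < s ^ ((n : ℝ) / 2) := by positivity
      nlinarith
    have h1 := hf.anti v' v hv' hvv
    have hb := rpow_bern (a := s ^ ((n : ℝ) / 2) * v) (b := s' ^ ((n : ℝ) / 2) * v') (t := tau n)
      (by positivity) (by positivity) ht.le
    have hh : 0 ≤ f v / v ^ tau n := by positivity
    have e2 : tau n * (f v / v) * s = (f v / v ^ tau n) *
        (tau n * (s ^ ((n : ℝ) / 2) * v) ^ tau n / (s ^ ((n : ℝ) / 2) * v)) := by
      have e3 := NL.scale hn f hs hv
      have p1 : s ^ ((n : ℝ) / 2 + 1) = s ^ ((n : ℝ) / 2) * s := by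
        rw [rpow_add hs, rpow_one]
      have p2 : 0 < s ^ ((n : ℝ) / 2) := by positivity
      calc tau n * (f v / v) * s = tau n * (s ^ ((n : ℝ) / 2 + 1) * f v) / (s ^ ((n : ℝ) / 2) * v) := by
            rw [p1]; field_simp
        _ = _ := by rw [e3]; ring
    rw [e2, NL.scale hn f hs hv, NL.scale hn f hs' hv', mul_assoc]
    calc _ ≤ (f v / v ^ tau n) * (s ^ ((n : ℝ) / 2) * v) ^ tau n -
          (f v / v ^ tau n) * (s' ^ ((n : ℝ) / 2) * v') ^ tau n := by
            gcongr
      _ = (f v / v ^ tau n) * ((s ^ ((n : ℝ) / 2) * v) ^ tau n - (s' ^ ((n : ℝ) / 2) * v') ^ tau n) := by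
            ring
      _ ≤ _ := by gcongr

/-! ### Choice of constants -/

lemma exists_sigma (C B : ℝ) : ∃ σ : ℝ, 0 < σ ∧ ∀ s, 0 < s → s < σ →
    C * (B + 2 - log s) < s ^ (-1 / 2 : ℝ) := by
  have t1 : Tendsto (fun x : ℝ => log x * x ^ (1 / 2 : ℝ)) (𝓝[>] 0) (𝓝 0) :=
    tendsto_log_mul_rpow_nhdsGT_zero (by norm_num)
  have t2 : Tendsto (fun x : ℝ => x ^ (1 / 2 : ℝ)) (𝓝[>] 0) (𝓝 0) := by
    have : ContinuousAt (fun x : ℝ => x ^ (1 / 2 : ℝ)) 0 :=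
      continuousAt_rpow_const _ _ (Or.inr (by norm_num))
    have h := this.tendsto
    rw [zero_rpow (by norm_num)] at h
    exact h.mono_left nhdsWithin_le_nhds
  have t3 : Tendsto (fun x : ℝ => C * ((B + 2) * x ^ (1 / 2 : ℝ) - log x * x ^ (1 / 2 : ℝ)))
      (𝓝[>] 0) (𝓝 0) := by
    have := ((t2.const_mul (B + 2)).sub t1).const_mul C
    simpa using this
  have h := t3.eventually (gt_mem_nhds (show (0 : ℝ) < 1 by norm_num))
  obtain ⟨σ, hσ, hs⟩ := (mem_nhdsGT_iff_exists_Ioo_subset).1 h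
  refine ⟨σ, hσ, fun s h0 h1 => ?_⟩
  have h2 : C * ((B + 2) * s ^ (1 / 2 : ℝ) - log s * s ^ (1 / 2 : ℝ)) < 1 := hs ⟨h0, h1⟩
  have e : s ^ (-1 / 2 : ℝ) = (s ^ (1 / 2 : ℝ))⁻¹ := by
    rw [← rpow_neg h0.le]; norm_num
  have p : 0 < s ^ (1 / 2 : ℝ) := by positivity
  rw [e, ← one_div, lt_div_iff₀ p]
  linarith

lemma consts {lo hi C : ℝ} (hlo : 0 < lo) (hC : 0 ≤ C) : ∃ N σ : ℝ, 0 < N ∧ 0 < σ ∧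
    ∀ l, lo ≤ l → l ≤ hi → ∀ p ∈ Dl l, ¬ (σ ≤ p.1 ∧ Qf l p ≤ -(1 / N)) →
      C * (J2.Phi l N (log (1 / lo) + (1 / lo) ^ (1 / 2 : ℝ))).v p < Rf l N p := by
  set B := log (1 / lo) + (1 / lo) ^ (1 / 2 : ℝ)
  obtain ⟨σ, hσ, hs⟩ := exists_sigma C B
  set N := max 1 (max (8 * hi) (2 * (C * (B + 2 - log σ)) / σ + 1)) with hN
  have n1 : 1 ≤ N := le_max_left _ _
  have n2 : 8 * hi ≤ N := (le_max_left _ _).trans (le_max_right _ _)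
  have n3 : 2 * (C * (B + 2 - log σ)) / σ + 1 ≤ N := (le_max_right _ _).trans (le_max_right _ _)
  have n0 : 0 < N := by linarith
  refine ⟨N, σ, n0, hσ, fun l l1 l2 p hp hb => ?_⟩
  have hp1 : 0 < p.1 := hp.1
  have hl : 0 < l := hlo.trans_le l1
  have hd : 0 < df l p := df_pos (l := l) hp.1
  rw [Phi_v]
  have i1 : C * (B + 2 - log p.1 - p.1 ^ (1 / 2 : ℝ) - exp (N * Qf l p)) ≤ C * (B + 2 - log p.1) := by
    have : 0 < p.1 ^ (1 / 2 : ℝ) := by positivity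
    have := exp_pos (N * Qf l p)
    exact mul_le_mul_of_nonneg_left (by linarith) hC
  refine i1.trans_lt ?_
  unfold Rf
  have q1 : 0 < p.1 ^ (-1 / 2 : ℝ) := by positivity
  have q2 : 0 < 4 * p.1 * N ^ 2 * df l p * exp (N * Qf l p) := by positivity
  by_cases hc : p.1 < σ
  · linarith [hs p.1 hp1 hc]
  · push Not at hc
    have hQ : -(1 / N) < Qf l p := by
      by_contra h
      exact hb ⟨hc, not_lt.1 h⟩
    have hNQ : -1 < N * Qf l p := by
      have := mul_lt_mul_of_pos_left hQ n0
      have e : N * -(1 / N) = -1 := by field_simp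
      linarith
    have hd2 : 1 / 2 ≤ df l p := by
      rw [df_eq]
      have hq : Qf l p < 0 := hp.2
      nlinarith
    have he : 1 / 4 ≤ exp (N * Qf l p) := by
      have h1 : exp (-1) ≤ exp (N * Qf l p) := exp_le_exp.2 hNQ.le
      have h2 : (1 : ℝ) / 4 ≤ exp (-1) := by
        have := exp_neg_one_gt_d9
        linarith
      linarith
    have hlog : C * (B + 2 - log p.1) ≤ C * (B + 2 - log σ) := by
      have := log_le_log hσ hc
      gcongr
    have h5 : C * (B + 2 - log σ) < σ * N / 2 := by
      have : 2 * (C * (B + 2 - log σ)) / σ < N := by linarith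
      rw [div_lt_iff₀ hσ] at this
      linarith
    have h6 : σ * N / 2 ≤ σ * N ^ 2 / 2 := by nlinarith [mul_pos hσ n0]
    have h7 : σ * N ^ 2 / 2 ≤ 4 * p.1 * N ^ 2 * df l p * exp (N * Qf l p) := by
      calc σ * N ^ 2 / 2 = 4 * σ * N ^ 2 * (1 / 2) * (1 / 4) := by ring
        _ ≤ _ := by gcongr
    linarith

/-! ### The reflected differences -/

/-- One equation of the system, with all hypotheses. -/
structure Sol (u v : H n → ℝ) (f : ℝ → ℝ) : Prop where
  cu : Continuous u
  cv : Continuous v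
  pu : ∀ ξ, 0 < u ξ
  pv : ∀ ξ, 0 < v ξ
  yu : IsCylindrical u
  yv : IsCylindrical v
  sol : IsWeakSol univ u (fun ξ => f (v ξ))
  nl : NL n f

/-- Difference of the reduced function and its reflection. -/
def Wl (hn : 1 ≤ n) (u : H n → ℝ) (l : ℝ) (p : ℝ × ℝ) : ℝ := wr hn u p - wr hn u (sg l p)

/-- Reduced right-hand side. -/
def Ar (hn : 1 ≤ n) (f : ℝ → ℝ) (v : H n → ℝ) (p : ℝ × ℝ) : ℝ :=
  p.1 ^ ((n : ℝ) / 2 + 1) * f (v (pt hn p))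

/-- Reduced right-hand side of the difference. -/
def Gl (hn : 1 ≤ n) (f : ℝ → ℝ) (v : H n → ℝ) (l : ℝ) (p : ℝ × ℝ) : ℝ :=
  -(1 / 4) * Ar hn f v p - -(1 / 4) * Ar hn f v (sg l p)

lemma comp_sg_cont {W : ℝ × ℝ → ℝ} (h : ContinuousOn W Pp) (l : ℝ) :
    ContinuousOn (fun p => W (sg l p)) Pp :=
  h.comp (isIso_sg l).cont (isIso_sg l).maps

lemma Wl_cont (hn : 1 ≤ n) {u : H n → ℝ} (hu : Continuous u) (l : ℝ) :
    ContinuousOn (Wl hn u l) Pp :=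
  (wr_cont hn hu).sub (comp_sg_cont (wr_cont hn hu) l)

lemma Sol.cfv {u v : H n → ℝ} {f : ℝ → ℝ} (h : Sol u v f) : Continuous fun ξ => f (v ξ) :=
  h.nl.cont.comp_continuous h.cv fun ξ => (h.pv ξ).le

lemma Sol.cA (hn : 1 ≤ n) {u v : H n → ℝ} {f : ℝ → ℝ} (h : Sol u v f) :
    ContinuousOn (Ar hn f v) Pp := by
  unfold Ar
  refine ContinuousOn.mul ?_ (h.cfv.comp (pt_cont hn)).continuousOn
  exact ContinuousOn.rpow_const (by fun_prop) fun p hp => Or.inl (Pp_pos hp).ne'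

lemma Sol.cG (hn : 1 ≤ n) {u v : H n → ℝ} {f : ℝ → ℝ} (h : Sol u v f) (l : ℝ) :
    ContinuousOn (Gl hn f v l) Pp :=
  ((h.cA hn).const_mul _).sub ((comp_sg_cont (h.cA hn) l).const_mul _)

lemma Sol.weak (hn : 1 ≤ n) {u v : H n → ℝ} {f : ℝ → ℝ} (h : Sol u v f) (l : ℝ) :
    ∀ p ∈ Pp, ∀ η, 0 < η → WeakRad (mn n) p η (Wl hn u l) (Gl hn f v l) := by
  intro p hp η hη
  have hcyl : IsCylindrical fun ξ => f (v ξ) := by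
    intro ξ ξ' h1 h2
    simp only [h.yv ξ ξ' h1 h2]
  have w1 : ∀ q ∈ Pp, WeakRad (mn n) q η (wr hn u) (fun p => -(1 / 4) * Ar hn f v p) :=
    fun q hq => weakRad_sol hn h.cu h.yu h.cfv hcyl h.sol hq hη
  have w2 := WeakRad.iso (isIso_sg l) hp (w1 _ ((isIso_sg l).maps p hp))
  have c1 := wr_cont hn h.cu
  have c2 := (h.cA hn).const_mul (-(1 / 4))
  have w3 := WeakRad.sub_mul (k := 1) hp hη c1 (comp_sg_cont c1 l) c2 (comp_sg_cont c2 l) (w1 p hp) w2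
  simp only [one_mul] at w3
  exact w3

lemma sg_fst {l : ℝ} (hl : 0 < l) {p : ℝ × ℝ} (hp : p ∈ Dl l) : p.1 < (sg l p).1 := by
  have h1 : 0 < p.1 := hp.1
  have h2 : Qf l p < 0 := hp.2
  have hd : 0 < df l p := df_pos (l := l) h1
  have hd1 : df l p < 1 := by rw [df_eq]; nlinarith
  rw [sg_eq (Dl_sub l hp)]
  change p.1 < p.1 / df l p
  rw [lt_div_iff₀ hd]
  nlinarith

lemma Sol.Gl_lower (hn : 1 ≤ n) {u v : H n → ℝ} {f : ℝ → ℝ} (h : Sol u v f) {l : ℝ} (hl : 0 < l)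
    {p : ℝ × ℝ} (hp : p ∈ Dl l) :
    -(1 / 4) * (tau n * (f (v (pt hn p)) / v (pt hn p))) * p.1 * max (Wl hn v l p) 0 ≤
      Gl hn f v l p := by
  have := h.nl.lip hn hp.1 (sg_fst hl hp) (h.pv (pt hn p)) (h.pv (pt hn (sg l p)))
  simp only [Gl, Ar, Wl, wr]
  linarith

lemma Sol.Gl_nonneg (hn : 1 ≤ n) {u v : H n → ℝ} {f : ℝ → ℝ} (h : Sol u v f) {l : ℝ} (hl : 0 < l)
    {p : ℝ × ℝ} (hp : p ∈ Dl l) (hz : Wl hn v l p ≤ 0) : 0 ≤ Gl hn f v l p := by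
  have := h.Gl_lower hn hl hp
  rw [max_eq_right hz, mul_zero] at this
  exact this

lemma Sol.Gl_eq (hn : 1 ≤ n) {u v : H n → ℝ} {f : ℝ → ℝ} (h : Sol u v f) {l : ℝ} (hl : 0 < l)
    {p : ℝ × ℝ} (hp : p ∈ Dl l) (hz : Wl hn v l p < 0) (hG : Gl hn f v l p = 0) :
    ∀ t, 0 < t → f t = 0 := by
  refine h.nl.eq hn hp.1 (sg_fst hl hp) (h.pv (pt hn p)) (h.pv (pt hn (sg l p))) ?_ ?_
  · simp only [Wl, wr] at hz
    linarith
  · simp only [Gl, Ar] at hG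
    linarith

lemma Wl_bdry (hn : 1 ≤ n) (u : H n → ℝ) (l : ℝ) : ∀ p ∈ Pp, Qf l p = 0 → Wl hn u l p = 0 := by
  intro p hp h
  rw [Wl, sg_Q0 hp h, sub_self]

lemma Dl_box {lo l : ℝ} (hlo : 0 < lo) (h : lo ≤ l) {p : ℝ × ℝ} (hp : p ∈ Dl l) :
    p ∈ Icc (0 : ℝ) (1 / lo) ×ˢ Icc (-(1 / lo)) 0 := by
  have hp' := Dl_mono h hp
  obtain ⟨a, b, c⟩ := Dl_bound hlo hp'.1.le hp'.2.le
  exact ⟨⟨hp'.1.le, a⟩, ⟨b, c⟩⟩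

lemma box_bdd {F : ℝ × ℝ → ℝ} (hF : Continuous F) {lo : ℝ} (hlo : 0 < lo) :
    ∃ M : ℝ, 0 ≤ M ∧ ∀ l, lo ≤ l → ∀ p ∈ Dl l, F p ≤ M := by
  have hc : IsCompact (Icc (0 : ℝ) (1 / lo) ×ˢ Icc (-(1 / lo)) (0 : ℝ)) := isCompact_Icc.prod isCompact_Icc
  obtain ⟨M, hM⟩ := hc.bddAbove_image hF.continuousOn
  refine ⟨max M 0, le_max_right _ _, fun l hl p hp => (hM ⟨p, Dl_box hlo hl hp, rfl⟩).trans (le_max_left _ _)⟩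

lemma Sol.lipC (hn : 1 ≤ n) {u v : H n → ℝ} {f : ℝ → ℝ} (h : Sol u v f) {lo : ℝ} (hlo : 0 < lo) :
    ∃ C : ℝ, 0 ≤ C ∧ ∀ C', C ≤ C' → ∀ l, lo ≤ l → ∀ p ∈ Dl l,
      -(1 / 4) * C' * p.1 * max (Wl hn v l p) 0 ≤ Gl hn f v l p := by
  have hF : Continuous fun p => tau n * (f (v (pt hn p)) / v (pt hn p)) := by
    refine continuous_const.mul (Continuous.div (h.cfv.comp (pt_cont hn)) (h.cv.comp (pt_cont hn)) ?_)
    intro p; exact (h.pv _).ne'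
  obtain ⟨M, hM, hb⟩ := box_bdd hF hlo
  refine ⟨M, hM, fun C' hC' l hl p hp => ?_⟩
  refine le_trans ?_ (h.Gl_lower hn (hlo.trans_le hl) hp)
  have h1 : tau n * (f (v (pt hn p)) / v (pt hn p)) ≤ C' := (hb l hl p hp).trans hC'
  have h2 : 0 ≤ p.1 * max (Wl hn v l p) 0 := mul_nonneg (le_of_lt hp.1) (le_max_right _ _)
  nlinarith

lemma growth (hn : 1 ≤ n) {u : H n → ℝ} (cu : Continuous u) (pu : ∀ ξ, 0 < u ξ) {lo : ℝ} (hlo : 0 < lo) :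
    ∃ M : ℝ, ∀ M', M ≤ M' → ∀ l, lo ≤ l → ∀ p ∈ Dl l, Wl hn u l p ≤ M' * p.1 ^ ((n : ℝ) / 2) := by
  obtain ⟨M, hM, hb⟩ := box_bdd (cu.comp (pt_cont hn)) hlo
  refine ⟨M, fun M' hM' l hl p hp => ?_⟩
  have h1 : u (pt hn p) ≤ M' := (hb l hl p hp).trans hM'
  have h2 : 0 < p.1 := hp.1
  have h3 : 0 < (sg l p).1 := h2.trans (sg_fst (hlo.trans_le hl) hp)
  have h4 : 0 < wr hn u (sg l p) := mul_pos (rpow_pos_of_pos h3 _) (pu _)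
  have h5 : wr hn u p ≤ M' * p.1 ^ ((n : ℝ) / 2) := by
    rw [wr, mul_comm]
    gcongr
  unfold Wl
  linarith

/-- If the nonlinearity vanishes, the difference is nonpositive for every `l`. -/
lemma Sol.zero_case (hn : 1 ≤ n) {u v : H n → ℝ} {f : ℝ → ℝ} (h : Sol u v f)
    (hf : ∀ l, 0 < l → ∀ p ∈ Dl l, 0 ≤ Gl hn f v l p) {l : ℝ} (hl : 0 < l) : ∀ p ∈ Dl l, Wl hn u l p ≤ 0 := by
  obtain ⟨M, hM⟩ := growth hn h.cu h.pu hl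
  have b : ∀ p ∈ Dl l, -(1 / 4) * 0 * p.1 * max (Wl hn u l p) 0 ≤ Gl hn f v l p := by
    intro p hp
    have := hf l hl p hp
    simpa using this
  have := barrier_core hn (l := l) (N := 1) (S0 := 1 / l) (C := 0) (M := M) (K := ∅) hl one_pos le_rfl le_rfl
    (Wl_cont hn h.cu l) (Wl_cont hn h.cu l) (h.cG hn l) (h.cG hn l) (h.weak hn l) (h.weak hn l)
    b b (Wl_bdry hn u l) (Wl_bdry hn u l) (hM M le_rfl l le_rfl) (hM M le_rfl l le_rfl)
    (fun p _ hk => absurd hk (notMem_empty _)) ?_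
  · exact fun p hp => (this p hp).1
  · intro p hp _
    have h1 : 0 < p.1 := hp.1
    have hd : 0 < df l p := df_pos (l := l) h1
    rw [zero_mul]
    unfold Rf
    positivity

/-- The joint barrier statement for all `l` in a range. -/
lemma joint_barrier (hn : 1 ≤ n) {u v : H n → ℝ} {f g : ℝ → ℝ} (h : Sol u v f) (h' : Sol v u g)
    {lo hi : ℝ} (hlo : 0 < lo) : ∃ N σ : ℝ, 0 < N ∧ 0 < σ ∧ ∀ l, lo ≤ l → l ≤ hi →
      (∀ p ∈ Dl l, σ ≤ p.1 → Qf l p ≤ -(1 / N) → Wl hn u l p ≤ 0 ∧ Wl hn v l p ≤ 0) →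
      ∀ p ∈ Dl l, Wl hn u l p ≤ 0 ∧ Wl hn v l p ≤ 0 := by
  obtain ⟨C1, hC1, b1⟩ := h.lipC hn hlo
  obtain ⟨C2, hC2, b2⟩ := h'.lipC hn hlo
  obtain ⟨M1, m1⟩ := growth hn h.cu h.pu hlo
  obtain ⟨M2, m2⟩ := growth hn h.cv h.pv hlo
  obtain ⟨N, σ, hN, hσ, good⟩ := consts (hi := hi) (C := max C1 C2) hlo (hC1.trans (le_max_left _ _))
  refine ⟨N, σ, hN, hσ, fun l l1 l2 hK => ?_⟩
  have hl : 0 < l := hlo.trans_le l1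
  exact barrier_core hn (l := l) (N := N) (S0 := 1 / lo) (C := max C1 C2) (M := max M1 M2)
    (K := {p | σ ≤ p.1 ∧ Qf l p ≤ -(1 / N)}) hl hN (hC1.trans (le_max_left _ _))
    (one_div_le_one_div_of_le hlo l1)
    (Wl_cont hn h.cu l) (Wl_cont hn h.cv l) (h.cG hn l) (h'.cG hn l) (h.weak hn l) (h'.weak hn l)
    (b1 _ (le_max_left _ _) l l1) (b2 _ (le_max_right _ _) l l1)
    (Wl_bdry hn u l) (Wl_bdry hn v l) (m1 _ (le_max_left _ _) l l1) (m2 _ (le_max_right _ _) l l1)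
    (fun p hp hk => hK p hp hk.1 hk.2) (fun p hp hk => good l l1 l2 p hp hk)

/-! ### Translation between the inverted functions and the reduced ones -/

lemma gauge4 (ξ : H n) : gaugeH ξ ^ 4 = rsq ξ ^ 2 + ξ.2.2 ^ 2 := by
  have h : 0 ≤ rsq ξ ^ 2 + ξ.2.2 ^ 2 := by positivity
  unfold gaugeH
  rw [← rpow_natCast, ← rpow_mul h]
  norm_num

lemma gauge2n (ξ : H n) : gaugeH ξ ^ (2 * n) = (rsq ξ ^ 2 + ξ.2.2 ^ 2) ^ ((n : ℝ) / 2) := by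
  have h : 0 ≤ rsq ξ ^ 2 + ξ.2.2 ^ 2 := by positivity
  unfold gaugeH
  rw [← rpow_natCast, ← rpow_mul h]
  congr 1
  push_cast
  ring

lemma Rp_tilde {ξ : H n} (h : 0 < rsq ξ ^ 2 + ξ.2.2 ^ 2) : Rp (tilde ξ) = iv (Rp ξ) := by
  have e : rsq (tilde ξ) = rsq ξ / (rsq ξ ^ 2 + ξ.2.2 ^ 2) := by
    have e1 : rsq (tilde ξ) = ∑ i, (((ξ.1 i * ξ.2.2 + ξ.2.1 i * rsq ξ) / gaugeH ξ ^ 4) ^ 2 +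
      ((ξ.2.1 i * ξ.2.2 - ξ.1 i * rsq ξ) / gaugeH ξ ^ 4) ^ 2) := by
      rw [Finset.sum_add_distrib]; rfl
    have e2 : ∀ i, ((ξ.1 i * ξ.2.2 + ξ.2.1 i * rsq ξ) / gaugeH ξ ^ 4) ^ 2 +
      ((ξ.2.1 i * ξ.2.2 - ξ.1 i * rsq ξ) / gaugeH ξ ^ 4) ^ 2 =
        (ξ.1 i ^ 2 + ξ.2.1 i ^ 2) * (1 / (rsq ξ ^ 2 + ξ.2.2 ^ 2)) := by
      intro i
      rw [gauge4]
      field_simp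
      ring
    rw [e1, Finset.sum_congr rfl fun i _ => e2 i, ← Finset.sum_mul, Finset.sum_add_distrib,
      mul_one_div]
    rfl
  unfold Rp iv
  rw [e]
  simp only [tilde, gauge4]

lemma crInv_eq (hn : 1 ≤ n) {u : H n → ℝ} (hu : IsCylindrical u) {ξ : H n} (h : 0 < rsq ξ) :
    rsq ξ ^ ((n : ℝ) / 2) * crInv u ξ = wr hn u (iv (Rp ξ)) := by
  have h0 : 0 < rsq ξ ^ 2 + ξ.2.2 ^ 2 := by positivity
  unfold crInv wr
  rw [gauge2n, cyl_pt hn hu (tilde ξ), Rp_tilde h0]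
  have : (iv (Rp ξ)).1 = rsq ξ / (rsq ξ ^ 2 + ξ.2.2 ^ 2) := rfl
  rw [this, div_rpow h.le h0.le]
  ring

lemma Rp_hRefl (l : ℝ) (ξ : H n) : Rp (hRefl l ξ) = rf l (Rp ξ) := by
  unfold Rp hRefl rf rsq
  simp only [Prod.mk.injEq, and_true]
  ring

lemma rsq_hRefl (l : ℝ) (ξ : H n) : rsq (hRefl l ξ) = rsq ξ := by
  unfold hRefl rsq
  simp only
  ring

lemma Ulam_eq (hn : 1 ≤ n) {u : H n → ℝ} (hu : IsCylindrical u) {ξ : H n} (h : 0 < rsq ξ) (l : ℝ) :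
    rsq ξ ^ ((n : ℝ) / 2) * Ulam u l ξ = Wl hn u l (iv (Rp ξ)) := by
  have hP : Rp ξ ∈ Pp := h
  have h2 : 0 < rsq (hRefl l ξ) := by rw [rsq_hRefl]; exact h
  have e2 := crInv_eq hn hu h2
  rw [rsq_hRefl, Rp_hRefl] at e2
  unfold Ulam Wl sg
  rw [iv_iv hP, mul_sub, e2, crInv_eq hn hu h]

lemma tilde_cont {ξ : H n} (h : 0 < rsq ξ ^ 2 + ξ.2.2 ^ 2) : ContinuousAt tilde ξ := by
  have c := (rsq_cont (n := n))
  unfold tilde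
  simp only [gauge4]
  refine ContinuousAt.prodMk ?_ (ContinuousAt.prodMk ?_ ?_)
  · refine continuousAt_pi.2 fun i => ContinuousAt.div ?_ ?_ h.ne'
    · exact Continuous.continuousAt (by fun_prop)
    · exact Continuous.continuousAt (by fun_prop)
  · refine continuousAt_pi.2 fun i => ContinuousAt.div ?_ ?_ h.ne'
    · exact Continuous.continuousAt (by fun_prop)
    · exact Continuous.continuousAt (by fun_prop)
  · refine ContinuousAt.div ?_ ?_ h.ne'
    · exact Continuous.continuousAt (by fun_prop)
    · exact Continuous.continuousAt (by fun_prop)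

lemma crInv_cont {u : H n → ℝ} (cu : Continuous u) {ξ : H n} (h : 0 < rsq ξ ^ 2 + ξ.2.2 ^ 2) :
    ContinuousAt (crInv u) ξ := by
  have c := (rsq_cont (n := n))
  unfold crInv
  simp only [gauge2n]
  refine ContinuousAt.div (cu.continuousAt.comp (tilde_cont h)) ?_ (rpow_pos_of_pos h _).ne'
  exact ContinuousAt.rpow_const (Continuous.continuousAt (by fun_prop)) (Or.inl h.ne')

lemma rsq_zero {ξ : H n} (h : rsq ξ = 0) : ξ = (0, 0, ξ.2.2) := by
  unfold rsq at h
  have a1 : 0 ≤ ∑ i, (ξ.1 i) ^ 2 := Finset.sum_nonneg fun i _ => sq_nonneg _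
  have a2 : 0 ≤ ∑ i, (ξ.2.1 i) ^ 2 := Finset.sum_nonneg fun i _ => sq_nonneg _
  have b1 : ∑ i, (ξ.1 i) ^ 2 = 0 := by linarith
  have b2 : ∑ i, (ξ.2.1 i) ^ 2 = 0 := by linarith
  rw [Finset.sum_eq_zero_iff_of_nonneg fun i _ => sq_nonneg _] at b1 b2
  refine Prod.ext (funext fun i => ?_) (Prod.ext (funext fun i => ?_) rfl)
  · simpa using b1 i (Finset.mem_univ i)
  · simpa using b2 i (Finset.mem_univ i)

lemma Ulam_mem (hn : 1 ≤ n) {u : H n → ℝ} (cu : Continuous u) {l : ℝ} (hl : 0 < l) {S : Set ℝ}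
    (hS : IsClosed S) (h : ∀ ξ ∈ Sig (n := n) l, 0 < rsq ξ → Ulam u l ξ ∈ S) :
    ∀ ξ ∈ Sig (n := n) l, ξ ≠ zl l → Ulam u l ξ ∈ S := by
  intro ξ hξ hne
  rcases (rsq_nonneg ξ).lt_or_eq with h0 | h0
  · exact h ξ hξ h0
  have e := rsq_zero h0.symm
  have ht : l < ξ.2.2 := hξ
  have ht0 : ξ.2.2 ≠ 0 := by linarith
  have ht2 : 2 * l - ξ.2.2 ≠ 0 := by
    intro hc
    apply hne
    rw [e, zl]
    have : ξ.2.2 = 2 * l := by linarith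
    rw [this]
  have c1 : ContinuousAt (crInv u) ξ := crInv_cont cu (by positivity)
  have c2 : ContinuousAt (crInv u) (hRefl l ξ) := crInv_cont cu (by
    have : (hRefl l ξ).2.2 = 2 * l - ξ.2.2 := rfl
    rw [this]; positivity)
  have c3 : ContinuousAt (hRefl (n := n) l) ξ := by
    unfold hRefl; exact Continuous.continuousAt (by fun_prop)
  have c4 : ContinuousAt (Ulam u l) ξ := c1.sub (c2.comp c3)
  have e2 : pt hn (0, ξ.2.2) = ξ := by
    rw [e]; simp [pt]
  have c5 : Tendsto (fun x : ℝ => pt hn (x, ξ.2.2)) (𝓝[>] 0) (𝓝 ξ) := by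
    have : Continuous fun x : ℝ => pt hn (x, ξ.2.2) := (pt_cont hn).comp (by fun_prop)
    have t := this.tendsto 0
    rw [e2] at t
    exact t.mono_left nhdsWithin_le_nhds
  refine hS.mem_of_tendsto (c4.tendsto.comp c5) ?_
  filter_upwards [self_mem_nhdsWithin] with x hx
  have hx : 0 < x := hx
  refine h _ ?_ ?_
  · exact hξ
  · rw [rsq_pt hn (le_of_lt hx)]; exact hx

lemma trans_back (hn : 1 ≤ n) {u : H n → ℝ} (hu : IsCylindrical u) {l : ℝ} (hl : 0 < l)
    (h : ∀ ξ ∈ Sig (n := n) l, ξ ≠ zl l → Ulam u l ξ ≤ 0) : ∀ p ∈ Dl l, Wl hn u l p ≤ 0 := by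
  intro p hp
  have hP := Dl_sub l hp
  have hi := iv_mem hP
  have e : Rp (pt hn (iv p)) = iv p := by
    unfold Rp
    rw [rsq_pt hn (le_of_lt (Pp_pos hi))]
    rfl
  have hr : 0 < rsq (pt hn (iv p)) := by
    rw [rsq_pt hn (le_of_lt (Pp_pos hi))]; exact hi
  have hU := Ulam_eq hn hu hr l
  rw [e, iv_iv hP] at hU
  rw [← hU]
  refine mul_nonpos_of_nonneg_of_nonpos (by positivity) (h _ ?_ ?_)
  · have := (mem_Dl_iv (l := l) hi)
    rw [iv_iv hP] at this
    exact this.1 hp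
  · intro hc
    rw [hc] at hr
    simp [zl, rsq] at hr

lemma trans_le (hn : 1 ≤ n) {u : H n → ℝ} (cu : Continuous u) (hu : IsCylindrical u) {l : ℝ} (hl : 0 < l)
    (h : ∀ p ∈ Dl l, Wl hn u l p ≤ 0) : ∀ ξ ∈ Sig (n := n) l, ξ ≠ zl l → Ulam u l ξ ≤ 0 := by
  refine Ulam_mem hn cu hl (S := Iic 0) isClosed_Iic fun ξ hξ hr => ?_
  have hP : Rp ξ ∈ Pp := hr
  have h1 := h _ ((mem_Dl_iv hP).2 hξ)
  rw [← Ulam_eq hn hu hr l] at h1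
  have : 0 < rsq ξ ^ ((n : ℝ) / 2) := by positivity
  exact nonpos_of_mul_nonpos_right h1 this

lemma trans_eq (hn : 1 ≤ n) {u : H n → ℝ} (cu : Continuous u) (hu : IsCylindrical u) {l : ℝ} (hl : 0 < l)
    (h : ∀ p ∈ Dl l, Wl hn u l p = 0) : ∀ ξ ∈ Sig (n := n) l, ξ ≠ zl l → Ulam u l ξ = 0 := by
  refine Ulam_mem hn cu hl (S := {0}) isClosed_singleton fun ξ hξ hr => ?_
  have hP : Rp ξ ∈ Pp := hr
  have h1 := h _ ((mem_Dl_iv hP).2 hξ)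
  rw [← Ulam_eq hn hu hr l] at h1
  have : 0 < rsq ξ ^ ((n : ℝ) / 2) := by positivity
  rcases mul_eq_zero.1 h1 with h2 | h2
  · exact absurd h2 this.ne'
  · exact h2

/-! ### The moving plane argument -/

lemma dichotomy {m : ℝ} {l : ℝ} (hl : 0 < l) {W G : ℝ × ℝ → ℝ} (cW : ContinuousOn W Pp) (cG : ContinuousOn G Pp)
    (hw : ∀ p ∈ Pp, ∀ η, 0 < η → WeakRad m p η W G) (hW : ∀ p ∈ Dl l, W p ≤ 0)
    (hG : ∀ p ∈ Dl l, 0 ≤ G p) : (∀ p ∈ Dl l, W p = 0 ∧ G p = 0) ∨ ∀ p ∈ Dl l, W p < 0 := by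
  have hv : ∀ p ∈ Dl l, W p = 0 → (∀ᶠ q in 𝓝 p, W q = 0) ∧ G p = 0 := fun p hp h0 =>
    visc (Dl_sub l hp) cW cG (hw p (Dl_sub l hp)) ((isOpen_Dl l).mem_nhds hp) hW hG h0
  have o1 : IsOpen (interior {p | W p = 0}) := isOpen_interior
  have o2 : IsOpen (Dl l ∩ W ⁻¹' Iio 0) :=
    (cW.mono (Dl_sub l)).isOpen_inter_preimage (isOpen_Dl l) isOpen_Iio
  have hd : Disjoint (interior {p | W p = 0}) (Dl l ∩ W ⁻¹' Iio 0) := by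
    rw [Set.disjoint_left]
    intro p h1 h2
    have h3 : W p = 0 := (interior_subset h1 : p ∈ {p | W p = 0})
    have h4 : W p < 0 := h2.2
    linarith
  have hsub : Dl l ⊆ interior {p | W p = 0} ∪ (Dl l ∩ W ⁻¹' Iio 0) := by
    intro p hp
    rcases (hW p hp).lt_or_eq with h | h
    · exact Or.inr ⟨hp, h⟩
    · exact Or.inl (mem_interior_iff_mem_nhds.2 (hv p hp h).1)
  rcases (convex_Dl hl).isPreconnected.subset_or_subset o1 o2 hd hsub with h | h
  · left
    intro p hp
    have h0 : W p = 0 := (interior_subset (h hp) : p ∈ {p | W p = 0})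
    exact ⟨h0, (hv p hp h0).2⟩
  · right
    exact fun p hp => (h hp).2

lemma sg_joint : ContinuousOn (fun x : ℝ × ℝ × ℝ => sg x.1 x.2) {x | x.2 ∈ Pp} := by
  have c1 : ContinuousOn (fun x : ℝ × ℝ × ℝ => iv x.2) {x | x.2 ∈ Pp} :=
    isIso_iv.cont.comp (by fun_prop) fun x hx => hx
  have c2 : ContinuousOn (fun x : ℝ × ℝ × ℝ => rf x.1 (iv x.2)) {x | x.2 ∈ Pp} := by
    unfold rf
    exact (c1.fst).prodMk ((continuousOn_const.mul continuousOn_fst).sub c1.snd)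
  exact isIso_iv.cont.comp c2 fun x hx => (isIso_rf x.1).maps _ (isIso_iv.maps _ hx)

lemma Wl_joint (hn : 1 ≤ n) {u : H n → ℝ} (cu : Continuous u) :
    ContinuousOn (fun x : ℝ × ℝ × ℝ => Wl hn u x.1 x.2) {x | x.2 ∈ Pp} := by
  unfold Wl
  refine ContinuousOn.sub ((wr_cont hn cu).comp (by fun_prop) fun x hx => hx) ?_
  exact (wr_cont hn cu).comp sg_joint fun x hx => (isIso_sg x.1).maps _ hx

lemma near (hn : 1 ≤ n) {u : H n → ℝ} (cu : Continuous u) {lo l1 N σ : ℝ} (hlo : 0 < lo) (hN : 0 < N)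
    (hσ : 0 < σ) (hneg : ∀ p ∈ Dl l1, Wl hn u l1 p < 0) :
    ∃ ε : ℝ, 0 < ε ∧ ∀ l, lo ≤ l → l ≤ l1 → l1 - ε < l → ∀ p ∈ Dl l, σ ≤ p.1 → Qf l p ≤ -(1 / N) →
      Wl hn u l p < 0 := by
  set E : Set (ℝ × ℝ × ℝ) := (Icc lo l1 ×ˢ (Icc (0 : ℝ) (1 / lo) ×ˢ Icc (-(1 / lo)) (0 : ℝ))) ∩
    {x | σ ≤ x.2.1 ∧ Qf x.1 x.2 ≤ -(1 / N)} with hE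
  have cE : IsClosed {x : ℝ × ℝ × ℝ | σ ≤ x.2.1 ∧ Qf x.1 x.2 ≤ -(1 / N)} := by
    have c1 : Continuous fun x : ℝ × ℝ × ℝ => x.2.1 := by fun_prop
    have c2 : Continuous fun x : ℝ × ℝ × ℝ => Qf x.1 x.2 := by unfold Qf; fun_prop
    exact (isClosed_le continuous_const c1).inter (isClosed_le c2 continuous_const)
  have kE : IsCompact E := (isCompact_Icc.prod (isCompact_Icc.prod isCompact_Icc)).inter_right cE
  have sE : E ⊆ {x | x.2 ∈ Pp} := fun x hx => hσ.trans_le hx.2.1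
  have cB : IsClosed (E ∩ (fun x : ℝ × ℝ × ℝ => Wl hn u x.1 x.2) ⁻¹' Ici 0) :=
    ((Wl_joint hn cu).mono sE).preimage_isClosed_of_isClosed kE.isClosed isClosed_Ici
  have kB := kE.of_isClosed_subset cB inter_subset_left
  have kI := (kB.image continuous_fst).isClosed
  have hnot : l1 ∉ Prod.fst '' (E ∩ (fun x : ℝ × ℝ × ℝ => Wl hn u x.1 x.2) ⁻¹' Ici 0) := by
    rintro ⟨x, ⟨hx1, hx2⟩, rfl⟩
    have h1 : 0 ≤ Wl hn u x.1 x.2 := hx2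
    have h2 : Qf x.1 x.2 ≤ -(1 / N) := hx1.2.2
    have h3 : 0 < 1 / N := by positivity
    have := hneg x.2 ⟨sE hx1, by linarith⟩
    linarith
  obtain ⟨ε, hε, hb⟩ := Metric.isOpen_iff.1 kI.isOpen_compl l1 hnot
  refine ⟨ε, hε, fun l h1 h2 h3 p hp h4 h5 => ?_⟩
  by_contra hc
  push Not at hc
  have hm : l ∈ Metric.ball l1 ε := by
    rw [Metric.mem_ball, Real.dist_eq, abs_lt]
    constructor <;> linarith
  refine hb hm ⟨(l, p), ⟨⟨⟨⟨h1, h2⟩, Dl_box hlo h1 hp⟩, ⟨h4, h5⟩⟩, hc⟩, rfl⟩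

lemma degenerate (hn : 1 ≤ n) {u v : H n → ℝ} {f g : ℝ → ℝ} (h : Sol u v f) (h' : Sol v u g)
    (h0 : ∀ t, 0 < t → f t = 0) : ∀ l, 0 < l → ∀ p ∈ Dl l, Wl hn u l p ≤ 0 ∧ Wl hn v l p ≤ 0 := by
  have hu : ∀ l, 0 < l → ∀ p ∈ Dl l, Wl hn u l p ≤ 0 := fun l hl => by
    refine h.zero_case hn (fun l _ p _ => ?_) hl
    simp only [Gl, Ar, h0 _ (h.pv _)]
    simp
  have hv : ∀ l, 0 < l → ∀ p ∈ Dl l, Wl hn v l p ≤ 0 := fun l hl =>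
    h'.zero_case hn (fun l hl p hp => h'.Gl_nonneg hn hl hp (hu l hl p hp)) hl
  exact fun l hl p hp => ⟨hu l hl p hp, hv l hl p hp⟩

lemma Dl_nonempty (l : ℝ) : ∃ p, p ∈ Dl l := by
  have : ((1 : ℝ), l + 1) ∈ Pp := show (0 : ℝ) < 1 by norm_num
  exact ⟨iv (1, l + 1), (mem_Dl_iv this).2 (by simp)⟩

lemma limit_le (hn : 1 ≤ n) {u : H n → ℝ} (cu : Continuous u) {l1 : ℝ}
    (h : ∀ l, l1 < l → ∀ p ∈ Dl l, Wl hn u l p ≤ 0) : ∀ p ∈ Dl l1, Wl hn u l1 p ≤ 0 := by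
  intro p hp
  have hP := Dl_sub l1 hp
  have c : Continuous fun l : ℝ => Wl hn u l p := by
    rw [← continuousOn_univ]
    exact (Wl_joint hn cu).comp (f := fun l : ℝ => ((l, p) : ℝ × ℝ × ℝ)) (by fun_prop) fun l _ => hP
  have cq : Continuous fun l : ℝ => Qf l p := by unfold Qf; fun_prop
  refine le_of_tendsto ((c.tendsto l1).mono_left (nhdsWithin_le_nhds (s := Ioi l1))) ?_
  have e1 : ∀ᶠ l in 𝓝[>] l1, Qf l p < 0 :=
    ((cq.tendsto l1).mono_left nhdsWithin_le_nhds).eventually (gt_mem_nhds hp.2)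
  filter_upwards [self_mem_nhdsWithin, e1] with l h1 h2
  exact h l h1 p ⟨hp.1, h2⟩

/-- The moving plane step in reduced form. -/
lemma reduced (hn : 1 ≤ n) {u v : H n → ℝ} {f g : ℝ → ℝ} (h : Sol u v f) (h' : Sol v u g) {l1 : ℝ}
    (hl : 0 < l1) (hpos : ∀ l, l1 < l → ∀ p ∈ Dl l, Wl hn u l p ≤ 0 ∧ Wl hn v l p ≤ 0)
    (hmin : ∀ l, 0 < l → l < l1 → ¬ ∀ m, l ≤ m → ∀ p ∈ Dl m, Wl hn u m p ≤ 0 ∧ Wl hn v m p ≤ 0) :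
    ∀ p ∈ Dl l1, Wl hn u l1 p = 0 ∧ Wl hn v l1 p = 0 := by
  have wu := limit_le hn h.cu fun l hl p hp => (hpos l hl p hp).1
  have wv := limit_le hn h.cv fun l hl p hp => (hpos l hl p hp).2
  have du := dichotomy hl (Wl_cont hn h.cu l1) (h.cG hn l1) (h.weak hn l1) wu
    fun p hp => h.Gl_nonneg hn hl hp (wv p hp)
  have dv := dichotomy hl (Wl_cont hn h.cv l1) (h'.cG hn l1) (h'.weak hn l1) wv
    fun p hp => h'.Gl_nonneg hn hl hp (wu p hp)
  obtain ⟨q, hq⟩ := Dl_nonempty l1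
  rcases du with du | du <;> rcases dv with dv | dv
  · exact fun p hp => ⟨(du p hp).1, (dv p hp).1⟩
  · exfalso
    have h0 := h.Gl_eq hn hl hq (dv q hq) (du q hq).2
    have := degenerate hn h h' h0
    exact hmin (l1 / 2) (by linarith) (by linarith) fun m hm => this m (by linarith)
  · exfalso
    have h0 := h'.Gl_eq hn hl hq (du q hq) (dv q hq).2
    have := degenerate hn h' h h0
    exact hmin (l1 / 2) (by linarith) (by linarith) fun m hm p hp => (this m (by linarith) p hp).symm
  · exfalso
    have hlo : 0 < l1 / 2 := by linarith
    obtain ⟨N, σ, hN, hσ, hj⟩ := joint_barrier hn h h' (hi := l1) hlo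
    obtain ⟨ε1, he1, n1⟩ := near hn h.cu hlo hN hσ du
    obtain ⟨ε2, he2, n2⟩ := near hn h.cv hlo hN hσ dv
    have hlt : max (l1 / 2) (l1 - min ε1 ε2 / 2) < l1 := by
      have : 0 < min ε1 ε2 := lt_min he1 he2
      exact max_lt (by linarith) (by linarith)
    refine hmin _ (hlo.trans_le (le_max_left _ _)) hlt fun m hm => ?_
    rcases lt_or_ge l1 m with h1 | h1
    · exact hpos m h1
    · have a1 : l1 / 2 ≤ m := (le_max_left _ _).trans hm
      have a2 : l1 - min ε1 ε2 / 2 ≤ m := (le_max_right _ _).trans hm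
      have a3 : 0 < min ε1 ε2 := lt_min he1 he2
      have a4 := min_le_left ε1 ε2
      have a5 := min_le_right ε1 ε2
      exact hj m a1 h1 fun p hp b1 b2 =>
        ⟨(n1 m a1 h1 (by linarith) p hp b1 b2).le, (n2 m a1 h1 (by linarith) p hp b1 b2).le⟩

end

/-- **Lemma 3.4.** Under the assumptions of Theorem 1.1, let
`λ₁ = inf{λ > 0 : U_μ ≤ 0 and V_μ ≤ 0 on Σ_μ ∖ {0_μ} for all μ ≥ λ}`.
If `λ₁ > 0`, then `U_{λ₁} ≡ 0` and `V_{λ₁} ≡ 0` on `Σ_{λ₁} ∖ {0_{λ₁}}`. -/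
theorem critical_plane_symmetry (n : ℕ) (hn : 1 ≤ n)
    (u v : H n → ℝ) (f g : ℝ → ℝ)
    (hu_cont : Continuous u) (hv_cont : Continuous v)
    (hu_pos : ∀ ξ, 0 < u ξ) (hv_pos : ∀ ξ, 0 < v ξ)
    (hu_cyl : IsCylindrical u) (hv_cyl : IsCylindrical v)
    (hu_sol : IsWeakSol Set.univ u (fun ξ => f (v ξ)))
    (hv_sol : IsWeakSol Set.univ v (fun ξ => g (u ξ)))
    (hf_cont : ContinuousOn f (Set.Ici 0))
    (hg_cont : ContinuousOn g (Set.Ici 0))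
    (hf_mono : ∀ s t : ℝ, 0 < s → s ≤ t → f s ≤ f t)
    (hg_mono : ∀ s t : ℝ, 0 < s → s ≤ t → g s ≤ g t)
    (hh_anti : ∀ s t : ℝ, 0 < s → s ≤ t → f t / t ^ tau n ≤ f s / s ^ tau n)
    (hk_anti : ∀ s t : ℝ, 0 < s → s ≤ t → g t / t ^ tau n ≤ g s / s ^ tau n)
    (l₁ : ℝ)
    (hl₁ : l₁ = sInf {l : ℝ | 0 < l ∧ ∀ m : ℝ, l ≤ m →
      ∀ ξ ∈ Sig (n := n) m, ξ ≠ zl m → Ulam u m ξ ≤ 0 ∧ Ulam v m ξ ≤ 0})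
    (hl₁_pos : 0 < l₁) :
    ∀ ξ ∈ Sig (n := n) l₁, ξ ≠ zl l₁ → Ulam u l₁ ξ = 0 ∧ Ulam v l₁ ξ = 0 := by
  have h : Sol u v f :=
    ⟨hu_cont, hv_cont, hu_pos, hv_pos, hu_cyl, hv_cyl, hu_sol, ⟨hf_cont, hf_mono, hh_anti⟩⟩
  have h' : Sol v u g :=
    ⟨hv_cont, hu_cont, hv_pos, hu_pos, hv_cyl, hu_cyl, hv_sol, ⟨hg_cont, hg_mono, hk_anti⟩⟩
  set S : Set ℝ := {l : ℝ | 0 < l ∧ ∀ m : ℝ, l ≤ m →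
      ∀ ξ ∈ Sig (n := n) m, ξ ≠ zl m → Ulam u m ξ ≤ 0 ∧ Ulam v m ξ ≤ 0} with hS
  have hne : S.Nonempty := by
    by_contra hc
    rw [Set.not_nonempty_iff_eq_empty] at hc
    rw [hc, Real.sInf_empty] at hl₁
    linarith
  have hbd : BddBelow S := ⟨0, fun x hx => hx.1.le⟩
  have key := reduced hn h h' hl₁_pos (fun l hl => ?_) (fun l h0 hl hall => ?_)
  · intro ξ hξ hz
    exact ⟨trans_eq hn hu_cont hu_cyl hl₁_pos (fun p hp => (key p hp).1) ξ hξ hz,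
      trans_eq hn hv_cont hv_cyl hl₁_pos (fun p hp => (key p hp).2) ξ hξ hz⟩
  · rw [hl₁] at hl
    obtain ⟨l', hl', hlt⟩ := exists_lt_of_csInf_lt hne hl
    have hlp : 0 < l := hl'.1.trans hlt
    have b := hl'.2 l hlt.le
    intro p hp
    exact ⟨trans_back hn hu_cyl hlp (fun ξ hξ hz => (b ξ hξ hz).1) p hp,
      trans_back hn hv_cyl hlp (fun ξ hξ hz => (b ξ hξ hz).2) p hp⟩
  · have hmem : l ∈ S := by
      refine ⟨h0, fun m hm ξ hξ hz => ?_⟩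
      have hmp : 0 < m := h0.trans_le hm
      exact ⟨trans_le hn hu_cont hu_cyl hmp (fun p hp => (hall m hm p hp).1) ξ hξ hz,
        trans_le hn hv_cont hv_cyl hmp (fun p hp => (hall m hm p hp).2) ξ hξ hz⟩
    have := csInf_le hbd hmem
    rw [← hl₁] at this
    linarith

end Heisenberg
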